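/- Let N ≥ 2, n ≥ 1, and let Ω ⊂ ℝ^N be a bounded Lipschitz domain. For each s ∈ (0,1), let u_n^{(s)} ∈ H^s_{Ω,0} satisfy ‖u_n^{(s)}‖_{L²(Ω)} = 1, ∫_Ω u_n^{(s)} dx = 0, and (c_{N,s}/2)∬_{ℝ^{2N}\(Ω^c×Ω^c)}(u_n^{(s)}(x)−u_n^{(s)}(y))(v(x)−v(y))/|x−y|^{N+2s} dx dy = μ_n^{(s)}(Ω) ∫_Ω u_n^{(s)} v dx for all v ∈ H^s_{Ω,0}. Then there exists an increasing sequence s_k → 1⁻ and a function u_n^{(1)} ∈ H¹(Ω) with ‖u_n^{(1)}‖_{L²(Ω)} = 1 satisfying ∫_Ω ∇u_n^{(1)}·∇v dx = μ_n^{(1)}(Ω) ∫_Ω u_n^{(1)} v dx for all v ∈ H¹(Ω), such that ‖u_n^{(s_k)} − u_n^{(1)}‖_{L²(Ω)} → 0 as k → ∞. -/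

import Mathlib

open MeasureTheory Filter Topology Bornology Set
open scoped ENNReal NNReal

noncomputable section

namespace FracNeumann

abbrev Euc (N : ℕ) : Type := EuclideanSpace ℝ (Fin N)

/-- The kernel weight `|x - y| ^ (N + 2s)`. -/
def kern (N : ℕ) (s : ℝ) (x y : Euc N) : ℝ := ‖x - y‖ ^ ((N : ℝ) + 2 * s)

/-- The region `ℝ^{2N} \ (Ω^c × Ω^c)`, where `Ω^c := ℝ^N \ closure Ω`. -/
def reg (N : ℕ) (Ω : Set (Euc N)) : Set (Euc N × Euc N) :=
  {q | q.1 ∈ closure Ω ∨ q.2 ∈ closure Ω}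

/-- The squared seminorm `[u]_{H^s_{Ω,0}}²`, as an extended real number. -/
def semiSq (N : ℕ) (s : ℝ) (Ω : Set (Euc N)) (u : Euc N → ℝ) : ℝ≥0∞ :=
  ∫⁻ q in reg N Ω, ENNReal.ofReal ((u q.1 - u q.2) ^ 2 / kern N s q.1 q.2)

/-- `∫_Ω u²`, as an extended real number. -/
def l2sq (N : ℕ) (Ω : Set (Euc N)) (u : Euc N → ℝ) : ℝ≥0∞ :=
  ∫⁻ x in Ω, ENNReal.ofReal ((u x) ^ 2)

/-- Membership in `H^s_{Ω,0}`. -/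
def memHs (N : ℕ) (s : ℝ) (Ω : Set (Euc N)) (u : Euc N → ℝ) : Prop :=
  Measurable u ∧ l2sq N Ω u < ⊤ ∧ semiSq N s Ω u < ⊤

/-- The squared Gagliardo seminorm `[u]_{H^s(Ω)}²`. -/
def semiSqOn (N : ℕ) (s : ℝ) (Ω : Set (Euc N)) (u : Euc N → ℝ) : ℝ≥0∞ :=
  ∫⁻ q in Ω ×ˢ Ω, ENNReal.ofReal ((u q.1 - u q.2) ^ 2 / kern N s q.1 q.2)

/-- Membership in `H^s(Ω)` (for functions defined on all of `ℝ^N`). -/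
def memHsOn (N : ℕ) (s : ℝ) (Ω : Set (Euc N)) (u : Euc N → ℝ) : Prop :=
  Measurable u ∧ l2sq N Ω u < ⊤ ∧ semiSqOn N s Ω u < ⊤

/-- The normalizing constant `c_{N,s}` of the fractional Laplacian. -/
def cNs (N : ℕ) (s : ℝ) : ℝ :=
  (4 : ℝ) ^ s * s * Real.Gamma ((N : ℝ) / 2 + s) /
    (Real.pi ^ ((N : ℝ) / 2) * Real.Gamma (1 - s))

/-- The nonlocal Neumann derivative `𝒩_s u`. -/
def Nneu (N : ℕ) (s : ℝ) (Ω : Set (Euc N)) (u : Euc N → ℝ) (x : Euc N) : ℝ :=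
  cNs N s * ∫ y in Ω, (u x - u y) / kern N s x y

/-- Membership in `H̃^s_{Ω,0}`: members of `H^s_{Ω,0}` with `𝒩_s u = 0` a.e. in `Ω^c`. -/
def memHsTilde (N : ℕ) (s : ℝ) (Ω : Set (Euc N)) (u : Euc N → ℝ) : Prop :=
  memHs N s Ω u ∧ ∀ᵐ x ∂(volume.restrict (closure Ω)ᶜ), Nneu N s Ω u x = 0

/-- The first nontrivial Neumann eigenvalue `μ₁^{(s)}(Ω)`. -/
def mu1 (N : ℕ) (s : ℝ) (Ω : Set (Euc N)) : ℝ :=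
  sInf {t : ℝ | ∃ u : Euc N → ℝ, memHs N s Ω u ∧ (∫ x in Ω, (u x) ^ 2) = 1 ∧
    (∫ x in Ω, u x) = 0 ∧ t = cNs N s / 2 * (semiSq N s Ω u).toReal}

/-- The bilinear form (without the constant). -/
def bform (N : ℕ) (s : ℝ) (Ω : Set (Euc N)) (u v : Euc N → ℝ) : ℝ :=
  ∫ q in reg N Ω, (u q.1 - u q.2) * (v q.1 - v q.2) / kern N s q.1 q.2

/-- First nontrivial eigenfunction: weak solution associated to `μ₁^{(s)}(Ω)`. -/
def IsFirstEigen (N : ℕ) (s : ℝ) (Ω : Set (Euc N)) (u : Euc N → ℝ) : Prop :=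
  memHs N s Ω u ∧ ¬ (u =ᵐ[volume.restrict Ω] 0) ∧ (∫ x in Ω, u x) = 0 ∧
    ∀ v : Euc N → ℝ, memHs N s Ω v →
      cNs N s / 2 * bform N s Ω u v = mu1 N s Ω * ∫ x in Ω, u x * v x

/-- Reflection `σ_e(x) = x - 2(x·e)e` across the hyperplane `{x·e = 0}`. -/
def reflect (N : ℕ) (e x : Euc N) : Euc N := x - (2 * (inner ℝ x e : ℝ)) • e

/-- The polarization `P_e u` with respect to the hyperplane `{x·e = 0}`. -/
def polarize (N : ℕ) (e : Euc N) (u : Euc N → ℝ) (x : Euc N) : ℝ :=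
  if 0 ≤ (inner ℝ x e : ℝ) then min (u x) (u (reflect N e x))
  else max (u x) (u (reflect N e x))

/-- Foliated Schwarz symmetry with respect to `p`. -/
def FoliatedSchwarz (N : ℕ) (p : Euc N) (u : Euc N → ℝ) : Prop :=
  ∃ uh : ℝ → ℝ → ℝ, (∀ r : ℝ, AntitoneOn (uh r) (Icc 0 Real.pi)) ∧
    ∀ x : Euc N, x ≠ 0 → u x = uh ‖x‖ (Real.arccos ((inner ℝ x p : ℝ) / ‖x‖))

/-- Radial symmetry (pointwise). -/
def Radial (N : ℕ) (u : Euc N → ℝ) : Prop := ∃ f : ℝ → ℝ, ∀ x, u x = f ‖x‖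

/-- Radial symmetry (a.e.). -/
def RadialAE (N : ℕ) (u : Euc N → ℝ) : Prop :=
  ∃ f : ℝ → ℝ, ∀ᵐ x : Euc N ∂volume, u x = f ‖x‖

/-- The set `{x ∈ Ω : u x ≠ 0}` has exactly two connected components. -/
def TwoNodal (N : ℕ) (Ω : Set (Euc N)) (u : Euc N → ℝ) : Prop :=
  Nat.card (ConnectedComponents {x : Euc N // x ∈ Ω ∧ u x ≠ 0}) = 2

/-- Bounded Lipschitz domain: open, bounded, connected, and near every boundary point the set
is the region above the graph of a Lipschitz function in some direction `e`. -/
def IsLipschitzDomain (N : ℕ) (Ω : Set (Euc N)) : Prop :=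
  IsOpen Ω ∧ IsBounded Ω ∧ IsConnected Ω ∧
    ∀ x ∈ frontier Ω, ∃ e : Euc N, ‖e‖ = 1 ∧ ∃ r : ℝ, 0 < r ∧
      ∃ (L : NNReal) (f : Euc N → ℝ), LipschitzWith L f ∧
        ∀ y ∈ Metric.ball x r,
          (y ∈ Ω ↔ f (y - ((inner ℝ y e : ℝ)) • e) < (inner ℝ y e : ℝ))

/-- `g` is a weak gradient of `u` in `Ω`, square-integrable on `Ω`. -/
def IsWeakGradient (N : ℕ) (Ω : Set (Euc N)) (u : Euc N → ℝ) (g : Euc N → Euc N) : Prop :=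
  Measurable g ∧ (∫⁻ x in Ω, ENNReal.ofReal (‖g x‖ ^ 2)) < ⊤ ∧
    ∀ φ : Euc N → ℝ, ContDiff ℝ (⊤ : ℕ∞) φ → HasCompactSupport φ → tsupport φ ⊆ Ω →
      ∀ i : Fin N, (∫ x in Ω, u x * fderiv ℝ φ x (EuclideanSpace.single i 1)) =
        - ∫ x in Ω, g x i * φ x

/-- Membership in `H¹(Ω)`. -/
def memH1 (N : ℕ) (Ω : Set (Euc N)) (u : Euc N → ℝ) : Prop :=
  Measurable u ∧ l2sq N Ω u < ⊤ ∧ ∃ g, IsWeakGradient N Ω u g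

/-- `∫_Ω |∇u|²`, as an extended real number. -/
def gradSq (N : ℕ) (Ω : Set (Euc N)) (u : Euc N → ℝ) : ℝ≥0∞ :=
  ⨅ (g : Euc N → Euc N) (_ : IsWeakGradient N Ω u g), ∫⁻ x in Ω, ENNReal.ofReal (‖g x‖ ^ 2)

/-- Rayleigh quotient for the fractional Neumann problem. -/
def rayleighS (N : ℕ) (s : ℝ) (Ω : Set (Euc N)) (u : Euc N → ℝ) : ℝ≥0∞ :=
  ENNReal.ofReal (cNs N s / 2) * semiSq N s Ω u / l2sq N Ω u

/-- Rayleigh quotient for the local Neumann problem. -/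
def rayleigh1 (N : ℕ) (Ω : Set (Euc N)) (u : Euc N → ℝ) : ℝ≥0∞ :=
  gradSq N Ω u / l2sq N Ω u

/-- The min-max value `μ_n^{(s)}(Ω)` over `n`-dimensional subspaces of `H^s_{Ω,0} ∩ L²₀(Ω)`. -/
def muNs (N : ℕ) (s : ℝ) (Ω : Set (Euc N)) (n : ℕ) : ℝ≥0∞ :=
  ⨅ (A : Submodule ℝ (Euc N → ℝ)) (_ : Module.finrank ℝ A = n ∧
      (∀ u ∈ A, memHs N s Ω u ∧ (∫ x in Ω, u x) = 0) ∧
      (∀ u ∈ A, u =ᵐ[(volume : Measure (Euc N))] 0 → u = 0)),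
    ⨆ (u : Euc N → ℝ) (_ : u ∈ A ∧ u ≠ 0), rayleighS N s Ω u

/-- The min-max value over `n`-dimensional subspaces of `H̃^s_{Ω,0} ∩ L²₀(Ω)`. -/
def muNsTilde (N : ℕ) (s : ℝ) (Ω : Set (Euc N)) (n : ℕ) : ℝ≥0∞ :=
  ⨅ (A : Submodule ℝ (Euc N → ℝ)) (_ : Module.finrank ℝ A = n ∧
      (∀ u ∈ A, memHsTilde N s Ω u ∧ (∫ x in Ω, u x) = 0) ∧
      (∀ u ∈ A, u =ᵐ[(volume : Measure (Euc N))] 0 → u = 0)),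
    ⨆ (u : Euc N → ℝ) (_ : u ∈ A ∧ u ≠ 0), rayleighS N s Ω u

/-- The min-max value `μ_n^{(1)}(Ω)` over `n`-dimensional subspaces of `H¹(Ω) ∩ L²₀(Ω)`. -/
def muN1 (N : ℕ) (Ω : Set (Euc N)) (n : ℕ) : ℝ≥0∞ :=
  ⨅ (A : Submodule ℝ (Euc N → ℝ)) (_ : Module.finrank ℝ A = n ∧
      (∀ u ∈ A, memH1 N Ω u ∧ (∫ x in Ω, u x) = 0) ∧
      (∀ u ∈ A, u =ᵐ[volume.restrict Ω] 0 → u = 0)),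
    ⨆ (u : Euc N → ℝ) (_ : u ∈ A ∧ u ≠ 0), rayleigh1 N Ω u

/-- `μ_n^{(s)}(Ω)` including `μ₀^{(s)}(Ω) := 0`. -/
def muNsFull (N : ℕ) (s : ℝ) (Ω : Set (Euc N)) (n : ℕ) : ℝ≥0∞ :=
  if n = 0 then 0 else muNs N s Ω n

/-- `μ_n^{(1)}(Ω)` including `μ₀^{(1)}(Ω) := 0`. -/
def muN1Full (N : ℕ) (Ω : Set (Euc N)) (n : ℕ) : ℝ≥0∞ :=
  if n = 0 then 0 else muN1 N Ω n

/-- The squared `H^s_{Ω,0}`-seminorm of the `s`-minimal extension of `u`: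
the minimal value of `[v]²` over `v ∈ H^s_{Ω,0}` with `v = u` a.e. in `Ω`. -/
def minExtSemiSq (N : ℕ) (s : ℝ) (Ω : Set (Euc N)) (u : Euc N → ℝ) : ℝ≥0∞ :=
  ⨅ (v : Euc N → ℝ) (_ : memHs N s Ω v ∧ v =ᵐ[volume.restrict Ω] u), semiSq N s Ω v

/-- `ω_{N-1}`: volume of the unit ball of `ℝ^{N-1}`. -/
def omegaPrev (N : ℕ) : ℝ := (volume (Metric.ball (0 : Euc (N - 1)) 1)).toReal

/-- Membership in `L²₀(Ω)`. -/
def memL20 (N : ℕ) (Ω : Set (Euc N)) (u : Euc N → ℝ) : Prop :=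
  Measurable u ∧ l2sq N Ω u < ⊤ ∧ (∫ x in Ω, u x) = 0

/-- The functional `F_s` (value `+∞` outside `H^s(Ω)`). -/
def Fs (N : ℕ) (s : ℝ) (Ω : Set (Euc N)) (u : Euc N → ℝ) : ℝ≥0∞ :=
  ENNReal.ofReal (1 - s) * minExtSemiSq N s Ω u

/-- The functional `F₁` (value `+∞` outside `H¹(Ω)`). -/
def F1 (N : ℕ) (Ω : Set (Euc N)) (u : Euc N → ℝ) : ℝ≥0∞ :=
  ENNReal.ofReal (omegaPrev N / (2 * N)) * gradSq N Ω u

end FracNeumann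

namespace FracNeumann
set_option linter.all false
/-- volume of the unit ball -/
def bN (N : ℕ) : ℝ := (volume : Measure (Euc N)).real (Metric.ball 0 1)

lemma bN_eq (N : ℕ) (hN : 2 ≤ N) : bN N = Real.pi ^ ((N : ℝ) / 2) / Real.Gamma ((N : ℝ) / 2 + 1) := by
  haveI : Nonempty (Fin N) := ⟨⟨0, by omega⟩⟩
  have h := EuclideanSpace.volume_ball (Fin N) (0 : Euc N) 1
  have hG : 0 < Real.Gamma ((N : ℝ) / 2 + 1) := Real.Gamma_pos_of_pos (by positivity)
  unfold bN Measure.real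
  rw [h]
  simp only [ENNReal.ofReal_one, one_pow, one_mul, Fintype.card_fin]
  rw [ENNReal.toReal_ofReal (by positivity), Real.sqrt_eq_rpow, ← Real.rpow_natCast,
    ← Real.rpow_mul Real.pi_pos.le]
  congr 2
  ring

lemma bN_pos (N : ℕ) (hN : 2 ≤ N) : 0 < bN N := by
  rw [bN_eq N hN]
  have hG : 0 < Real.Gamma ((N : ℝ) / 2 + 1) := Real.Gamma_pos_of_pos (by positivity)
  have := Real.pi_pos
  positivity

lemma cNs_pos (N : ℕ) (s : ℝ) (hs : s ∈ Ioo (0 : ℝ) 1) : 0 < cNs N s := by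
  unfold cNs
  have h1 : 0 < Real.Gamma ((N : ℝ) / 2 + s) :=
    Real.Gamma_pos_of_pos (by have := hs.1; positivity)
  have h2 : 0 < Real.Gamma (1 - s) := Real.Gamma_pos_of_pos (by linarith [hs.2])
  have := Real.pi_pos
  have := hs.1
  positivity

lemma cNs_eq (N : ℕ) (s : ℝ) (hs : s ∈ Ioo (0 : ℝ) 1) :
    cNs N s = (1 - s) * ((4 : ℝ) ^ s * s * Real.Gamma ((N : ℝ) / 2 + s) /
      (Real.pi ^ ((N : ℝ) / 2) * Real.Gamma (2 - s))) := by
  have h2 : Real.Gamma (2 - s) = (1 - s) * Real.Gamma (1 - s) := by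
    have := Real.Gamma_add_one (s := 1 - s) (by linarith [hs.2])
    rw [← this]; congr 1; ring
  have h3 : 0 < Real.Gamma (1 - s) := Real.Gamma_pos_of_pos (by linarith [hs.2])
  have := Real.pi_pos
  have h4 : 0 < 1 - s := by linarith [hs.2]
  rw [h2]
  unfold cNs
  field_simp

lemma tendsto_cNs_div (N : ℕ) (hN : 2 ≤ N) :
    Tendsto (fun s => cNs N s / (1 - s)) (𝓝[<] 1) (𝓝 (4 / bN N)) := by
  have h : Tendsto (fun s : ℝ => (4 : ℝ) ^ s * s * Real.Gamma ((N : ℝ) / 2 + s) /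
      (Real.pi ^ ((N : ℝ) / 2) * Real.Gamma (2 - s))) (𝓝[<] 1) (𝓝 (4 / bN N)) := by
    have hc : ContinuousAt (fun s : ℝ => (4 : ℝ) ^ s * s * Real.Gamma ((N : ℝ) / 2 + s) /
      (Real.pi ^ ((N : ℝ) / 2) * Real.Gamma (2 - s))) 1 := by
      have hg1 : ContinuousAt (fun s : ℝ => Real.Gamma ((N : ℝ) / 2 + s)) 1 := by
        apply ContinuousAt.comp (g := Real.Gamma)
        · apply (Real.differentiableAt_Gamma _).continuousAt
          intro m
          have : (0 : ℝ) < (N : ℝ) / 2 + 1 := by positivity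
          have h2 : (0 : ℝ) ≤ m := by positivity
          linarith
        · fun_prop
      have hg2 : ContinuousAt (fun s : ℝ => Real.Gamma (2 - s)) 1 := by
        apply ContinuousAt.comp (g := Real.Gamma)
        · apply (Real.differentiableAt_Gamma _).continuousAt
          intro m
          have h2 : (0 : ℝ) ≤ m := by positivity
          linarith
        · fun_prop
      have h4 : ContinuousAt (fun s : ℝ => (4 : ℝ) ^ s) 1 :=
        (Real.continuous_const_rpow (by norm_num)).continuousAt
      apply ContinuousAt.div ((h4.mul continuousAt_id).mul hg1) (continuousAt_const.mul hg2)
      have : 0 < Real.pi := Real.pi_pos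
      have h5 : (0 : ℝ) < Real.Gamma (2 - 1) := Real.Gamma_pos_of_pos (by norm_num)
      exact (mul_pos (Real.rpow_pos_of_pos this _) h5).ne'
    have h1 := hc.tendsto.mono_left (nhdsWithin_le_nhds (s := Iio 1))
    convert h1 using 2
    rw [bN_eq N hN]
    have : (2 : ℝ) - 1 = 1 := by norm_num
    rw [this, Real.Gamma_one]
    have := Real.pi_pos
    simp
    field_simp
  apply h.congr'
  have : Ioo (0 : ℝ) 1 ∈ 𝓝[<] (1 : ℝ) := Ioo_mem_nhdsLT (by norm_num)
  filter_upwards [this] with s hs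
  rw [cNs_eq N s hs]
  have : 0 < 1 - s := by linarith [hs.2]
  field_simp

lemma tendsto_cNs (N : ℕ) (hN : 2 ≤ N) : Tendsto (fun s => cNs N s) (𝓝[<] 1) (𝓝 0) := by
  have h := tendsto_cNs_div N hN
  have h2 : Tendsto (fun s : ℝ => 1 - s) (𝓝[<] 1) (𝓝 0) := by
    have : Tendsto (fun s : ℝ => 1 - s) (𝓝 1) (𝓝 (1 - 1)) := by
      apply Continuous.tendsto; fun_prop
    simp only [sub_self] at this
    exact this.mono_left nhdsWithin_le_nhds
  have h3 := h.mul h2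
  simp only [mul_zero] at h3
  apply h3.congr'
  filter_upwards [self_mem_nhdsWithin] with s hs
  have : 1 - s ≠ 0 := by have : s < 1 := hs; linarith
  field_simp

lemma tendsto_main (N : ℕ) (hN : 2 ≤ N) (δ : ℝ) (hδ : 0 < δ) :
    Tendsto (fun s => cNs N s / 2 * (bN N * δ ^ (2 - 2 * s) / (2 - 2 * s))) (𝓝[<] 1) (𝓝 1) := by
  have h := tendsto_cNs_div N hN
  have h2 : Tendsto (fun s : ℝ => δ ^ (2 - 2 * s)) (𝓝[<] 1) (𝓝 1) := by
    have : Continuous (fun s : ℝ => δ ^ (2 - 2 * s)) := by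
      apply Continuous.rpow
      · fun_prop
      · fun_prop
      · intro x; left; exact hδ.ne'
    have h := (this.tendsto 1).mono_left (nhdsWithin_le_nhds (s := Iio 1))
    simpa using h
  have hb := bN_pos N hN
  have h3 := (h.mul h2).mul_const (bN N / 4)
  have e : 4 / bN N * 1 * (bN N / 4) = 1 := by field_simp
  rw [e] at h3
  apply h3.congr'
  filter_upwards [self_mem_nhdsWithin] with s hs
  have : 1 - s ≠ 0 := by have : s < 1 := hs; linarith
  have e2 : 2 - 2 * s = 2 * (1 - s) := by ring
  rw [show (2 - 2 * s) = 2 * (1 - s) by ring]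
  field_simp
  ring

lemma ball_rpow (N : ℕ) (hN : 2 ≤ N) (δ p : ℝ) (hδ : 0 < δ) (hp : 0 < p) :
    IntegrableOn (fun h : Euc N => ‖h‖ ^ (p - N)) (Metric.ball 0 δ) ∧
    ∫ h in Metric.ball (0 : Euc N) δ, ‖h‖ ^ (p - N) = N * bN N * δ ^ p / p := by
  haveI : Nonempty (Fin N) := ⟨⟨0, by omega⟩⟩
  haveI : Nontrivial (Euc N) := by
    apply Module.nontrivial_of_finrank_pos (R := ℝ); simp; omega
  have hcong : ∀ y ∈ Ioo (0:ℝ) δ, y ^ (Module.finrank ℝ (Euc N) - 1) • (y ^ (p - N)) = y ^ (p - 1) := by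
    intro y hy
    rw [finrank_euclideanSpace_fin, smul_eq_mul, ← Real.rpow_natCast, ← Real.rpow_add hy.1]
    congr 1
    rw [Nat.cast_sub (by omega)]; push_cast; ring
  constructor
  · rw [integrableOn_fun_norm_addHaar volume (f := fun y => y ^ (p - N)),
      integrableOn_congr_fun hcong measurableSet_Ioo]
    have := (intervalIntegral.intervalIntegrable_rpow' (a := 0) (b := δ) (r := p - 1) (by linarith))
    rw [intervalIntegrable_iff_integrableOn_Ioo_of_le hδ.le] at this
    exact this
  · have h1 : ∫ h in Metric.ball (0 : Euc N) δ, ‖h‖ ^ (p - N)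
        = ∫ h : Euc N, (Iio δ).indicator (fun y : ℝ => y ^ (p - N)) ‖h‖ := by
      rw [← integral_indicator measurableSet_ball]
      congr 1; ext h
      simp [indicator]
    rw [h1, integral_fun_norm_addHaar]
    have h2 : ∫ y in Ioi (0:ℝ), y ^ (Module.finrank ℝ (Euc N) - 1) •
        (Iio δ).indicator (fun y : ℝ => y ^ (p - N)) y = ∫ y in (0:ℝ)..δ, y ^ (p - 1) := by
      rw [intervalIntegral.integral_of_le hδ.le, integral_Ioc_eq_integral_Ioo,
        ← integral_indicator measurableSet_Ioi, ← integral_indicator measurableSet_Ioo]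
      congr 1; ext y
      by_cases h0 : 0 < y
      · by_cases h1 : y < δ
        · have := hcong y ⟨h0, h1⟩
          simp only [indicator, mem_Ioi, mem_Iio, mem_Ioo, h0, h1, and_self, if_true]
          exact this
        · simp [indicator, h0, h1]
      · simp [indicator, h0]
    rw [h2, integral_rpow (Or.inl (by linarith)), finrank_euclideanSpace_fin]
    simp only [sub_add_cancel, nsmul_eq_mul, smul_eq_mul]
    rw [Real.zero_rpow hp.ne']
    unfold bN
    ring

lemma tail_rpow (N : ℕ) (hN : 2 ≤ N) (δ q : ℝ) (hδ : 0 < δ) (hq : 0 < q) :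
    IntegrableOn (fun h : Euc N => ‖h‖ ^ (-q - N)) (Metric.closedBall 0 δ)ᶜ ∧
    ∫ h in (Metric.closedBall (0 : Euc N) δ)ᶜ, ‖h‖ ^ (-q - N) = N * bN N * δ ^ (-q) / q := by
  haveI : Nonempty (Fin N) := ⟨⟨0, by omega⟩⟩
  haveI : Nontrivial (Euc N) := by
    apply Module.nontrivial_of_finrank_pos (R := ℝ); simp; omega
  have hms : MeasurableSet (Metric.closedBall (0 : Euc N) δ)ᶜ := measurableSet_closedBall.compl
  have hcong : ∀ y ∈ Ioi (0:ℝ), y ^ (Module.finrank ℝ (Euc N) - 1) •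
        (Ioi δ).indicator (fun y : ℝ => y ^ (-q - N)) y = (Ioi δ).indicator (fun y => y ^ (-q - 1)) y := by
    intro y hy
    by_cases h1 : δ < y
    · simp only [indicator, mem_Ioi, h1, if_true]
      rw [finrank_euclideanSpace_fin, smul_eq_mul, ← Real.rpow_natCast, ← Real.rpow_add hy]
      congr 1
      rw [Nat.cast_sub (by omega)]; push_cast; ring
    · simp [indicator, h1]
  have hfun : (Metric.closedBall (0 : Euc N) δ)ᶜ.indicator (fun h : Euc N => ‖h‖ ^ (-q - N))
      = fun h => (Ioi δ).indicator (fun y : ℝ => y ^ (-q - N)) ‖h‖ := by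
    ext h; simp [indicator]
  have hsub : Ioi δ ⊆ Ioi (0:ℝ) := Ioi_subset_Ioi hδ.le
  constructor
  · rw [← integrable_indicator_iff hms, hfun, integrable_fun_norm_addHaar,
      integrableOn_congr_fun hcong measurableSet_Ioi]
    have := integrableOn_Ioi_rpow_of_lt (a := -q - 1) (by linarith) hδ
    exact ((integrable_indicator_iff measurableSet_Ioi).2 this).integrableOn
  · rw [← integral_indicator hms, hfun, integral_fun_norm_addHaar,
      setIntegral_congr_fun measurableSet_Ioi hcong, setIntegral_indicator measurableSet_Ioi,
      inter_eq_right.2 hsub, integral_Ioi_rpow_of_lt (by linarith) hδ, finrank_euclideanSpace_fin]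
    simp only [nsmul_eq_mul, smul_eq_mul, sub_add_cancel]
    unfold bN
    field_simp

lemma lint_ball_rpow (N : ℕ) (hN : 2 ≤ N) (δ p : ℝ) (hδ : 0 < δ) (hp : 0 < p) :
    ∫⁻ h in Metric.ball (0 : Euc N) δ, ENNReal.ofReal (‖h‖ ^ (p - N))
      = ENNReal.ofReal (N * bN N * δ ^ p / p) := by
  obtain ⟨h1, h2⟩ := ball_rpow N hN δ p hδ hp
  rw [← h2, ofReal_integral_eq_lintegral_ofReal h1]
  exact Eventually.of_forall fun x => by positivity

lemma lint_tail_rpow (N : ℕ) (hN : 2 ≤ N) (δ q : ℝ) (hδ : 0 < δ) (hq : 0 < q) :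
    ∫⁻ h in (Metric.closedBall (0 : Euc N) δ)ᶜ, ENNReal.ofReal (‖h‖ ^ (-q - N))
      = ENNReal.ofReal (N * bN N * δ ^ (-q) / q) := by
  obtain ⟨h1, h2⟩ := tail_rpow N hN δ q hδ hq
  rw [← h2, ofReal_integral_eq_lintegral_ofReal h1]
  exact Eventually.of_forall fun x => by positivity

/-- rotation symmetry of the second moments -/
lemma lint_inner_sq (N : ℕ) (hN : 2 ≤ N) (a : Euc N) (k : ℝ → ℝ) (hk : ∀ t, 0 ≤ k t)
    (hkm : Measurable k) :
    ∫⁻ h : Euc N, ENNReal.ofReal ((inner ℝ a h : ℝ) ^ 2 * k ‖h‖)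
      = ENNReal.ofReal (‖a‖ ^ 2 / N) * ∫⁻ h : Euc N, ENNReal.ofReal (‖h‖ ^ 2 * k ‖h‖) := by
  set f : Euc N → ℝ≥0∞ := fun a => ∫⁻ h : Euc N, ENNReal.ofReal ((inner ℝ a h : ℝ) ^ 2 * k ‖h‖) with hf
  have hswap : ∀ a b : Euc N, ‖a‖ = ‖b‖ → f a = f b := by
    intro a b hab
    have hr := Submodule.reflection_sub hab
    set R := (Submodule.reflection (ℝ ∙ (a - b))ᗮ) with hR
    have hmp : MeasurePreserving R volume volume := R.measurePreserving
    simp only [hf]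
    rw [← hmp.lintegral_comp_emb R.toHomeomorph.measurableEmbedding
      (fun h => ENNReal.ofReal ((inner ℝ b h : ℝ) ^ 2 * k ‖h‖))]
    congr 1; ext h
    rw [← hr, LinearIsometryEquiv.inner_map_map, LinearIsometryEquiv.norm_map]
  have hscale : ∀ (c : ℝ) (a : Euc N), f (c • a) = ENNReal.ofReal (c ^ 2) * f a := by
    intro c a
    simp only [hf]
    rw [← lintegral_const_mul' _ _ ENNReal.ofReal_ne_top]
    congr 1; ext h
    rw [← ENNReal.ofReal_mul (sq_nonneg c), inner_smul_left]
    congr 1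
    simp; ring
  have hsum : ∑ i : Fin N, f (EuclideanSpace.single i 1) = ∫⁻ h : Euc N, ENNReal.ofReal (‖h‖ ^ 2 * k ‖h‖) := by
    simp only [hf]
    rw [← lintegral_finsetSum]
    · congr 1; ext h
      rw [← ENNReal.ofReal_sum_of_nonneg]
      · rw [← Finset.sum_mul, EuclideanSpace.norm_sq_eq]
        congr 2
        apply Finset.sum_congr rfl
        intro i _
        rw [EuclideanSpace.inner_single_left]; simp
      · intro i _; exact mul_nonneg (sq_nonneg _) (hk _)
    · intro i _
      apply Measurable.ennreal_ofReal
      apply Measurable.mul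
      · fun_prop
      · exact hkm.comp measurable_norm
  let i0 : Fin N := ⟨0, by omega⟩
  have h1 : ∀ i : Fin N, f (EuclideanSpace.single i 1) = f (EuclideanSpace.single i0 1) := by
    intro i; apply hswap; simp
  have h2 : f a = ENNReal.ofReal (‖a‖ ^ 2) * f (EuclideanSpace.single i0 1) := by
    rw [← hscale]; apply hswap; simp [norm_smul]
  change f a = _
  have hNpos : (0 : ℝ) < N := by positivity
  rw [h2, ← hsum, Finset.sum_congr rfl (fun i _ => h1 i)]
  rw [Finset.sum_const, Finset.card_univ, Fintype.card_fin, nsmul_eq_mul, ← mul_assoc]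
  congr 1
  rw [← ENNReal.ofReal_natCast, ← ENNReal.ofReal_mul (by positivity)]
  congr 1; field_simp

/-- Jensen -/
lemma sq_integral_le {α : Type*} [MeasurableSpace α] (ν : Measure α) [IsProbabilityMeasure ν]
    (f : α → ℝ) (hf : AEStronglyMeasurable f ν) :
    ENNReal.ofReal ((∫ x, f x ∂ν) ^ 2) ≤ ∫⁻ x, ENNReal.ofReal ((f x) ^ 2) ∂ν := by
  by_cases htop : ∫⁻ x, ENNReal.ofReal ((f x) ^ 2) ∂ν = ⊤
  · rw [htop]; exact le_top
  have hIntg2 : Integrable (fun x => f x ^ 2) ν := by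
    refine ⟨hf.pow 2, ?_⟩
    rw [hasFiniteIntegral_iff_ofReal (Eventually.of_forall fun x => sq_nonneg _)]
    exact lt_top_iff_ne_top.2 htop
  have hmem : MemLp f 2 ν := (memLp_two_iff_integrable_sq hf).2 hIntg2
  have hIntg : Integrable f ν := hmem.integrable (by norm_num)
  rw [← ofReal_integral_eq_lintegral_ofReal hIntg2 (Eventually.of_forall fun x => sq_nonneg _)]
  apply ENNReal.ofReal_le_ofReal
  have h := (convexOn_pow (𝕜 := ℝ) 2)
  have key : 0 ≤ ∫ x, (f x - ∫ y, f y ∂ν) ^ 2 ∂ν := integral_nonneg fun x => sq_nonneg _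
  have e : ∫ x, (f x - ∫ y, f y ∂ν) ^ 2 ∂ν = ∫ x, f x ^ 2 ∂ν - (∫ y, f y ∂ν) ^ 2 := by
    have : ∀ x, (f x - ∫ y, f y ∂ν) ^ 2 = f x ^ 2 - (2 * ∫ y, f y ∂ν) * f x + (∫ y, f y ∂ν) ^ 2 := by
      intro x; ring
    simp_rw [this]
    have hI : Integrable (fun x => f x ^ 2 - (2 * ∫ y, f y ∂ν) * f x) ν :=
      hIntg2.sub (hIntg.const_mul _)
    rw [integral_add hI (integrable_const _),
      integral_sub hIntg2 (hIntg.const_mul _), integral_const_mul]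
    simp
    ring
  linarith [e ▸ key]

/-- pairs `(x,h)` such that the segment from `x` to `x+h` lies in `Ω` -/
def Sg (N : ℕ) (Ω : Set (Euc N)) : Set (Euc N × Euc N) :=
  {p | ∀ t ∈ Icc (0 : ℝ) 1, p.1 + t • p.2 ∈ Ω}

lemma isOpen_Sg (N : ℕ) (Ω : Set (Euc N)) (hΩ : IsOpen Ω) : IsOpen (Sg N Ω) := by
  rw [isOpen_iff_eventually]
  intro p hp
  have hcont : Continuous (fun z : (Euc N × Euc N) × ℝ => z.1.1 + z.2 • z.1.2) := by fun_prop
  apply (isCompact_Icc (a := (0:ℝ)) (b := 1)).eventually_forall_of_forall_eventually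
  intro t ht
  exact hcont.continuousAt.eventually (hΩ.eventually_mem (hp t ht))

/-- the segment-restricted squared `L²` difference quotient -/
def Gf (N : ℕ) (Ω : Set (Euc N)) (u : Euc N → ℝ) (h : Euc N) : ℝ≥0∞ :=
  ∫⁻ x, (Sg N Ω).indicator (fun p => ENNReal.ofReal ((u (p.1 + p.2) - u p.1) ^ 2)) (x, h)

lemma measurableSet_reg (N : ℕ) (Ω : Set (Euc N)) : MeasurableSet (reg N Ω) := by
  unfold reg
  apply IsClosed.measurableSet
  exact (isClosed_closure.preimage continuous_fst).union (isClosed_closure.preimage continuous_snd)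

lemma measurable_kern (N : ℕ) (s : ℝ) : Measurable (fun q : Euc N × Euc N => kern N s q.1 q.2) := by
  unfold kern
  fun_prop

lemma measurable_semi (N : ℕ) (s : ℝ) (u : Euc N → ℝ) (hu : Measurable u) :
    Measurable (fun q : Euc N × Euc N => ENNReal.ofReal ((u q.1 - u q.2) ^ 2 / kern N s q.1 q.2)) := by
  have := measurable_kern N s
  have h1 : Measurable (fun q : Euc N × Euc N => u q.1) := hu.comp measurable_fst
  have h2 : Measurable (fun q : Euc N × Euc N => u q.2) := hu.comp measurable_snd
  exact (((h1.sub h2).pow_const 2).div this).ennreal_ofReal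

lemma lintegral_prod_shift (N : ℕ) (F : Euc N × Euc N → ℝ≥0∞) (hF : Measurable F) :
    ∫⁻ q, F q = ∫⁻ h, ∫⁻ x, F (x, x + h) := by
  rw [Measure.volume_eq_prod, lintegral_prod _ hF.aemeasurable]
  have h1 : ∀ x : Euc N, ∫⁻ y, F (x, y) = ∫⁻ h, F (x, x + h) := fun x =>
    (lintegral_add_left_eq_self (fun y => F (x, y)) x).symm
  simp_rw [h1]
  rw [lintegral_lintegral_swap]
  apply Measurable.aemeasurable
  exact hF.comp (by fun_prop)

lemma semiSq_eq (N : ℕ) (s : ℝ) (Ω : Set (Euc N)) (u : Euc N → ℝ) (hu : Measurable u) :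
    semiSq N s Ω u = ∫⁻ h, ∫⁻ x, (reg N Ω).indicator
      (fun q => ENNReal.ofReal ((u q.1 - u q.2) ^ 2 / kern N s q.1 q.2)) (x, x + h) := by
  unfold semiSq
  rw [← lintegral_indicator (measurableSet_reg N Ω), lintegral_prod_shift]
  exact (measurable_semi N s u hu).indicator (measurableSet_reg N Ω)

lemma measurable_GfAux (N : ℕ) (Ω : Set (Euc N)) (hΩ : IsOpen Ω) (u : Euc N → ℝ) (hu : Measurable u) :
    Measurable ((Sg N Ω).indicator (fun p => ENNReal.ofReal ((u (p.1 + p.2) - u p.1) ^ 2))) := by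
  apply Measurable.indicator _ (isOpen_Sg N Ω hΩ).measurableSet
  have h1 : Measurable (fun q : Euc N × Euc N => u (q.1 + q.2)) := hu.comp (by fun_prop)
  have h2 : Measurable (fun q : Euc N × Euc N => u q.1) := hu.comp measurable_fst
  exact ((h1.sub h2).pow_const 2).ennreal_ofReal

lemma measurable_Gf (N : ℕ) (Ω : Set (Euc N)) (hΩ : IsOpen Ω) (u : Euc N → ℝ) (hu : Measurable u) :
    Measurable (Gf N Ω u) := by
  unfold Gf
  exact (measurable_GfAux N Ω hΩ u hu).lintegral_prod_left'

lemma Gf_le (N : ℕ) (s : ℝ) (Ω : Set (Euc N)) (hΩ : IsOpen Ω) (u : Euc N → ℝ) (hu : Measurable u) :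
    ∫⁻ h, Gf N Ω u h * ENNReal.ofReal (‖h‖ ^ (-((N : ℝ) + 2 * s))) ≤ semiSq N s Ω u := by
  rw [semiSq_eq N s Ω u hu]
  apply lintegral_mono
  intro h
  unfold Gf
  dsimp only
  rw [← lintegral_mul_const' _ _ ENNReal.ofReal_ne_top]
  apply lintegral_mono
  intro x
  dsimp only
  by_cases hx : (x, h) ∈ Sg N Ω
  · have hx0 : x ∈ Ω := by simpa using hx 0 (by simp)
    have hr : (x, x + h) ∈ reg N Ω := Or.inl (subset_closure hx0)
    rw [indicator_of_mem hx, indicator_of_mem hr, ← ENNReal.ofReal_mul (sq_nonneg _)]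
    apply ENNReal.ofReal_le_ofReal
    simp only [kern]
    rw [Real.rpow_neg (norm_nonneg _), div_eq_mul_inv]
    have : ‖x - (x + h)‖ = ‖h‖ := by rw [← norm_neg]; congr 1; abel
    rw [this]
    apply le_of_eq
    ring
  · rw [indicator_of_notMem hx]; simp

lemma Gf_two (N : ℕ) (Ω : Set (Euc N)) (hΩ : IsOpen Ω) (u : Euc N → ℝ) (hu : Measurable u) (h : Euc N) :
    Gf N Ω u ((2 : ℝ) • h) ≤ 4 * Gf N Ω u h := by
  set F := (Sg N Ω).indicator (fun p => ENNReal.ofReal ((u (p.1 + p.2) - u p.1) ^ 2)) with hF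
  have hFm : Measurable F := measurable_GfAux N Ω hΩ u hu
  have key : ∀ x, F (x, (2:ℝ) • h) ≤ 2 * F (x, h) + 2 * F (x + h, h) := by
    intro x
    by_cases hx : (x, (2:ℝ) • h) ∈ Sg N Ω
    · have h1 : (x, h) ∈ Sg N Ω := by
        intro t ht
        have := hx (t / 2) ⟨by linarith [ht.1], by linarith [ht.2]⟩
        simp only [smul_smul] at this
        convert this using 3; ring
      have h2 : (x + h, h) ∈ Sg N Ω := by
        intro t ht
        have := hx (t / 2 + 1 / 2) ⟨by linarith [ht.1], by linarith [ht.2]⟩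
        simp only [smul_smul] at this
        convert this using 1
        have e : (t / 2 + 1 / 2) * 2 = 1 + t := by ring
        rw [e, add_smul, one_smul]; dsimp only; abel
      rw [hF, indicator_of_mem hx, indicator_of_mem h1, indicator_of_mem h2]
      have e2 : ∀ r : ℝ, (2 : ℝ≥0∞) * ENNReal.ofReal r = ENNReal.ofReal (2 * r) := by
        intro r; rw [ENNReal.ofReal_mul (by norm_num)]; simp
      simp only [e2]
      rw [← ENNReal.ofReal_add (by positivity) (by positivity)]
      apply ENNReal.ofReal_le_ofReal
      have e3 : x + (2:ℝ) • h = x + h + h := by rw [two_smul]; abel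
      simp only [e3]
      nlinarith [sq_nonneg ((u (x + h + h) - u (x + h)) - (u (x + h) - u x))]
    · rw [hF, indicator_of_notMem hx]; simp
  have e1 : Gf N Ω u h = ∫⁻ x, F (x, h) := rfl
  have e2 : Gf N Ω u h = ∫⁻ x, F (x + h, h) := by
    rw [e1, ← lintegral_add_right_eq_self _ h]
  have hm1 : Measurable fun x => F (x, h) := hFm.comp (by fun_prop)
  have hm2 : Measurable fun x => F (x + h, h) := hFm.comp (by fun_prop)
  calc Gf N Ω u ((2 : ℝ) • h) ≤ ∫⁻ x, (2 * F (x, h) + 2 * F (x + h, h)) := lintegral_mono key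
    _ = 2 * Gf N Ω u h + 2 * Gf N Ω u h := by
      rw [lintegral_add_left (hm1.const_mul 2), lintegral_const_mul _ hm1, lintegral_const_mul _ hm2,
        ← e1, ← e2]
    _ = 4 * Gf N Ω u h := by ring

lemma lintegral_ball_two (N : ℕ) (F : Euc N → ℝ≥0∞) (hF : Measurable F) (l : ℝ) :
    ∫⁻ h in Metric.ball (0 : Euc N) l, F h =
      ENNReal.ofReal (2 ^ (N : ℝ)) * ∫⁻ h in Metric.ball (0 : Euc N) (l / 2), F ((2:ℝ) • h) := by
  rw [← lintegral_indicator measurableSet_ball, ← lintegral_indicator measurableSet_ball]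
  have hmap := Measure.map_addHaar_smul (volume : Measure (Euc N)) (r := 2) (by norm_num)
  have hm : Measurable ((Metric.ball (0 : Euc N) l).indicator F) := hF.indicator measurableSet_ball
  have h1 : ∫⁻ h, (Metric.ball (0 : Euc N) (l/2)).indicator (fun h => F ((2:ℝ) • h)) h
      = ∫⁻ h, (Metric.ball (0 : Euc N) l).indicator F ((2:ℝ) • h) := by
    congr 1; ext h
    simp only [indicator, Metric.mem_ball, dist_zero_right, norm_smul]
    have : ‖h‖ < l / 2 ↔ ‖(2:ℝ)‖ * ‖h‖ < l := by
      simp only [Real.norm_ofNat]; constructor <;> intro h <;> linarith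
    simp only [this]
  rw [h1, ← lintegral_map (g := fun x : Euc N => (2:ℝ) • x) hm (by fun_prop), hmap, lintegral_smul_measure, smul_eq_mul, ← mul_assoc,
    ← ENNReal.ofReal_mul (by positivity)]
  have : (2 : ℝ) ^ (N : ℝ) * |((2 : ℝ) ^ Module.finrank ℝ (Euc N))⁻¹| = 1 := by
    rw [finrank_euclideanSpace_fin, Real.rpow_natCast, abs_of_pos (by positivity)]
    field_simp
  rw [this]; simp

lemma annulus (N : ℕ) (s : ℝ) (hs : s ∈ Ioo (0:ℝ) 1) (Ω : Set (Euc N)) (hΩ : IsOpen Ω) (u : Euc N → ℝ)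
    (hu : Measurable u) (hfin : semiSq N s Ω u < ⊤) (l : ℝ) (hl : 0 < l) :
    ∫⁻ h in Metric.ball (0 : Euc N) l \ Metric.ball 0 (l / 2),
      Gf N Ω u h * ENNReal.ofReal (‖h‖ ^ (-((N : ℝ) + 2 * s))) ≤
      ENNReal.ofReal (1 - 4 ^ (s - 1)) * semiSq N s Ω u := by
  set F : Euc N → ℝ≥0∞ := fun h => Gf N Ω u h * ENNReal.ofReal (‖h‖ ^ (-((N : ℝ) + 2 * s))) with hF
  have hFm : Measurable F := (measurable_Gf N Ω hΩ u hu).mul (by fun_prop)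
  have hle : ∫⁻ h in Metric.ball (0 : Euc N) l, F h ≤ semiSq N s Ω u :=
    (setLIntegral_le_lintegral _ _).trans (Gf_le N s Ω hΩ u hu)
  set J := ∫⁻ h in Metric.ball (0 : Euc N) l, F h with hJ
  set J2 := ∫⁻ h in Metric.ball (0 : Euc N) (l / 2), F h with hJ2
  set An := ∫⁻ h in Metric.ball (0 : Euc N) l \ Metric.ball 0 (l / 2), F h with hAn
  have hsub : Metric.ball (0 : Euc N) (l / 2) ⊆ Metric.ball 0 l := Metric.ball_subset_ball (by linarith)
  have hadd : J2 + An = J := by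
    have := lintegral_inter_add_diff (μ := volume) F (Metric.ball (0 : Euc N) l)
      (measurableSet_ball (x := (0 : Euc N)) (ε := l / 2))
    rw [inter_eq_right.2 hsub] at this
    exact this
  have hpt : ∀ h : Euc N, F ((2:ℝ) • h) ≤ ENNReal.ofReal (4 * 2 ^ (-((N : ℝ) + 2 * s))) * F h := by
    intro h
    simp only [hF]
    rw [norm_smul, Real.mul_rpow (norm_nonneg _) (norm_nonneg _), Real.norm_ofNat,
      ENNReal.ofReal_mul (by positivity), ENNReal.ofReal_mul (by norm_num)]
    have := Gf_two N Ω hΩ u hu h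
    have e4 : ENNReal.ofReal 4 = 4 := by simp
    rw [e4]
    calc _ ≤ 4 * Gf N Ω u h * (ENNReal.ofReal (2 ^ (-((N : ℝ) + 2 * s))) * ENNReal.ofReal (‖h‖ ^ (-((N : ℝ) + 2 * s)))) := by gcongr
      _ = _ := by ring
  have hJle : J ≤ ENNReal.ofReal (4 ^ (1 - s)) * J2 := by
    rw [hJ, lintegral_ball_two N F hFm l]
    calc _ ≤ ENNReal.ofReal (2 ^ (N:ℝ)) * ∫⁻ h in Metric.ball (0 : Euc N) (l / 2),
            ENNReal.ofReal (4 * 2 ^ (-((N : ℝ) + 2 * s))) * F h := by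
          gcongr; exact hpt _
      _ = ENNReal.ofReal (4 ^ (1 - s)) * J2 := by
          rw [lintegral_const_mul _ hFm, ← mul_assoc, ← ENNReal.ofReal_mul (by positivity)]
          congr 2
          have e : (4:ℝ) ^ (1 - s) = 2 ^ (2 * (1 - s)) := by
            rw [Real.rpow_mul (by norm_num)]; norm_num
          have e2 : (4:ℝ) = 2 ^ (2:ℝ) := by norm_num
          rw [e]
          nth_rw 1 [e2]
          rw [← Real.rpow_add (by norm_num), ← Real.rpow_add (by norm_num)]
          congr 1; ring
  have hJtop : J ≠ ⊤ := (hle.trans_lt hfin).ne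
  have hJ2top : J2 ≠ ⊤ := fun h => hJtop (by rw [← hadd, h]; simp)
  have hAntop : An ≠ ⊤ := fun h => hJtop (by rw [← hadd, h]; simp)
  have hpos : 0 ≤ 1 - (4:ℝ) ^ (s - 1) := by
    have : (4:ℝ) ^ (s - 1) ≤ 1 := Real.rpow_le_one_of_one_le_of_nonpos (by norm_num) (by linarith [hs.2])
    linarith
  have hmain : An ≤ ENNReal.ofReal (1 - 4 ^ (s - 1)) * J := by
    rw [← ENNReal.ofReal_toReal hAntop, ← ENNReal.ofReal_toReal hJtop, ← ENNReal.ofReal_mul hpos]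
    apply ENNReal.ofReal_le_ofReal
    have a1 : J2.toReal + An.toReal = J.toReal := by
      rw [← hadd, ENNReal.toReal_add hJ2top hAntop]
    have a2 : J.toReal ≤ 4 ^ (1 - s) * J2.toReal := by
      have := ENNReal.toReal_mono (ENNReal.mul_ne_top ENNReal.ofReal_ne_top hJ2top) hJle
      rwa [ENNReal.toReal_mul, ENNReal.toReal_ofReal (by positivity)] at this
    have a3 : (4:ℝ) ^ (s - 1) * 4 ^ (1 - s) = 1 := by
      rw [← Real.rpow_add (by norm_num)]; simp
    have a4 : (0:ℝ) < 4 ^ (s - 1) := by positivity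
    have a5 := mul_le_mul_of_nonneg_left a2 a4.le
    rw [← mul_assoc, a3, one_mul] at a5
    nlinarith
  exact hmain.trans (by gcongr)

/-- projection orthogonal to `e` -/
lemma proj_norm_le (N : ℕ) (e z : Euc N) (he : ‖e‖ = 1) : ‖z - (inner ℝ z e : ℝ) • e‖ ≤ ‖z‖ := by
  apply le_of_sq_le_sq _ (norm_nonneg _)
  rw [norm_sub_sq_real, inner_smul_right, norm_smul, he]
  simp only [Real.norm_eq_abs, mul_one, sq_abs]
  nlinarith [sq_nonneg (inner ℝ z e : ℝ)]

lemma cone (N : ℕ) (hN : 2 ≤ N) (Ω : Set (Euc N)) (hΩ : IsLipschitzDomain N Ω) (x0 : Euc N)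
    (hx0 : x0 ∈ closure Ω) :
    ∃ (e : Euc N) (κ r : ℝ), ‖e‖ = 1 ∧ 0 < κ ∧ κ ≤ 1 / 4 ∧ 0 < r ∧
      ∀ y ∈ Ω ∩ Metric.ball x0 r, ∀ l ∈ Ioc 0 r,
        ∀ h ∈ Metric.closedBall (((3 / 4 : ℝ) * l) • e) (κ * l), (y, h) ∈ Sg N Ω := by
  obtain ⟨hopen, hbdd, hconn, hlip⟩ := hΩ
  have hnorm : ∀ (e h : Euc N) (κ l : ℝ), ‖e‖ = 1 → κ ≤ 1 / 4 → 0 < l →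
      h ∈ Metric.closedBall (((3 / 4 : ℝ) * l) • e) (κ * l) → ‖h‖ ≤ l := by
    intro e h κ l he hκ hl hh
    rw [Metric.mem_closedBall, dist_eq_norm] at hh
    have h1 : ‖h‖ ≤ ‖h - ((3 / 4 : ℝ) * l) • e‖ + ‖((3 / 4 : ℝ) * l) • e‖ := by
      simpa using norm_add_le (h - ((3 / 4 : ℝ) * l) • e) (((3 / 4 : ℝ) * l) • e)
    rw [norm_smul, he, Real.norm_eq_abs, abs_of_pos (by positivity)] at h1
    nlinarith
  by_cases hx : x0 ∈ Ω
  · obtain ⟨ρ, hρ, hsub⟩ := Metric.isOpen_iff.1 hopen x0 hx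
    refine ⟨EuclideanSpace.single ⟨0, by omega⟩ 1, 1 / 4, ρ / 2, by simp, by norm_num, le_rfl, by positivity, ?_⟩
    intro y hy l hl h hh t ht
    have hn := hnorm _ h (1/4) l (by simp) le_rfl hl.1 hh
    apply hsub
    have hy2 := hy.2
    rw [Metric.mem_ball, dist_eq_norm] at hy2 ⊢
    have e1 : (y, h).1 + t • (y, h).2 - x0 = (y - x0) + t • h := by simp only; abel
    rw [e1]
    have h2 := norm_add_le (y - x0) (t • h)
    rw [norm_smul, Real.norm_eq_abs, abs_of_nonneg ht.1] at h2
    have h3 : t * ‖h‖ ≤ 1 * l := mul_le_mul ht.2 hn (norm_nonneg _) (by norm_num)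
    linarith [hl.2]
  · have hfr : x0 ∈ frontier Ω := by
      rw [hopen.frontier_eq]; exact ⟨hx0, hx⟩
    obtain ⟨e, he, r, hr, L, f, hf, hiff⟩ := hlip x0 hfr
    have hL : (0:ℝ) ≤ L := L.2
    have hκ4 : 1 / (4 * (1 + (L:ℝ))) ≤ 1 / 4 := by
      apply one_div_le_one_div_of_le <;> linarith
    refine ⟨e, 1 / (4 * (1 + L)), r / 2, he, by positivity, hκ4, by positivity, ?_⟩
    intro y hy l hl h hh t ht
    set κ : ℝ := 1 / (4 * (1 + L)) with hκ
    have hκL : κ * (1 + L) = 1 / 4 := by rw [hκ]; field_simp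
    have hn := hnorm e h κ l he hκ4 hl.1 hh
    have hy2 := hy.2
    rw [Metric.mem_ball, dist_eq_norm] at hy2
    have hyb : y ∈ Metric.ball x0 r := by
      rw [Metric.mem_ball, dist_eq_norm]; linarith
    have hyg := (hiff y hyb).1 hy.1
    show y + t • h ∈ Ω
    have hzb : y + t • h ∈ Metric.ball x0 r := by
      rw [Metric.mem_ball, dist_eq_norm]
      have e1 : y + t • h - x0 = (y - x0) + t • h := by abel
      rw [e1]
      have h2 := norm_add_le (y - x0) (t • h)
      rw [norm_smul, Real.norm_eq_abs, abs_of_nonneg ht.1] at h2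
      have h3 : t * ‖h‖ ≤ 1 * l := mul_le_mul ht.2 hn (norm_nonneg _) (by norm_num)
      linarith [hl.2]
    rw [hiff _ hzb]
    have hee : (inner ℝ e e : ℝ) = 1 := by rw [real_inner_self_eq_norm_sq, he]; norm_num
    set d := h - ((3 / 4 : ℝ) * l) • e with hd
    have hdn : ‖d‖ ≤ κ * l := by
      rw [Metric.mem_closedBall, dist_eq_norm] at hh; exact hh
    have hhd : h = d + ((3 / 4 : ℝ) * l) • e := by rw [hd]; abel
    have hin : (inner ℝ h e : ℝ) = inner ℝ d e + 3 / 4 * l := by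
      rw [hhd, inner_add_left, inner_smul_left, hee]; simp
    have hin2 : -(κ * l) ≤ (inner ℝ d e : ℝ) := by
      have := abs_real_inner_le_norm d e
      rw [he, mul_one] at this
      have := abs_le.1 (this.trans hdn)
      linarith [this.1]
    have hP : (y + t • h) - (inner ℝ (y + t • h) e : ℝ) • e
        = (y - (inner ℝ y e : ℝ) • e) + t • (d - (inner ℝ d e : ℝ) • e) := by
      rw [inner_add_left, inner_smul_left, hin, hhd]
      simp only [conj_trivial]
      module
    have hfl := hf.dist_le_mul ((y + t • h) - (inner ℝ (y + t • h) e : ℝ) • e) (y - (inner ℝ y e : ℝ) • e)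
    rw [Real.dist_eq, dist_eq_norm, hP, add_sub_cancel_left, norm_smul, Real.norm_eq_abs,
      abs_of_nonneg ht.1] at hfl
    have hpd := proj_norm_le N e d he
    have h5 := (abs_le.1 hfl).2
    rw [hP, inner_add_left, inner_smul_left, hin]
    simp only [conj_trivial]
    have h6 : (L:ℝ) * (t * ‖d - (inner ℝ d e : ℝ) • e‖) ≤ L * (t * (κ * l)) := by
      have := ht.1
      gcongr
      exact hpd.trans hdn
    have h7 : 0 ≤ t * l := mul_nonneg ht.1 hl.1.le
    have h8 : t * (-(κ * l)) ≤ t * (inner ℝ d e : ℝ) := mul_le_mul_of_nonneg_left hin2 ht.1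
    nlinarith

open scoped Pointwise in
lemma graph_null (N : ℕ) (e : Euc N) (he : ‖e‖ = 1) (f : Euc N → ℝ) (hf : Continuous f) :
    volume {y : Euc N | f (y - (inner ℝ y e : ℝ) • e) = (inner ℝ y e : ℝ)} = 0 := by
  have hee : (inner ℝ e e : ℝ) = 1 := by rw [real_inner_self_eq_norm_sq, he]; norm_num
  apply Measure.addHaar_eq_zero_of_disjoint_translates volume (fun n : ℕ => (1 / ((n : ℝ) + 1)) • e)
  · rw [isBounded_iff_forall_norm_le]
    refine ⟨1, ?_⟩
    rintro _ ⟨n, rfl⟩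
    simp only
    rw [norm_smul, he, mul_one, Real.norm_eq_abs, abs_of_pos (by positivity), div_le_one (by positivity)]
    linarith [(Nat.cast_nonneg n : (0:ℝ) ≤ n)]
  · have key : ∀ (n : ℕ) (z : Euc N), z ∈ ({(1 / ((n : ℝ) + 1)) • e} : Set (Euc N)) +
        {y : Euc N | f (y - (inner ℝ y e : ℝ) • e) = (inner ℝ y e : ℝ)} →
        1 / ((n : ℝ) + 1) = inner ℝ z e - f (z - (inner ℝ z e : ℝ) • e) := by
      intro n z hz
      rw [Set.mem_add] at hz
      obtain ⟨a, ha, y, hy, rfl⟩ := hz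
      rw [mem_singleton_iff] at ha
      have hy' : f (y - (inner ℝ y e : ℝ) • e) = (inner ℝ y e : ℝ) := hy
      subst ha
      rw [inner_add_left, inner_smul_left, hee]
      simp only [conj_trivial, mul_one]
      have : (1 / ((n : ℝ) + 1)) • e + y - (1 / ((n : ℝ) + 1) + (inner ℝ y e : ℝ)) • e
        = y - (inner ℝ y e : ℝ) • e := by module
      rw [this, hy']
      ring
    intro m n hmn
    rw [Function.onFun, Set.disjoint_left]
    intro z hz1 hz2
    have h1 := key m z hz1
    have h2 := key n z hz2
    rw [← h2] at h1
    apply hmn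
    have : (m : ℝ) + 1 = n + 1 := by
      have hm : (0:ℝ) < (m:ℝ) + 1 := by positivity
      have hn : (0:ℝ) < (n:ℝ) + 1 := by positivity
      field_simp at h1
      linarith
    exact_mod_cast add_right_cancel this
  · apply IsClosed.measurableSet
    apply isClosed_eq <;> fun_prop

lemma frontier_null (N : ℕ) (Ω : Set (Euc N)) (hΩ : IsLipschitzDomain N Ω) :
    volume (frontier Ω) = 0 := by
  obtain ⟨hopen, hbdd, hconn, hlip⟩ := hΩ
  apply measure_null_of_locally_null
  intro x hx
  obtain ⟨e, he, r, hr, L, f, hf, hiff⟩ := hlip x hx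
  refine ⟨frontier Ω ∩ Metric.ball x r, inter_mem_nhdsWithin _ (Metric.ball_mem_nhds x hr), ?_⟩
  apply measure_mono_null _ (graph_null N e he f hf.continuous)
  rintro y ⟨hy1, hy2⟩
  have hyn : y ∉ Ω := by rw [hopen.frontier_eq] at hy1; exact hy1.2
  have hyc : y ∈ closure Ω := hy1.1
  have h1 : ¬ f (y - (inner ℝ y e : ℝ) • e) < inner ℝ y e := fun h => hyn ((hiff y hy2).2 h)
  rw [not_lt] at h1
  by_contra hne
  have h2 : (inner ℝ y e : ℝ) < f (y - (inner ℝ y e : ℝ) • e) := lt_of_le_of_ne h1 (fun h => hne h.symm)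
  have hopen2 : IsOpen ({z : Euc N | (inner ℝ z e : ℝ) < f (z - (inner ℝ z e : ℝ) • e)} ∩ Metric.ball x r) := by
    apply IsOpen.inter _ Metric.isOpen_ball
    have := hf.continuous
    apply isOpen_lt <;> fun_prop
  obtain ⟨z, ⟨hz1, hz2⟩, hz3⟩ := mem_closure_iff.1 hyc _ hopen2 ⟨h2, hy2⟩
  have := (hiff z hz2).1 hz3
  have hz1' : (inner ℝ z e : ℝ) < f (z - (inner ℝ z e : ℝ) • e) := hz1
  linarith

/-! ### `L²` helpers -/

lemma memL2_of {N : ℕ} {Ω : Set (Euc N)} {u : Euc N → ℝ} (hu : Measurable u) (h : l2sq N Ω u < ⊤) :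
    MemLp u 2 (volume.restrict Ω) := by
  rw [memLp_two_iff_integrable_sq hu.aestronglyMeasurable]
  refine ⟨(hu.pow_const 2).aestronglyMeasurable, ?_⟩
  rw [hasFiniteIntegral_iff_ofReal (Eventually.of_forall fun x => sq_nonneg _)]
  exact h

lemma l2sq_eq {N : ℕ} {Ω : Set (Euc N)} {u : Euc N → ℝ} (h : MemLp u 2 (volume.restrict Ω)) :
    l2sq N Ω u = ENNReal.ofReal (∫ x in Ω, (u x) ^ 2) := by
  unfold l2sq
  rw [ofReal_integral_eq_lintegral_ofReal h.integrable_sq (Eventually.of_forall fun x => sq_nonneg _)]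

lemma l2sq_lt_top {N : ℕ} {Ω : Set (Euc N)} {u : Euc N → ℝ} (h : MemLp u 2 (volume.restrict Ω)) :
    l2sq N Ω u < ⊤ := by rw [l2sq_eq h]; exact ENNReal.ofReal_lt_top

lemma inner_toLp {α : Type*} [MeasurableSpace α] {μ : Measure α} {f g : α → ℝ} (hf : MemLp f 2 μ) (hg : MemLp g 2 μ) :
    (inner ℝ (hf.toLp f) (hg.toLp g) : ℝ) = ∫ x, f x * g x ∂μ := by
  rw [L2.inner_def]
  apply integral_congr_ae
  filter_upwards [hf.coeFn_toLp, hg.coeFn_toLp] with x h1 h2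
  rw [h1, h2]
  simp [mul_comm]

lemma norm_sq_toLp {α : Type*} [MeasurableSpace α] {μ : Measure α} {f : α → ℝ} (hf : MemLp f 2 μ) :
    ‖hf.toLp f‖ ^ 2 = ∫ x, (f x) ^ 2 ∂μ := by
  rw [← real_inner_self_eq_norm_sq, inner_toLp]
  congr 1; ext x; ring

/-- weak sequential compactness in separable `L²` -/
lemma weak_subseq {H : Type*} [NormedAddCommGroup H] [InnerProductSpace ℝ H]
    [TopologicalSpace.SeparableSpace H] (W : ℕ → H) (C : ℝ) (hW : ∀ k, ‖W k‖ ≤ C) :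
    ∃ φ : ℕ → ℕ, StrictMono φ ∧ ∀ f : H, ∃ a : ℝ, Tendsto (fun k => (inner ℝ (W (φ k)) f : ℝ)) atTop (𝓝 a) := by
  have hc := WeakDual.isSeqCompact_closedBall ℝ H (0 : StrongDual ℝ H) C
  have hmem : ∀ k, StrongDual.toWeakDual (innerSL ℝ (W k)) ∈
      (WeakDual.toStrongDual ⁻¹' Metric.closedBall (0 : StrongDual ℝ H) C) := by
    intro k
    rw [mem_preimage, mem_closedBall_zero_iff]
    have : ‖innerSL ℝ (W k)‖ ≤ C := by rw [innerSL_apply_norm]; exact hW k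
    exact this
  obtain ⟨a, -, φ, hφ, ha⟩ := hc hmem
  refine ⟨φ, hφ, fun f => ⟨a f, ?_⟩⟩
  have := ((WeakDual.eval_continuous (𝕜 := ℝ) (E := H) f).tendsto a).comp ha
  exact this

lemma const_bound (N : ℕ) (hN : 2 ≤ N) : ∃ C0 : ℝ, 0 < C0 ∧
    ∀ᶠ s in 𝓝[<] (1:ℝ), (1 - (4:ℝ) ^ (s - 1)) / (cNs N s / 2) ≤ C0 := by
  have h := tendsto_cNs_div N hN
  have hb := bN_pos N hN
  have hev : ∀ᶠ s in 𝓝[<] (1:ℝ), 2 / bN N < cNs N s / (1 - s) := by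
    apply h.eventually_const_lt
    rw [div_lt_div_iff_of_pos_right hb]; norm_num
  refine ⟨Real.log 4 * bN N, mul_pos (Real.log_pos (by norm_num)) hb, ?_⟩
  have : Ioo (0 : ℝ) 1 ∈ 𝓝[<] (1 : ℝ) := Ioo_mem_nhdsLT (by norm_num)
  filter_upwards [hev, this] with s hs hs2
  have hc := cNs_pos N s hs2
  have h1 : 0 < 1 - s := by linarith [hs2.2]
  rw [div_le_iff₀ (by positivity)]
  rw [div_lt_div_iff₀ hb h1] at hs
  have h2 : 1 - (4:ℝ) ^ (s - 1) ≤ (1 - s) * Real.log 4 := by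
    rw [Real.rpow_def_of_pos (by norm_num)]
    have := Real.add_one_le_exp (Real.log 4 * (s - 1))
    linarith
  have h3 : 0 < Real.log 4 := Real.log_pos (by norm_num)
  nlinarith

/-- uniform probability on a ball -/
def nuB (N : ℕ) (c : Euc N) (ρ : ℝ) : Measure (Euc N) :=
  (volume (Metric.ball c ρ))⁻¹ • volume.restrict (Metric.ball c ρ)

lemma vol_ball (N : ℕ) (hN : 2 ≤ N) (c : Euc N) (ρ : ℝ) (hρ : 0 < ρ) :
    volume (Metric.ball c ρ) = ENNReal.ofReal (ρ ^ N * bN N) := by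
  have hnt : Nontrivial (Euc N) := by
    apply Module.nontrivial_of_finrank_pos (R := ℝ); simp; omega
  rw [Measure.addHaar_ball _ _ hρ.le, finrank_euclideanSpace_fin, ENNReal.ofReal_mul (by positivity)]
  congr 1
  unfold bN Measure.real
  rw [ENNReal.ofReal_toReal]
  exact measure_ball_lt_top.ne

lemma nuB_prob (N : ℕ) (c : Euc N) (ρ : ℝ) (hρ : 0 < ρ) : IsProbabilityMeasure (nuB N c ρ) := by
  constructor
  unfold nuB
  rw [Measure.smul_apply, Measure.restrict_apply_univ, smul_eq_mul, ENNReal.inv_mul_cancel]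
  · exact (Metric.measure_ball_pos volume c hρ).ne'
  · exact measure_ball_lt_top.ne

/-- Averages over shifted balls are close to the function itself. -/
lemma patch_est (N : ℕ) (hN : 2 ≤ N) (Ω : Set (Euc N)) (hΩ : IsOpen Ω) (P : Set (Euc N)) (hPm : MeasurableSet P)
    (hPΩ : P ⊆ Ω) (e : Euc N) (κ l : ℝ) (he : ‖e‖ = 1) (hκ : 0 < κ) (hκ4 : κ ≤ 1 / 4) (hl : 0 < l) (hl1 : l ≤ 1)
    (hP : ∀ y ∈ P, ∀ h ∈ Metric.ball (((3 / 4 : ℝ) * l) • e) (κ * l), (y, h) ∈ Sg N Ω)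
    (s : ℝ) (hs : s ∈ Ioo (0:ℝ) 1) (hs2 : 1 / 2 ≤ s) (u : Euc N → ℝ) (hu : memHs N s Ω u) :
    ∫⁻ x in P, ENNReal.ofReal ((u x - ∫ h, u (x + h) ∂(nuB N (((3 / 4 : ℝ) * l) • e) (κ * l))) ^ 2)
      ≤ ENNReal.ofReal (l / (κ ^ N * bN N)) * (ENNReal.ofReal (1 - 4 ^ (s - 1)) * semiSq N s Ω u) := by
  obtain ⟨hum, hul2, hfin⟩ := hu
  have hL2 := memL2_of hum hul2
  set B := Metric.ball (((3 / 4 : ℝ) * l) • e) (κ * l) with hB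
  have hρ : 0 < κ * l := mul_pos hκ hl
  have hprob := nuB_prob N (((3 / 4 : ℝ) * l) • e) (κ * l) hρ
  set ν := nuB N (((3 / 4 : ℝ) * l) • e) (κ * l) with hν
  have hBne : volume B ≠ 0 := (Metric.measure_ball_pos volume _ hρ).ne'
  have hBtop : volume B ≠ ⊤ := measure_ball_lt_top.ne
  set F := (Sg N Ω).indicator (fun p => ENNReal.ofReal ((u (p.1 + p.2) - u p.1) ^ 2)) with hF
  have hFm : Measurable F := measurable_GfAux N Ω hΩ u hum
  have step1 : ∀ x ∈ P, ENNReal.ofReal ((u x - ∫ h, u (x + h) ∂ν) ^ 2) ≤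
      (volume B)⁻¹ * ∫⁻ h in B, F (x, h) := by
    intro x hx
    have hmeas : Measurable (fun h => u (x + h)) := hum.comp (by fun_prop)
    have hIntg : Integrable (fun h => u (x + h)) ν := by
      have h1 : MemLp (fun h => u (x + h)) 2 (volume.restrict B) := by
        rw [memLp_two_iff_integrable_sq hmeas.aestronglyMeasurable]
        refine ⟨(hmeas.pow_const 2).aestronglyMeasurable, ?_⟩
        rw [hasFiniteIntegral_iff_ofReal (Eventually.of_forall fun x => sq_nonneg _)]
        refine lt_of_le_of_lt ?_ hul2
        unfold l2sq
        have hsh := lintegral_add_left_eq_self (μ := (volume : Measure (Euc N)))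
          (fun h => Ω.indicator (fun x => ENNReal.ofReal ((u x) ^ 2)) h) x
        rw [← lintegral_indicator (s := B) measurableSet_ball, ← lintegral_indicator hΩ.measurableSet, ← hsh]
        apply lintegral_mono
        intro h
        beta_reduce
        by_cases hh : h ∈ B
        · have : x + h ∈ Ω := by simpa using hP x hx h hh 1 (by simp)
          rw [indicator_of_mem hh, indicator_of_mem this]
        · rw [indicator_of_notMem hh]; exact zero_le
      have hfm : IsFiniteMeasure (volume.restrict B) := ⟨by rw [Measure.restrict_apply_univ]; exact hBtop.lt_top⟩
      have h2 : Integrable (fun h => u (x + h)) (volume.restrict B) := h1.integrable (by norm_num)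
      exact h2.smul_measure (ENNReal.inv_ne_top.2 hBne)
    have e1 : u x - ∫ h, u (x + h) ∂ν = ∫ h, (u x - u (x + h)) ∂ν := by
      rw [integral_sub (integrable_const _) hIntg]; simp
    rw [e1]
    refine (sq_integral_le ν _ (measurable_const.sub hmeas).aestronglyMeasurable).trans ?_
    rw [hν, nuB, lintegral_smul_measure, smul_eq_mul]
    refine mul_le_mul' le_rfl ?_
    apply setLIntegral_mono' measurableSet_ball
    intro h hh
    rw [hF, indicator_of_mem (hP x hx h hh)]
    apply ENNReal.ofReal_le_ofReal
    apply le_of_eq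
    simp only [Pi.sub_apply]
    ring
  have step2 : ∫⁻ x in P, ENNReal.ofReal ((u x - ∫ h, u (x + h) ∂ν) ^ 2) ≤
      (volume B)⁻¹ * ∫⁻ h in B, Gf N Ω u h := by
    calc _ ≤ ∫⁻ x in P, (volume B)⁻¹ * ∫⁻ h in B, F (x, h) := setLIntegral_mono' hPm step1
      _ ≤ ∫⁻ x, (volume B)⁻¹ * ∫⁻ h in B, F (x, h) := setLIntegral_le_lintegral _ _
      _ = (volume B)⁻¹ * ∫⁻ x, ∫⁻ h in B, F (x, h) := by
          rw [lintegral_const_mul' _ _ (ENNReal.inv_ne_top.2 hBne)]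
      _ = (volume B)⁻¹ * ∫⁻ h in B, Gf N Ω u h := by
          rw [lintegral_lintegral_swap (f := fun x h => F (x, h)) hFm.aemeasurable]
          rfl
  have hsubB : B ⊆ Metric.ball (0 : Euc N) l \ Metric.ball 0 (l / 2) := by
    intro h hh
    rw [hB, Metric.mem_ball, dist_eq_norm] at hh
    have n1 : ‖((3 / 4 : ℝ) * l) • e‖ = 3 / 4 * l := by
      rw [norm_smul, he, Real.norm_eq_abs, abs_of_pos (by positivity), mul_one]
    have t1 := norm_sub_norm_le h (((3 / 4 : ℝ) * l) • e)
    have t2 := norm_sub_norm_le (((3 / 4 : ℝ) * l) • e) h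
    rw [norm_sub_rev] at t2
    rw [n1] at t1 t2
    have : κ * l ≤ 1 / 4 * l := by gcongr
    constructor
    · rw [mem_ball_zero_iff]; linarith
    · rw [mem_ball_zero_iff]; linarith
  have hAm : MeasurableSet (Metric.ball (0 : Euc N) l \ Metric.ball 0 (l / 2)) :=
    measurableSet_ball.diff measurableSet_ball
  have step3 : ∫⁻ h in B, Gf N Ω u h ≤
      ENNReal.ofReal (l ^ (N + 1)) * (ENNReal.ofReal (1 - 4 ^ (s - 1)) * semiSq N s Ω u) := by
    calc ∫⁻ h in B, Gf N Ω u h ≤ ∫⁻ h in Metric.ball (0 : Euc N) l \ Metric.ball 0 (l / 2), Gf N Ω u h :=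
          lintegral_mono_set hsubB
      _ ≤ ∫⁻ h in Metric.ball (0 : Euc N) l \ Metric.ball 0 (l / 2), ENNReal.ofReal (l ^ (N + 1)) *
            (Gf N Ω u h * ENNReal.ofReal (‖h‖ ^ (-((N : ℝ) + 2 * s)))) := by
          apply setLIntegral_mono' hAm
          intro h hh
          have hn1 : ‖h‖ < l := by simpa using hh.1
          have hn2 : l / 2 ≤ ‖h‖ := by simpa using hh.2
          have hpos : 0 < ‖h‖ := by linarith
          have : (1 : ℝ≥0∞) ≤ ENNReal.ofReal (l ^ (N + 1)) * ENNReal.ofReal (‖h‖ ^ (-((N : ℝ) + 2 * s))) := by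
            rw [← ENNReal.ofReal_mul (by positivity), ← ENNReal.ofReal_one]
            apply ENNReal.ofReal_le_ofReal
            rw [Real.rpow_neg hpos.le, ← div_eq_mul_inv, one_le_div (by positivity)]
            calc ‖h‖ ^ ((N : ℝ) + 2 * s) ≤ l ^ ((N : ℝ) + 2 * s) :=
                  Real.rpow_le_rpow hpos.le hn1.le (by have := hs.1; positivity)
              _ ≤ l ^ ((N : ℝ) + 1) := Real.rpow_le_rpow_of_exponent_ge hl hl1 (by linarith)
              _ = l ^ (N + 1) := by rw [← Real.rpow_natCast]; push_cast; rfl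
          calc Gf N Ω u h = Gf N Ω u h * 1 := by rw [mul_one]
            _ ≤ Gf N Ω u h * (ENNReal.ofReal (l ^ (N + 1)) * ENNReal.ofReal (‖h‖ ^ (-((N : ℝ) + 2 * s)))) := by gcongr
            _ = _ := by ring
      _ ≤ _ := by
          rw [lintegral_const_mul' _ _ ENNReal.ofReal_ne_top]
          gcongr
          exact annulus N s hs Ω hΩ u hum hfin l hl
  have hbN := bN_pos N hN
  calc _ ≤ (volume B)⁻¹ * ∫⁻ h in B, Gf N Ω u h := step2
    _ ≤ (volume B)⁻¹ * (ENNReal.ofReal (l ^ (N + 1)) * (ENNReal.ofReal (1 - 4 ^ (s - 1)) * semiSq N s Ω u)) := by gcongr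
    _ = _ := by
      rw [← mul_assoc, hB, vol_ball N hN _ _ hρ, ← ENNReal.ofReal_inv_of_pos (by positivity),
        ← ENNReal.ofReal_mul (by positivity)]
      congr 2
      rw [mul_pow, pow_succ]
      field_simp

/-! ### Compactness -/

lemma avg_eq (N : ℕ) (hN : 2 ≤ N) (Ω : Set (Euc N)) (hΩ : IsOpen Ω) (c : Euc N) (ρ : ℝ) (hρ : 0 < ρ)
    (x : Euc N) (hx : Metric.ball (x + c) ρ ⊆ Ω) (u : Euc N → ℝ) (hu : MemLp u 2 (volume.restrict Ω))
    (hI : MemLp ((Metric.ball (x + c) ρ).indicator (fun _ => (1 : ℝ))) 2 (volume.restrict Ω)) :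
    ∫ h, u (x + h) ∂(nuB N c ρ) = ((volume (Metric.ball c ρ))⁻¹).toReal * inner ℝ (hu.toLp u) (hI.toLp _) := by
  rw [inner_toLp]
  unfold nuB
  rw [integral_smul_measure, smul_eq_mul]
  congr 1
  have e2 : ∫ y in Ω, u y * (Metric.ball (x + c) ρ).indicator (fun _ => (1 : ℝ)) y =
      ∫ y in Ω, (Metric.ball (x + c) ρ).indicator u y := by
    congr 1; ext y
    by_cases hy : y ∈ Metric.ball (x + c) ρ
    · simp only [indicator_of_mem hy, mul_one]
    · simp only [indicator_of_notMem hy, mul_zero]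
  rw [e2, ← integral_indicator hΩ.measurableSet]
  have e3 : (fun y => Ω.indicator ((Metric.ball (x + c) ρ).indicator u) y) = (Metric.ball (x + c) ρ).indicator u := by
    ext y
    by_cases hy : y ∈ Metric.ball (x + c) ρ
    · rw [indicator_of_mem (hx hy)]
    · by_cases hy2 : y ∈ Ω
      · rw [indicator_of_mem hy2]
      · rw [indicator_of_notMem hy2, indicator_of_notMem hy]
  have e4 := integral_add_left_eq_self (μ := (volume : Measure (Euc N))) ((Metric.ball (x + c) ρ).indicator u) x
  rw [e3, ← e4, ← integral_indicator measurableSet_ball]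
  congr 1; ext h
  by_cases hy : h ∈ Metric.ball c ρ
  · have : x + h ∈ Metric.ball (x + c) ρ := by simpa [Metric.mem_ball] using hy
    rw [indicator_of_mem hy, indicator_of_mem this]
  · have : x + h ∉ Metric.ball (x + c) ρ := by simpa [Metric.mem_ball] using hy
    rw [indicator_of_notMem hy, indicator_of_notMem this]

lemma avg_measurable (N : ℕ) (c : Euc N) (ρ : ℝ) (hρ : 0 < ρ) (u : Euc N → ℝ) (hu : Measurable u) :
    Measurable (fun x => ∫ h, u (x + h) ∂(nuB N c ρ)) := by
  have := nuB_prob N c ρ hρ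
  have h1 : StronglyMeasurable (fun p : Euc N × Euc N => u (p.1 + p.2)) :=
    (hu.comp (by fun_prop)).stronglyMeasurable
  exact (h1.integral_prod_right' (ν := nuB N c ρ)).measurable

lemma patch_avg (N : ℕ) (hN : 2 ≤ N) (Ω : Set (Euc N)) (hΩ : IsOpen Ω) (P : Set (Euc N)) (hPm : MeasurableSet P)
    (hPfin : volume P ≠ ⊤) (c : Euc N) (ρ : ℝ) (hρ : 0 < ρ) (hP : ∀ x ∈ P, Metric.ball (x + c) ρ ⊆ Ω)
    (w : ℕ → Euc N → ℝ) (hw : ∀ k, Measurable (w k)) (hw2 : ∀ k, MemLp (w k) 2 (volume.restrict Ω))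
    (C : ℝ) (hC : ∀ k, ‖(hw2 k).toLp (w k)‖ ≤ C)
    (hweak : ∀ f : Lp ℝ 2 (volume.restrict Ω), ∃ a : ℝ,
      Tendsto (fun k => (inner ℝ ((hw2 k).toLp (w k)) f : ℝ)) atTop (𝓝 a)) :
    Tendsto (fun p : ℕ × ℕ => ∫⁻ x in P, ENNReal.ofReal ((∫ h, w p.1 (x + h) ∂(nuB N c ρ) -
      ∫ h, w p.2 (x + h) ∂(nuB N c ρ)) ^ 2)) atTop (𝓝 0) := by
  have hI : ∀ x, MemLp ((Metric.ball (x + c) ρ).indicator (fun _ => (1 : ℝ))) 2 (volume.restrict Ω) := by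
    intro x
    apply memLp_indicator_const 2 measurableSet_ball
    right
    exact ((Measure.restrict_apply_le _ _).trans_lt measure_ball_lt_top).ne
  set b := ((volume (Metric.ball c ρ))⁻¹).toReal with hb
  have hb0 : 0 ≤ b := ENNReal.toReal_nonneg
  set A : ℕ → Euc N → ℝ := fun k x => ∫ h, w k (x + h) ∂(nuB N c ρ) with hA
  have hAe : ∀ k, ∀ x ∈ P, A k x = b * inner ℝ ((hw2 k).toLp (w k)) ((hI x).toLp _) := fun k x hx =>
    avg_eq N hN Ω hΩ c ρ hρ x (hP x hx) (w k) (hw2 k) (hI x)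
  have hIn : ∀ x, ‖(hI x).toLp _‖ ≤ Real.sqrt (volume.real (Metric.ball c ρ)) := by
    intro x
    apply Real.le_sqrt_of_sq_le
    rw [norm_sq_toLp]
    have : (fun y => (Metric.ball (x + c) ρ).indicator (fun _ => (1 : ℝ)) y ^ 2) =
      (Metric.ball (x + c) ρ).indicator (fun _ => (1 : ℝ)) := by
      ext y
      by_cases hy : y ∈ Metric.ball (x + c) ρ
      · simp only [indicator_of_mem hy, one_pow]
      · simp [indicator_of_notMem hy]
    rw [this, integral_indicator_const _ measurableSet_ball, smul_eq_mul, mul_one]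
    have : volume.real (Metric.ball c ρ) = volume.real (Metric.ball (x + c) ρ) := by
      unfold Measure.real
      rw [vol_ball N hN c ρ hρ, vol_ball N hN _ ρ hρ]
    rw [this]
    exact ENNReal.toReal_mono measure_ball_lt_top.ne (Measure.restrict_apply_le _ _)
  set K := b * (C * Real.sqrt (volume.real (Metric.ball c ρ))) with hK
  have hC0 : 0 ≤ C := (norm_nonneg _).trans (hC 0)
  have hAb : ∀ k, ∀ x ∈ P, |A k x| ≤ K := by
    intro k x hx
    rw [hAe k x hx, abs_mul, abs_of_nonneg hb0, hK]
    apply mul_le_mul_of_nonneg_left _ hb0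
    refine (abs_real_inner_le_norm _ _).trans ?_
    gcongr
    · exact hC k
    · exact hIn x
  have hm : ∀ k, Measurable (A k) := fun k => avg_measurable N c ρ hρ _ (hw k)
  have key := tendsto_lintegral_filter_of_dominated_convergence (μ := volume.restrict P)
    (l := (atTop : Filter (ℕ × ℕ))) (F := fun p x => ENNReal.ofReal ((A p.1 x - A p.2 x) ^ 2)) (f := fun _ => 0)
    (fun _ => ENNReal.ofReal ((2 * K) ^ 2)) ?_ ?_ ?_ ?_
  · simpa using key
  · apply Eventually.of_forall
    intro p
    exact (((hm p.1).sub (hm p.2)).pow_const 2).ennreal_ofReal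
  · apply Eventually.of_forall
    intro p
    filter_upwards [ae_restrict_mem hPm] with x hx
    apply ENNReal.ofReal_le_ofReal
    have h1 := abs_le.1 (hAb p.1 x hx)
    have h2 := abs_le.1 (hAb p.2 x hx)
    apply sq_le_sq'
    · linarith
    · linarith
  · rw [lintegral_const, Measure.restrict_apply_univ]
    exact ENNReal.mul_ne_top ENNReal.ofReal_ne_top hPfin
  · filter_upwards [ae_restrict_mem hPm] with x hx
    obtain ⟨a, ha⟩ := hweak ((hI x).toLp _)
    have h1 : Tendsto (fun k => A k x) atTop (𝓝 (b * a)) := by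
      simp_rw [hAe _ x hx]
      exact ha.const_mul b
    have h2 : Tendsto (fun p : ℕ × ℕ => (A p.1 x - A p.2 x) ^ 2) atTop (𝓝 0) := by
      rw [← prod_atTop_atTop_eq]
      have := ((h1.comp (tendsto_fst (f := (atTop : Filter ℕ)) (g := (atTop : Filter ℕ)))).sub (h1.comp tendsto_snd)).pow 2
      simpa using this
    simpa using ENNReal.tendsto_ofReal h2

lemma patch_cauchy (N : ℕ) (hN : 2 ≤ N) (Ω : Set (Euc N)) (hΩ : IsOpen Ω) (hbd : volume Ω ≠ ⊤) (P : Set (Euc N)) (hPm : MeasurableSet P)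
    (hPΩ : P ⊆ Ω) (e : Euc N) (κ r : ℝ) (he : ‖e‖ = 1) (hκ : 0 < κ) (hκ4 : κ ≤ 1 / 4) (hr : 0 < r)
    (hP : ∀ y ∈ P, ∀ l ∈ Ioc 0 r, ∀ h ∈ Metric.closedBall (((3 / 4 : ℝ) * l) • e) (κ * l), (y, h) ∈ Sg N Ω)
    (sk : ℕ → ℝ) (hsk : ∀ k, sk k ∈ Ioo (0:ℝ) 1) (hlim : Tendsto sk atTop (𝓝 1))
    (w : ℕ → Euc N → ℝ) (hw : ∀ k, memHs N (sk k) Ω (w k)) (hw2 : ∀ k, MemLp (w k) 2 (volume.restrict Ω))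
    (C M : ℝ) (hC : ∀ k, ‖(hw2 k).toLp (w k)‖ ≤ C)
    (hM : ∀ k, cNs N (sk k) / 2 * (semiSq N (sk k) Ω (w k)).toReal ≤ M)
    (hweak : ∀ f : Lp ℝ 2 (volume.restrict Ω), ∃ a : ℝ,
      Tendsto (fun k => (inner ℝ ((hw2 k).toLp (w k)) f : ℝ)) atTop (𝓝 a)) :
    Tendsto (fun p : ℕ × ℕ => ∫⁻ x in P, ENNReal.ofReal ((w p.1 x - w p.2 x) ^ 2)) atTop (𝓝 0) := by
  obtain ⟨C0, hC0, hC0e⟩ := const_bound N hN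
  have hbN := bN_pos N hN
  have hsl : Tendsto sk atTop (𝓝[<] 1) :=
    tendsto_nhdsWithin_iff.2 ⟨hlim, Eventually.of_forall fun k => (hsk k).2⟩
  have hM0 : 0 ≤ M := le_trans (mul_nonneg (by have := cNs_pos N _ (hsk 0); linarith) ENNReal.toReal_nonneg) (hM 0)
  have hev : ∀ᶠ k in atTop, (1 - (4:ℝ) ^ (sk k - 1)) / (cNs N (sk k) / 2) ≤ C0 ∧ 1 / 2 ≤ sk k :=
    (hsl.eventually hC0e).and (hlim.eventually_const_le (by norm_num))
  rw [ENNReal.tendsto_nhds_zero]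
  intro ε hε
  rcases eq_or_ne ε ⊤ with h | hεt
  · subst h; exact Eventually.of_forall fun _ => le_top
  lift ε to ℝ≥0 using hεt
  have hε' : (0:ℝ) < ε := by exact_mod_cast hε
  -- choose the scale
  set D := C0 * M / (κ ^ N * bN N) with hD
  have hD0 : 0 ≤ D := by positivity
  set l := min (min r 1) (ε / (9 * (D + 1))) with hl
  have hl0 : 0 < l := by
    rw [hl]; refine lt_min (lt_min hr one_pos) (by positivity)
  have hlr : l ≤ r := (min_le_left _ _).trans (min_le_left _ _)
  have hl1 : l ≤ 1 := (min_le_left _ _).trans (min_le_right _ _)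
  have hlD : l * D ≤ ε / 9 := by
    calc l * D ≤ (ε / (9 * (D + 1))) * D := by gcongr; exact min_le_right _ _
      _ ≤ ε / 9 := by
        rw [div_mul_eq_mul_div, div_le_div_iff₀ (by positivity) (by norm_num)]
        nlinarith
  set c := ((3 / 4 : ℝ) * l) • e with hc
  have hρ : 0 < κ * l := mul_pos hκ hl0
  have hPl : ∀ y ∈ P, ∀ h ∈ Metric.ball c (κ * l), (y, h) ∈ Sg N Ω := fun y hy h hh =>
    hP y hy l ⟨hl0, hlr⟩ h (Metric.ball_subset_closedBall hh)
  have hPball : ∀ x ∈ P, Metric.ball (x + c) (κ * l) ⊆ Ω := by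
    intro x hx y hy
    have : y - x ∈ Metric.ball c (κ * l) := by
      rw [Metric.mem_ball, dist_eq_norm] at hy ⊢
      convert hy using 2; abel
    have := hPl x hx _ this 1 (by simp)
    simpa using this
  have hPfin : volume P ≠ ⊤ := ((measure_mono hPΩ).trans_lt hbd.lt_top).ne
  have havg := patch_avg N hN Ω hΩ P hPm hPfin c (κ * l) hρ hPball w (fun k => (hw k).1) hw2 C hC hweak
  set A : ℕ → Euc N → ℝ := fun k x => ∫ h, w k (x + h) ∂(nuB N c (κ * l)) with hA
  have hAm : ∀ k, Measurable (A k) := fun k => avg_measurable N c _ hρ _ (hw k).1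
  have hest : ∀ᶠ k in atTop, ∫⁻ x in P, ENNReal.ofReal ((w k x - A k x) ^ 2) ≤ ENNReal.ofReal (ε / 9) := by
    filter_upwards [hev] with k hk
    refine (patch_est N hN Ω hΩ P hPm hPΩ e κ l he hκ hκ4 hl0 hl1 hPl (sk k) (hsk k) hk.2 (w k) (hw k)).trans ?_
    have hcp := cNs_pos N _ (hsk k)
    have h4 : 0 ≤ 1 - (4:ℝ) ^ (sk k - 1) := by
      have : (4:ℝ) ^ (sk k - 1) ≤ 1 := Real.rpow_le_one_of_one_le_of_nonpos (by norm_num) (by linarith [(hsk k).2])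
      linarith
    rw [← ENNReal.ofReal_toReal (hw k).2.2.ne, ← ENNReal.ofReal_mul h4, ← ENNReal.ofReal_mul (by positivity)]
    apply ENNReal.ofReal_le_ofReal
    refine le_trans ?_ hlD
    rw [hD]
    have h5 : (1 - (4:ℝ) ^ (sk k - 1)) * (semiSq N (sk k) Ω (w k)).toReal ≤ C0 * M := by
      calc _ = (1 - (4:ℝ) ^ (sk k - 1)) / (cNs N (sk k) / 2) * (cNs N (sk k) / 2 * (semiSq N (sk k) Ω (w k)).toReal) := by
            field_simp
        _ ≤ C0 * M := by
            gcongr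
            · exact hk.1
            · exact hM k
    calc _ = l * ((1 - (4:ℝ) ^ (sk k - 1)) * (semiSq N (sk k) Ω (w k)).toReal / (κ ^ N * bN N)) := by ring
      _ ≤ _ := by gcongr
  have hest1 : ∀ᶠ p : ℕ × ℕ in atTop, ∫⁻ x in P, ENNReal.ofReal ((w p.1 x - A p.1 x) ^ 2) ≤ ENNReal.ofReal (ε / 9) := by
    rw [← prod_atTop_atTop_eq]; exact tendsto_fst.eventually hest
  have hest2 : ∀ᶠ p : ℕ × ℕ in atTop, ∫⁻ x in P, ENNReal.ofReal ((w p.2 x - A p.2 x) ^ 2) ≤ ENNReal.ofReal (ε / 9) := by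
    rw [← prod_atTop_atTop_eq]; exact tendsto_snd.eventually hest
  have hest3 : ∀ᶠ p : ℕ × ℕ in atTop, ∫⁻ x in P, ENNReal.ofReal ((A p.1 x - A p.2 x) ^ 2) ≤ ENNReal.ofReal (ε / 9) := by
    exact (ENNReal.tendsto_nhds_zero.1 havg) _ (ENNReal.ofReal_pos.2 (by positivity))
  filter_upwards [hest1, hest2, hest3] with p h1 h2 h3
  have m1 : Measurable fun x => ENNReal.ofReal ((w p.1 x - A p.1 x) ^ 2) :=
    (((hw p.1).1.sub (hAm p.1)).pow_const 2).ennreal_ofReal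
  have m2 : Measurable fun x => ENNReal.ofReal ((w p.2 x - A p.2 x) ^ 2) :=
    (((hw p.2).1.sub (hAm p.2)).pow_const 2).ennreal_ofReal
  calc ∫⁻ x in P, ENNReal.ofReal ((w p.1 x - w p.2 x) ^ 2)
      ≤ ∫⁻ x in P, (ENNReal.ofReal 3 * (ENNReal.ofReal ((w p.1 x - A p.1 x) ^ 2) +
        (ENNReal.ofReal ((w p.2 x - A p.2 x) ^ 2) + ENNReal.ofReal ((A p.1 x - A p.2 x) ^ 2)))) := by
        apply lintegral_mono
        intro x
        beta_reduce
        rw [← ENNReal.ofReal_add (by positivity) (by positivity), ← ENNReal.ofReal_add (by positivity) (by positivity),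
          ← ENNReal.ofReal_mul (by norm_num)]
        apply ENNReal.ofReal_le_ofReal
        nlinarith [sq_nonneg ((w p.1 x - A p.1 x) + (w p.2 x - A p.2 x)),
          sq_nonneg ((w p.1 x - A p.1 x) - (A p.1 x - A p.2 x)), sq_nonneg ((w p.2 x - A p.2 x) + (A p.1 x - A p.2 x))]
    _ = ENNReal.ofReal 3 * ((∫⁻ x in P, ENNReal.ofReal ((w p.1 x - A p.1 x) ^ 2)) +
        ((∫⁻ x in P, ENNReal.ofReal ((w p.2 x - A p.2 x) ^ 2)) + ∫⁻ x in P, ENNReal.ofReal ((A p.1 x - A p.2 x) ^ 2))) := by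
        rw [lintegral_const_mul' _ _ ENNReal.ofReal_ne_top, lintegral_add_left m1, lintegral_add_left m2]
    _ ≤ ENNReal.ofReal 3 * (ENNReal.ofReal (ε / 9) + (ENNReal.ofReal (ε / 9) + ENNReal.ofReal (ε / 9))) := by gcongr
    _ = ε := by
        rw [← ENNReal.ofReal_add (by positivity) (by positivity), ← ENNReal.ofReal_add (by positivity) (by positivity),
          ← ENNReal.ofReal_mul (by norm_num), show (3:ℝ) * (ε / 9 + (ε / 9 + ε / 9)) = ε by ring]
        exact ENNReal.ofReal_coe_nnreal

lemma vol_ne_top {N : ℕ} {Ω : Set (Euc N)} (hΩ : IsLipschitzDomain N Ω) : volume Ω ≠ ⊤ :=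
  hΩ.2.1.measure_lt_top.ne

lemma lint_biUnion_le {α ι : Type*} [MeasurableSpace α] (μ : Measure α) (t : Finset ι) (S : ι → Set α) (f : α → ℝ≥0∞) :
    ∫⁻ x in ⋃ i ∈ t, S i, f x ∂μ ≤ ∑ i ∈ t, ∫⁻ x in S i, f x ∂μ := by
  rw [← lintegral_finsetSum_measure]
  apply lintegral_mono'
  · rw [Measure.le_iff]
    intro s hs
    rw [Measure.restrict_apply hs, Measure.finsetSum_apply, inter_iUnion₂]
    refine (measure_biUnion_finset_le _ _).trans (Finset.sum_le_sum fun i _ => ?_)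
    rw [Measure.restrict_apply hs]
  · exact le_rfl

/-- finite cone cover of the closure -/
lemma cone_cover (N : ℕ) (hN : 2 ≤ N) (Ω : Set (Euc N)) (hΩ : IsLipschitzDomain N Ω) :
    ∃ (t : Finset (Euc N)) (r : Euc N → ℝ) (e : Euc N → Euc N) (κ : Euc N → ℝ),
      (∀ x ∈ t, ‖e x‖ = 1 ∧ 0 < κ x ∧ κ x ≤ 1 / 4 ∧ 0 < r x ∧ ∀ y ∈ Ω ∩ Metric.ball x (r x), ∀ l ∈ Ioc 0 (r x),
        ∀ h ∈ Metric.closedBall (((3 / 4 : ℝ) * l) • e x) (κ x * l), (y, h) ∈ Sg N Ω) ∧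
      closure Ω ⊆ ⋃ x ∈ t, Metric.ball x (r x) := by
  have H : ∀ x : Euc N, ∃ (e : Euc N) (κ r : ℝ), x ∈ closure Ω → (‖e‖ = 1 ∧ 0 < κ ∧ κ ≤ 1 / 4 ∧ 0 < r ∧
      ∀ y ∈ Ω ∩ Metric.ball x r, ∀ l ∈ Ioc 0 r,
        ∀ h ∈ Metric.closedBall (((3 / 4 : ℝ) * l) • e) (κ * l), (y, h) ∈ Sg N Ω) := by
    intro x
    by_cases hx : x ∈ closure Ω
    · obtain ⟨e, κ, r, h⟩ := cone N hN Ω hΩ x hx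
      exact ⟨e, κ, r, fun _ => h⟩
    · exact ⟨0, 0, 0, fun h => absurd h hx⟩
  choose e κ r hH using H
  have hcomp : IsCompact (closure Ω) := hΩ.2.1.isCompact_closure
  obtain ⟨t, ht, hcov⟩ := hcomp.elim_nhds_subcover (fun x => Metric.ball x (r x))
    (fun x hx => Metric.ball_mem_nhds x (hH x hx).2.2.2.1)
  exact ⟨t, r, e, κ, fun x hx => hH x (ht x hx), hcov⟩

lemma compact_seq (N : ℕ) (hN : 2 ≤ N) (Ω : Set (Euc N)) (hΩ : IsLipschitzDomain N Ω)
    (sk : ℕ → ℝ) (hsk : ∀ k, sk k ∈ Ioo (0:ℝ) 1) (hlim : Tendsto sk atTop (𝓝 1))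
    (w : ℕ → Euc N → ℝ) (hw : ∀ k, memHs N (sk k) Ω (w k))
    (C M : ℝ) (hC : ∀ k, ∫ x in Ω, (w k x) ^ 2 ≤ C)
    (hM : ∀ k, cNs N (sk k) / 2 * (semiSq N (sk k) Ω (w k)).toReal ≤ M) :
    ∃ φ : ℕ → ℕ, StrictMono φ ∧ ∃ w0 : Euc N → ℝ, Measurable w0 ∧ MemLp w0 2 (volume.restrict Ω) ∧
      Tendsto (fun k => ∫ x in Ω, (w (φ k) x - w0 x) ^ 2) atTop (𝓝 0) := by
  have hw2 : ∀ k, MemLp (w k) 2 (volume.restrict Ω) := fun k => memL2_of (hw k).1 (hw k).2.1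
  have hCn : ∀ k, ‖(hw2 k).toLp (w k)‖ ≤ Real.sqrt C := by
    intro k
    apply Real.le_sqrt_of_sq_le
    rw [norm_sq_toLp]; exact hC k
  haveI : Fact ((1:ℝ≥0∞) ≤ 2) := ⟨by norm_num⟩
  haveI : Fact ((2:ℝ≥0∞) ≠ ⊤) := ⟨by norm_num⟩
  obtain ⟨φ, hφ, hweak⟩ := weak_subseq (fun k => (hw2 k).toLp (w k)) (Real.sqrt C) hCn
  refine ⟨φ, hφ, ?_⟩
  obtain ⟨t, r, e, κ, ht, hcov⟩ := cone_cover N hN Ω hΩ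
  have hpatch : ∀ x ∈ t, Tendsto (fun p : ℕ × ℕ => ∫⁻ y in Ω ∩ Metric.ball x (r x),
      ENNReal.ofReal ((w (φ p.1) y - w (φ p.2) y) ^ 2)) atTop (𝓝 0) := by
    intro x hx
    obtain ⟨h1, h2, h3, h4, h5⟩ := ht x hx
    exact patch_cauchy N hN Ω hΩ.1 (vol_ne_top hΩ) _ (hΩ.1.measurableSet.inter measurableSet_ball) inter_subset_left
      (e x) (κ x) (r x) h1 h2 h3 h4 h5 (fun k => sk (φ k)) (fun k => hsk _) (hlim.comp hφ.tendsto_atTop)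
      (fun k => w (φ k)) (fun k => hw _) (fun k => hw2 _) (Real.sqrt C) M (fun k => hCn _) (fun k => hM _) hweak
  have hsum : Tendsto (fun p : ℕ × ℕ => ∑ x ∈ t, ∫⁻ y in Ω ∩ Metric.ball x (r x),
      ENNReal.ofReal ((w (φ p.1) y - w (φ p.2) y) ^ 2)) atTop (𝓝 0) := by
    have := tendsto_finset_sum t hpatch
    simpa using this
  have hfull : Tendsto (fun p : ℕ × ℕ => ∫⁻ y in Ω, ENNReal.ofReal ((w (φ p.1) y - w (φ p.2) y) ^ 2)) atTop (𝓝 0) := by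
    refine tendsto_of_tendsto_of_tendsto_of_le_of_le tendsto_const_nhds hsum (fun _ => zero_le) ?_
    intro p
    have hsub : Ω ⊆ ⋃ x ∈ t, (Ω ∩ Metric.ball x (r x)) := by
      intro y hy
      have := hcov (subset_closure hy)
      simp only [mem_iUnion] at this ⊢
      obtain ⟨x, hx, hyx⟩ := this
      exact ⟨x, hx, hy, hyx⟩
    refine (lintegral_mono_set hsub).trans ?_
    exact lint_biUnion_le _ _ _ _
  have hdist : ∀ k l, dist ((hw2 (φ k)).toLp (w (φ k))) ((hw2 (φ l)).toLp (w (φ l))) =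
      Real.sqrt (∫⁻ y in Ω, ENNReal.ofReal ((w (φ k) y - w (φ l) y) ^ 2)).toReal := by
    intro k l
    rw [dist_eq_norm, ← MemLp.toLp_sub, ← Real.sqrt_sq (norm_nonneg _), norm_sq_toLp]
    congr 1
    rw [integral_eq_lintegral_of_nonneg_ae (Eventually.of_forall fun x => sq_nonneg _)]
    · rfl
    · exact (((hw2 (φ k)).sub (hw2 (φ l))).aestronglyMeasurable.pow 2)
  have hcau : CauchySeq (fun k => (hw2 (φ k)).toLp (w (φ k))) := by
    rw [cauchySeq_iff_tendsto_dist_atTop_0]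
    simp_rw [hdist]
    have h1 := (ENNReal.continuousAt_toReal ENNReal.zero_ne_top).tendsto.comp hfull
    have h2 := (Real.continuous_sqrt.tendsto _).comp h1
    simpa [Function.comp_def] using h2
  obtain ⟨W, hW⟩ := cauchySeq_tendsto_of_complete hcau
  refine ⟨W, (Lp.stronglyMeasurable W).measurable, Lp.memLp W, ?_⟩
  have h1 := (tendsto_iff_norm_sub_tendsto_zero.1 hW).pow 2
  simp only [ne_eq, OfNat.ofNat_ne_zero, not_false_eq_true, zero_pow] at h1
  refine h1.congr ?_
  intro k
  have : (hw2 (φ k)).toLp (w (φ k)) - W = ((hw2 (φ k)).sub (Lp.memLp W)).toLp _ := by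
    rw [MemLp.toLp_sub (hw2 (φ k)) (Lp.memLp W), Lp.toLp_coeFn]
  rw [this, norm_sq_toLp]
  rfl

/-! ### Moments and Taylor -/

lemma inner_moment (N : ℕ) (hN : 2 ≤ N) (δ s : ℝ) (hδ : 0 < δ) (hs : s ∈ Ioo (0:ℝ) 1) (a : Euc N) :
    IntegrableOn (fun h : Euc N => (inner ℝ a h : ℝ) ^ 2 * ‖h‖ ^ (-((N : ℝ) + 2 * s))) (Metric.ball 0 δ) ∧
    ∫ h in Metric.ball (0 : Euc N) δ, (inner ℝ a h : ℝ) ^ 2 * ‖h‖ ^ (-((N : ℝ) + 2 * s))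
      = ‖a‖ ^ 2 * (bN N * δ ^ (2 - 2 * s) / (2 - 2 * s)) := by
  have hN0 : (0:ℝ) < N := by exact_mod_cast (by omega : 0 < N)
  have hbN := bN_pos N hN
  have hp : 0 < 2 - 2 * s := by linarith [hs.2]
  set k : ℝ → ℝ := (Iio δ).indicator (fun t => |t| ^ (-((N : ℝ) + 2 * s))) with hk
  have hk0 : ∀ t, 0 ≤ k t := fun t => indicator_nonneg (fun x _ => by positivity) t
  have hkm : Measurable k := by
    apply Measurable.indicator _ measurableSet_Iio
    exact (measurable_id.norm).pow_const _
  have key := lint_inner_sq N hN a k hk0 hkm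
  have conv : ∀ F : Euc N → ℝ, (fun h => ENNReal.ofReal (F h * k ‖h‖)) =
      (Metric.ball (0 : Euc N) δ).indicator (fun h => ENNReal.ofReal (F h * ‖h‖ ^ (-((N : ℝ) + 2 * s)))) := by
    intro F; ext h
    by_cases hh : h ∈ Metric.ball (0 : Euc N) δ
    · have h2 : ‖h‖ ∈ Iio δ := by simpa using hh
      rw [indicator_of_mem hh, hk, indicator_of_mem h2, abs_of_nonneg (norm_nonneg h)]
    · have h2 : ‖h‖ ∉ Iio δ := by simpa using hh
      rw [indicator_of_notMem hh, hk, indicator_of_notMem h2, mul_zero, ENNReal.ofReal_zero]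
  rw [conv, conv (fun h => ‖h‖ ^ 2), lintegral_indicator measurableSet_ball, lintegral_indicator measurableSet_ball] at key
  have e1 : ∫⁻ h in Metric.ball (0 : Euc N) δ, ENNReal.ofReal (‖h‖ ^ 2 * ‖h‖ ^ (-((N : ℝ) + 2 * s))) =
      ENNReal.ofReal (N * bN N * δ ^ (2 - 2 * s) / (2 - 2 * s)) := by
    rw [← lint_ball_rpow N hN δ _ hδ hp]
    apply lintegral_congr_ae
    have h0 : ∀ᵐ h : Euc N ∂(volume.restrict (Metric.ball (0 : Euc N) δ)), h ≠ 0 := by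
      haveI : Nontrivial (Euc N) := by
        apply Module.nontrivial_of_finrank_pos (R := ℝ); simp; omega
      exact ae_restrict_of_ae (Measure.ae_ne volume 0)
    filter_upwards [h0] with h hh
    have : 0 < ‖h‖ := norm_pos_iff.2 hh
    rw [← Real.rpow_natCast, ← Real.rpow_add this]
    congr 2; push_cast; ring
  rw [e1, ← ENNReal.ofReal_mul (by positivity)] at key
  have e2 : ‖a‖ ^ 2 / N * (N * bN N * δ ^ (2 - 2 * s) / (2 - 2 * s)) = ‖a‖ ^ 2 * (bN N * δ ^ (2 - 2 * s) / (2 - 2 * s)) := by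
    field_simp
  rw [e2] at key
  have hm : Measurable (fun h : Euc N => (inner ℝ a h : ℝ) ^ 2 * ‖h‖ ^ (-((N : ℝ) + 2 * s))) := by
    refine Measurable.mul (by fun_prop) ?_
    exact measurable_norm.pow_const _
  have hnn : ∀ h : Euc N, 0 ≤ (inner ℝ a h : ℝ) ^ 2 * ‖h‖ ^ (-((N : ℝ) + 2 * s)) := fun h => by positivity
  constructor
  · refine ⟨hm.aestronglyMeasurable, ?_⟩
    rw [hasFiniteIntegral_iff_ofReal (Eventually.of_forall hnn), key]
    exact ENNReal.ofReal_lt_top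
  · rw [integral_eq_lintegral_of_nonneg_ae (Eventually.of_forall hnn) hm.aestronglyMeasurable, key,
      ENNReal.toReal_ofReal (by positivity)]

lemma coord_moment (N : ℕ) (hN : 2 ≤ N) (δ s : ℝ) (hδ : 0 < δ) (hs : s ∈ Ioo (0:ℝ) 1) (i j : Fin N) :
    IntegrableOn (fun h : Euc N => h i * h j * ‖h‖ ^ (-((N : ℝ) + 2 * s))) (Metric.ball 0 δ) ∧
    ∫ h in Metric.ball (0 : Euc N) δ, h i * h j * ‖h‖ ^ (-((N : ℝ) + 2 * s))
      = if i = j then bN N * δ ^ (2 - 2 * s) / (2 - 2 * s) else 0 := by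
  set ei : Euc N := EuclideanSpace.single i 1
  set ej : Euc N := EuclideanSpace.single j 1
  have hi : ∀ h : Euc N, (inner ℝ ei h : ℝ) = h i := fun h => by simp [ei, EuclideanSpace.inner_single_left]
  have hj : ∀ h : Euc N, (inner ℝ ej h : ℝ) = h j := fun h => by simp [ej, EuclideanSpace.inner_single_left]
  obtain ⟨p1, p2⟩ := inner_moment N hN δ s hδ hs (ei + ej)
  obtain ⟨q1, q2⟩ := inner_moment N hN δ s hδ hs (ei - ej)
  have e : (fun h : Euc N => h i * h j * ‖h‖ ^ (-((N : ℝ) + 2 * s))) = fun h =>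
      (1/4) * ((inner ℝ (ei + ej) h : ℝ) ^ 2 * ‖h‖ ^ (-((N : ℝ) + 2 * s)) -
        (inner ℝ (ei - ej) h : ℝ) ^ 2 * ‖h‖ ^ (-((N : ℝ) + 2 * s))) := by
    ext h
    rw [inner_add_left, inner_sub_left, hi, hj]; ring
  rw [e]
  refine ⟨(p1.sub q1).const_mul _, ?_⟩
  rw [integral_const_mul, integral_sub p1 q1, p2, q2]
  have n1 : ‖ei + ej‖ ^ 2 - ‖ei - ej‖ ^ 2 = if i = j then 4 else 0 := by
    rw [norm_add_sq_real, norm_sub_sq_real, hi]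
    simp only [ej, PiLp.single_apply]
    split_ifs <;> ring
  rw [← sub_mul, n1]
  split_ifs <;> ring

lemma taylor2 {F : Type*} [NormedAddCommGroup F] [NormedSpace ℝ F] (N : ℕ) (V : Euc N → F)
    (hV : ContDiff ℝ (⊤ : ℕ∞) V) (hc : HasCompactSupport V) :
    ∃ C : ℝ, 0 ≤ C ∧ (∀ x, ‖V x‖ ≤ C) ∧ (∀ x, ‖fderiv ℝ V x‖ ≤ C) ∧
      ∀ x h, ‖V (x + h) - V x - fderiv ℝ V x h‖ ≤ C * ‖h‖ ^ 2 := by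
  have hd : ContDiff ℝ (⊤ : ℕ∞) (fderiv ℝ V) := by
    exact hV.fderiv_right (m := (⊤ : ℕ∞)) (by simp)
  have hdc : HasCompactSupport (fderiv ℝ V) := hc.fderiv ℝ
  obtain ⟨K, hK⟩ := ContDiff.lipschitzWith_of_hasCompactSupport hdc hd (by simp)
  obtain ⟨C1, hC1⟩ := hV.continuous.bounded_above_of_compact_support hc
  obtain ⟨C2, hC2⟩ := hd.continuous.bounded_above_of_compact_support hdc
  refine ⟨max (max C1 C2) K, ?_, fun x => (hC1 x).trans ?_, fun x => (hC2 x).trans ?_, ?_⟩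
  · exact le_max_of_le_right K.2
  · exact (le_max_left _ _).trans (le_max_left _ _)
  · exact (le_max_right _ _).trans (le_max_left _ _)
  intro x h
  have hh := Convex.norm_image_sub_le_of_norm_fderiv_le' (𝕜 := ℝ) (f := V) (φ := fderiv ℝ V x) (C := K * ‖h‖)
    (s := segment ℝ x (x + h)) (x := x) (y := x + h) (fun y _ => hV.differentiable (by simp) y) ?_
    (convex_segment _ _) (left_mem_segment _ _ _) (right_mem_segment _ _ _)
  · simp only [add_sub_cancel_left] at hh
    refine hh.trans ?_
    calc (K : ℝ) * ‖h‖ * ‖h‖ = K * ‖h‖ ^ 2 := by ring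
      _ ≤ _ := by gcongr; exact le_max_right _ _
  · intro y hy
    have := hK.dist_le_mul y x
    rw [dist_eq_norm, dist_eq_norm] at this
    refine this.trans ?_
    gcongr
    obtain ⟨a, b, ha, hb, hab, rfl⟩ := hy
    have : a • x + b • (x + h) - x = b • h := by
      have : a = 1 - b := by linarith
      subst this
      module
    rw [this, norm_smul, Real.norm_eq_abs, abs_of_nonneg hb]
    nlinarith [norm_nonneg h]

lemma ofReal_integral_le {α : Type*} [MeasurableSpace α] (μ : Measure α) (f : α → ℝ) :
    ENNReal.ofReal (∫ x, f x ∂μ) ≤ ∫⁻ x, ENNReal.ofReal (f x) ∂μ := by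
  by_cases hf : Integrable f μ
  · rw [integral_eq_lintegral_pos_part_sub_lintegral_neg_part hf]
    refine (ENNReal.ofReal_le_ofReal (sub_le_self _ ENNReal.toReal_nonneg)).trans ?_
    exact ENNReal.ofReal_toReal_le
  · rw [integral_undef hf]; simp

/-! ### Lower bound of the nonlocal energy by duality -/

def bas (N : ℕ) (i : Fin N) : Euc N := EuclideanSpace.single i 1

def Qf (N : ℕ) (W : Euc N → ℝ) (V : Euc N → Euc N) (i j : Fin N) (x : Euc N) : ℝ :=
  -2 * (W x * (fderiv ℝ V x (bas N j)) i) - V x i * V x j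

lemma vec_sum (N : ℕ) (h : Euc N) : h = ∑ j, h j • bas N j := by
  ext i
  simp [bas, Pi.single_apply]

lemma inner_coord (N : ℕ) (x y : Euc N) : (inner ℝ x y : ℝ) = ∑ i, x i * y i := by
  rw [PiLp.inner_apply]
  apply Finset.sum_congr rfl
  intro i _
  simp [mul_comm]

lemma Qf_integrable (N : ℕ) (W : Euc N → ℝ) (hW : Integrable W) (V : Euc N → Euc N)
    (hV : ContDiff ℝ (⊤ : ℕ∞) V) (hc : HasCompactSupport V) (i j : Fin N) : Integrable (Qf N W V i j) := by
  obtain ⟨C, hC, hC1, hC2, hC3⟩ := taylor2 N V hV hc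
  have hd : Continuous (fderiv ℝ V) := hV.continuous_fderiv (by simp)
  unfold Qf
  apply Integrable.sub
  · apply Integrable.const_mul
    apply hW.mul_bdd (c := C * ‖bas N j‖)
    · apply Continuous.aestronglyMeasurable
      fun_prop
    · apply Eventually.of_forall
      intro x
      refine (PiLp.norm_apply_le _ i).trans ?_
      exact ((fderiv ℝ V x).le_opNorm _).trans (by gcongr; exact hC2 x)
  · apply Continuous.integrable_of_hasCompactSupport
    · have := hV.continuous
      fun_prop
    · apply hc.mono
      intro x hx
      simp only [Function.mem_support, ne_eq, mul_eq_zero, not_or] at hx ⊢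
      intro h
      exact hx.1 (by rw [h]; rfl)

lemma Qf_sum (N : ℕ) (W : Euc N → ℝ) (V : Euc N → Euc N) (x h : Euc N) :
    ∑ i, ∑ j, Qf N W V i j x * (h i * h j) =
      -2 * (W x * inner ℝ (fderiv ℝ V x h) h) - (inner ℝ (V x) h : ℝ) ^ 2 := by
  have e1 : (inner ℝ (fderiv ℝ V x h) h : ℝ) = ∑ i, ∑ j, (fderiv ℝ V x (bas N j)) i * (h i * h j) := by
    rw [inner_coord]
    apply Finset.sum_congr rfl
    intro i _
    have e0 : fderiv ℝ V x h = ∑ j, h j • fderiv ℝ V x (bas N j) := by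
      conv_lhs => rw [vec_sum N h]
      rw [map_sum]
      simp only [map_smul]
    rw [e0]
    simp only [WithLp.ofLp_sum, Finset.sum_apply, PiLp.smul_apply, smul_eq_mul, Finset.sum_mul]
    apply Finset.sum_congr rfl
    intro j _
    ring
  have e2 : (inner ℝ (V x) h : ℝ) ^ 2 = ∑ i, ∑ j, V x i * V x j * (h i * h j) := by
    rw [inner_coord, sq, Finset.sum_mul_sum]
    apply Finset.sum_congr rfl
    intro i _
    apply Finset.sum_congr rfl
    intro j _
    ring
  rw [e1, e2]
  simp only [Finset.mul_sum, ← Finset.sum_sub_distrib]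
  apply Finset.sum_congr rfl
  intro i _
  apply Finset.sum_congr rfl
  intro j _
  unfold Qf
  ring

lemma Gf_lower (N : ℕ) (Ω : Set (Euc N)) (w : Euc N → ℝ) (hwI : Integrable (Ω.indicator w))
    (V : Euc N → Euc N) (hV : ContDiff ℝ (⊤ : ℕ∞) V) (hc : HasCompactSupport V)
    (C : ℝ) (hC : 0 ≤ C) (hC1 : ∀ x, ‖V x‖ ≤ C)
    (hC3 : ∀ x h, ‖V (x + h) - V x - fderiv ℝ V x h‖ ≤ C * ‖h‖ ^ 2)
    (δ : ℝ) (hδ : Metric.cthickening δ (tsupport V) ⊆ Ω) (h : Euc N) (hh : ‖h‖ < δ) :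
    ENNReal.ofReal (∑ i, ∑ j, (∫ x, Qf N (Ω.indicator w) V i j x) * (h i * h j) -
      2 * C * ‖h‖ ^ 3 * ∫ x, |Ω.indicator w x|) ≤ Gf N Ω w h := by
  set W := Ω.indicator w with hW
  have hVc := hV.continuous
  have hSg : ∀ x, V x ≠ 0 → (x, h) ∈ Sg N Ω := by
    intro x hx t ht
    apply hδ
    have hx' : x ∈ tsupport V := subset_tsupport _ hx
    apply Metric.mem_cthickening_of_dist_le _ x δ _ hx'
    rw [dist_eq_norm]
    simp only [add_sub_cancel_left, norm_smul, Real.norm_eq_abs, abs_of_nonneg ht.1]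
    nlinarith [ht.2, ht.1, norm_nonneg h]
  set f : Euc N → ℝ := fun x => 2 * ((W (x + h) - W x) * inner ℝ (V x) h) - (inner ℝ (V x) h : ℝ) ^ 2 with hf
  have h1 : ENNReal.ofReal (∫ x, f x) ≤ Gf N Ω w h := by
    refine (ofReal_integral_le _ f).trans ?_
    unfold Gf
    apply lintegral_mono
    intro x
    beta_reduce
    by_cases hx : V x = 0
    · simp [hf, hx]
    · have hs := hSg x hx
      have hx0 : x ∈ Ω := by simpa using hs 0 (by simp)
      have hx1 : x + h ∈ Ω := by simpa using hs 1 (by simp)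
      rw [indicator_of_mem hs]
      apply ENNReal.ofReal_le_ofReal
      simp only [hf, hW, indicator_of_mem hx0, indicator_of_mem hx1]
      nlinarith [sq_nonneg (w (x + h) - w x - inner ℝ (V x) h)]
  refine le_trans (ENNReal.ofReal_le_ofReal ?_) h1
  have hinnerb : ∀ y, ‖(inner ℝ (V y) h : ℝ)‖ ≤ C * ‖h‖ := by
    intro y
    rw [Real.norm_eq_abs]
    exact (abs_real_inner_le_norm _ _).trans (by gcongr; exact hC1 y)
  have i1 : Integrable (fun x => W (x + h) * (inner ℝ (V x) h : ℝ)) := by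
    apply (hwI.comp_add_right h).mul_bdd (c := C * ‖h‖)
    · exact (by fun_prop : Continuous fun x => (inner ℝ (V x) h : ℝ)).aestronglyMeasurable
    · exact Eventually.of_forall hinnerb
  have i2 : Integrable (fun x => W x * (inner ℝ (V x) h : ℝ)) := by
    apply hwI.mul_bdd (c := C * ‖h‖)
    · exact (by fun_prop : Continuous fun x => (inner ℝ (V x) h : ℝ)).aestronglyMeasurable
    · exact Eventually.of_forall hinnerb
  have i3 : Integrable (fun x => W x * (inner ℝ (V (x - h)) h : ℝ)) := by
    apply hwI.mul_bdd (c := C * ‖h‖)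
    · exact (by fun_prop : Continuous fun x => (inner ℝ (V (x - h)) h : ℝ)).aestronglyMeasurable
    · exact Eventually.of_forall fun x => hinnerb _
  have i4 : Integrable (fun x => (inner ℝ (V x) h : ℝ) ^ 2) := by
    apply Continuous.integrable_of_hasCompactSupport (by fun_prop)
    apply hc.mono
    intro x hx
    simp only [Function.mem_support, ne_eq] at hx ⊢
    intro h0
    exact hx (by rw [h0]; simp)
  have e1 : ∫ x, f x = ∫ x, (2 * (W x * inner ℝ (V (x - h)) h - W x * inner ℝ (V x) h) - (inner ℝ (V x) h : ℝ) ^ 2) := by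
    have ea : f = fun x => 2 * (W (x + h) * inner ℝ (V x) h - W x * inner ℝ (V x) h) - (inner ℝ (V x) h : ℝ) ^ 2 := by
      ext x; simp only [hf]; ring
    have i12 : Integrable (fun x => 2 * (W (x + h) * inner ℝ (V x) h - W x * inner ℝ (V x) h)) := (i1.sub i2).const_mul 2
    have i32 : Integrable (fun x => 2 * (W x * inner ℝ (V (x - h)) h - W x * inner ℝ (V x) h)) := (i3.sub i2).const_mul 2
    rw [ea]
    beta_reduce
    rw [integral_sub i12 i4, integral_sub i32 i4,
      integral_const_mul, integral_const_mul, integral_sub i1 i2, integral_sub i3 i2]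
    have := integral_add_right_eq_self (μ := (volume : Measure (Euc N))) (fun x => W x * (inner ℝ (V (x - h)) h : ℝ)) h
    simp only [add_sub_cancel_right] at this
    rw [this]
  rw [e1]
  have e2 : ∑ i, ∑ j, (∫ x, Qf N W V i j x) * (h i * h j) = ∫ x, ∑ i, ∑ j, Qf N W V i j x * (h i * h j) := by
    rw [integral_finsetSum]
    · apply Finset.sum_congr rfl
      intro i _
      rw [integral_finsetSum]
      · apply Finset.sum_congr rfl
        intro j _
        rw [integral_mul_const]
      · intro j _
        exact (Qf_integrable N W hwI V hV hc i j).mul_const _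
    · intro i _
      apply integrable_finsetSum
      intro j _
      exact (Qf_integrable N W hwI V hV hc i j).mul_const _
  have i5 : Integrable (fun x => ∑ i, ∑ j, Qf N W V i j x * (h i * h j)) := by
    apply integrable_finsetSum
    intro i _
    apply integrable_finsetSum
    intro j _
    exact (Qf_integrable N W hwI V hV hc i j).mul_const _
  rw [e2, ← integral_const_mul, ← integral_sub i5 (hwI.abs.const_mul _)]
  apply integral_mono (i5.sub (hwI.abs.const_mul _)) (((i3.sub i2).const_mul 2).sub i4)
  intro x
  simp only [Pi.sub_apply]
  rw [Qf_sum]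
  have ht := hC3 x (-h)
  rw [← sub_eq_add_neg, norm_neg] at ht
  have hin : |(inner ℝ (V (x - h) - V x - fderiv ℝ V x (-h)) h : ℝ)| ≤ C * ‖h‖ ^ 2 * ‖h‖ :=
    (abs_real_inner_le_norm _ _).trans (by gcongr)
  rw [inner_sub_left, inner_sub_left, map_neg, inner_neg_left] at hin
  have hp : |W x * ((inner ℝ (V (x - h)) h : ℝ) - inner ℝ (V x) h - -inner ℝ (fderiv ℝ V x h) h)| ≤
      |W x| * (C * ‖h‖ ^ 2 * ‖h‖) := by
    rw [abs_mul]; gcongr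
  have := (abs_le.1 hp).1
  nlinarith

lemma semi_lower (N : ℕ) (hN : 2 ≤ N) (Ω : Set (Euc N)) (hΩ : IsOpen Ω) (w : Euc N → ℝ) (hw : Measurable w)
    (hwI : Integrable (Ω.indicator w))
    (V : Euc N → Euc N) (hV : ContDiff ℝ (⊤ : ℕ∞) V) (hc : HasCompactSupport V)
    (C : ℝ) (hC : 0 ≤ C) (hC1 : ∀ x, ‖V x‖ ≤ C)
    (hC3 : ∀ x h, ‖V (x + h) - V x - fderiv ℝ V x h‖ ≤ C * ‖h‖ ^ 2)
    (δ : ℝ) (hδ0 : 0 < δ) (hδ : Metric.cthickening δ (tsupport V) ⊆ Ω) (s : ℝ) (hs : s ∈ Ioo (0:ℝ) 1) :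
    ENNReal.ofReal ((∑ i, ∫ x, Qf N (Ω.indicator w) V i i x) * (bN N * δ ^ (2 - 2 * s) / (2 - 2 * s)) -
      2 * C * (∫ x, |Ω.indicator w x|) * (N * bN N * δ ^ (3 - 2 * s) / (3 - 2 * s))) ≤ semiSq N s Ω w := by
  refine le_trans ?_ (Gf_le N s Ω hΩ w hw)
  set q : Fin N → Fin N → ℝ := fun i j => ∫ x, Qf N (Ω.indicator w) V i j x with hq
  set B := ∫ x, |Ω.indicator w x| with hB
  set k : Euc N → ℝ := fun h => ‖h‖ ^ (-((N : ℝ) + 2 * s)) with hk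
  set R : Euc N → ℝ := fun h => ∑ i, ∑ j, q i j * (h i * h j) - 2 * C * ‖h‖ ^ 3 * B with hR
  have hp : 0 < 3 - 2 * s := by linarith [hs.2]
  obtain ⟨b1, b2⟩ := ball_rpow N hN δ (3 - 2 * s) hδ0 hp
  have hae : (fun h : Euc N => ‖h‖ ^ (3 - 2 * s - N)) =ᵐ[volume.restrict (Metric.ball (0 : Euc N) δ)] fun h => ‖h‖ ^ 3 * k h := by
    have h0 : ∀ᵐ h : Euc N ∂(volume.restrict (Metric.ball (0 : Euc N) δ)), h ≠ 0 := by
      haveI : Nontrivial (Euc N) := by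
        apply Module.nontrivial_of_finrank_pos (R := ℝ); simp; omega
      exact ae_restrict_of_ae (Measure.ae_ne volume 0)
    filter_upwards [h0] with h hh
    have : 0 < ‖h‖ := norm_pos_iff.2 hh
    simp only [hk]
    rw [← Real.rpow_natCast, ← Real.rpow_add this]
    congr 1; push_cast; ring
  have c1 : IntegrableOn (fun h : Euc N => ‖h‖ ^ 3 * k h) (Metric.ball 0 δ) := b1.congr hae
  have c2 : ∫ h in Metric.ball (0 : Euc N) δ, ‖h‖ ^ 3 * k h = N * bN N * δ ^ (3 - 2 * s) / (3 - 2 * s) := by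
    rw [← b2]; exact (integral_congr_ae hae).symm
  have hIntg : ∫ h in Metric.ball (0 : Euc N) δ, R h * k h = (∑ i, q i i) * (bN N * δ ^ (2 - 2 * s) / (2 - 2 * s)) -
      2 * C * B * (N * bN N * δ ^ (3 - 2 * s) / (3 - 2 * s)) := by
    have e1 : (fun h => R h * k h) = fun h => ∑ i, ∑ j, q i j * (h i * h j * k h) - 2 * C * B * (‖h‖ ^ 3 * k h) := by
      ext h
      simp only [hR, sub_mul, Finset.sum_mul]
      congr 1
      · refine Finset.sum_congr rfl fun i _ => Finset.sum_congr rfl fun j _ => by ring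
      · ring
    rw [e1, integral_sub, integral_const_mul, c2, integral_finsetSum]
    · congr 1
      rw [Finset.sum_mul]
      refine Finset.sum_congr rfl fun i _ => ?_
      rw [integral_finsetSum]
      · rw [Finset.sum_eq_single i]
        · rw [integral_const_mul, (coord_moment N hN δ s hδ0 hs i i).2, if_pos rfl]
        · intro j _ hj
          rw [integral_const_mul, (coord_moment N hN δ s hδ0 hs i j).2, if_neg (Ne.symm hj), mul_zero]
        · simp
      · intro j _
        exact (coord_moment N hN δ s hδ0 hs i j).1.const_mul _
    · intro i _
      exact integrable_finsetSum _ fun j _ => (coord_moment N hN δ s hδ0 hs i j).1.const_mul _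
    · exact integrable_finsetSum _ fun i _ => integrable_finsetSum _ fun j _ => (coord_moment N hN δ s hδ0 hs i j).1.const_mul _
    · exact c1.const_mul _
  rw [← hIntg]
  refine (ofReal_integral_le _ _).trans ?_
  refine le_trans ?_ (setLIntegral_le_lintegral (Metric.ball (0 : Euc N) δ) _)
  apply setLIntegral_mono' measurableSet_ball
  intro h hh
  rw [ENNReal.ofReal_mul' (by positivity)]
  gcongr
  exact Gf_lower N Ω w hwI V hV hc C hC hC1 hC3 δ hδ h (by simpa using hh)

lemma lp_tendsto {α : Type*} [MeasurableSpace α] {μ : Measure α} (w : ℕ → α → ℝ) (w0 : α → ℝ)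
    (hw : ∀ k, MemLp (w k) 2 μ) (hw0 : MemLp w0 2 μ)
    (h : Tendsto (fun k => ∫ x, (w k x - w0 x) ^ 2 ∂μ) atTop (𝓝 0)) :
    Tendsto (fun k => (hw k).toLp (w k)) atTop (𝓝 (hw0.toLp w0)) := by
  rw [tendsto_iff_norm_sub_tendsto_zero]
  have h2 := (Real.continuous_sqrt.tendsto _).comp h
  rw [Real.sqrt_zero] at h2
  refine h2.congr fun k => ?_
  simp only [Function.comp]
  rw [← MemLp.toLp_sub, ← Real.sqrt_sq (norm_nonneg _), norm_sq_toLp]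
  rfl

lemma tendsto_int_mul {α : Type*} [MeasurableSpace α] {μ : Measure α} (w v : ℕ → α → ℝ) (w0 v0 : α → ℝ)
    (hw : ∀ k, MemLp (w k) 2 μ) (hw0 : MemLp w0 2 μ) (hv : ∀ k, MemLp (v k) 2 μ) (hv0 : MemLp v0 2 μ)
    (h : Tendsto (fun k => ∫ x, (w k x - w0 x) ^ 2 ∂μ) atTop (𝓝 0))
    (h' : Tendsto (fun k => ∫ x, (v k x - v0 x) ^ 2 ∂μ) atTop (𝓝 0)) :
    Tendsto (fun k => ∫ x, w k x * v k x ∂μ) atTop (𝓝 (∫ x, w0 x * v0 x ∂μ)) := by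
  have := (lp_tendsto w w0 hw hw0 h).inner (𝕜 := ℝ) (lp_tendsto v v0 hv hv0 h')
  rw [inner_toLp] at this
  refine this.congr fun k => inner_toLp _ _

def divV (N : ℕ) (V : Euc N → Euc N) (x : Euc N) : ℝ := ∑ i, (fderiv ℝ V x (bas N i)) i

lemma indicator_integrable {N : ℕ} {Ω : Set (Euc N)} (hΩ : IsOpen Ω) (hfin : volume Ω ≠ ⊤) {w : Euc N → ℝ}
    (hw : MemLp w 2 (volume.restrict Ω)) : Integrable (Ω.indicator w) := by
  rw [integrable_indicator_iff hΩ.measurableSet]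
  haveI : IsFiniteMeasure (volume.restrict Ω) := ⟨by rw [Measure.restrict_apply_univ]; exact hfin.lt_top⟩
  exact hw.integrable (by norm_num)

lemma trQ_eq (N : ℕ) (Ω : Set (Euc N)) (hΩ : IsOpen Ω) (w : Euc N → ℝ) 
    (hwI : Integrable (Ω.indicator w))
    (V : Euc N → Euc N) (hV : ContDiff ℝ (⊤ : ℕ∞) V) (hc : HasCompactSupport V) (hVΩ : tsupport V ⊆ Ω) :
    ∑ i, ∫ x, Qf N (Ω.indicator w) V i i x = -2 * (∫ x in Ω, w x * divV N V x) - ∫ x in Ω, ‖V x‖ ^ 2 := by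
  rw [← integral_finsetSum _ fun i _ => Qf_integrable N _ hwI V hV hc i i]
  have e1 : (fun x => ∑ i, Qf N (Ω.indicator w) V i i x) = fun x => -2 * Ω.indicator (fun x => w x * divV N V x) x - Ω.indicator (fun x => ‖V x‖ ^ 2) x := by
    ext x
    unfold Qf
    rw [Finset.sum_sub_distrib, ← Finset.mul_sum]
    have n1 : ∑ i, V x i * V x i = ‖V x‖ ^ 2 := by rw [← real_inner_self_eq_norm_sq, inner_coord]
    rw [n1, ← Finset.mul_sum]
    by_cases hx : x ∈ Ω
    · rw [indicator_of_mem hx, indicator_of_mem hx, indicator_of_mem hx]; rfl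
    · rw [indicator_of_notMem hx, indicator_of_notMem hx, indicator_of_notMem hx]
      have : V x = 0 := by
        by_contra h0
        exact hx (hVΩ (subset_tsupport _ h0))
      rw [this]; simp
  rw [e1]
  obtain ⟨C, hC, hC1, hC2, hC3⟩ := taylor2 N V hV hc
  have hd : Continuous (fderiv ℝ V) := hV.continuous_fderiv (by simp)
  have i1 : Integrable (Ω.indicator (fun x => w x * divV N V x)) := by
    have e : Ω.indicator (fun x => w x * divV N V x) = fun x => ∑ i, Ω.indicator w x * (fderiv ℝ V x (bas N i)) i := by
      ext x
      by_cases hx : x ∈ Ω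
      · simp only [indicator_of_mem hx, divV, Finset.mul_sum]
      · simp only [indicator_of_notMem hx, zero_mul, Finset.sum_const_zero]
    rw [e]
    apply integrable_finsetSum
    intro i _
    apply hwI.mul_bdd (c := C * ‖bas N i‖)
    · exact (by fun_prop : Continuous fun x => (fderiv ℝ V x (bas N i)) i).aestronglyMeasurable
    · exact Eventually.of_forall fun x => (PiLp.norm_apply_le _ i).trans
        (((fderiv ℝ V x).le_opNorm _).trans (by gcongr; exact hC2 x))
  have i2 : Integrable (Ω.indicator (fun x => ‖V x‖ ^ 2)) := by
    rw [integrable_indicator_iff hΩ.measurableSet]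
    apply Integrable.integrableOn
    have := hV.continuous
    apply Continuous.integrable_of_hasCompactSupport (by fun_prop)
    exact hc.mono fun x hx => by
      simp only [Function.mem_support, ne_eq] at hx ⊢
      intro h0; exact hx (by rw [h0]; simp)
  rw [integral_sub (i1.const_mul _) i2, integral_const_mul, integral_indicator hΩ.measurableSet, integral_indicator hΩ.measurableSet]

lemma liminf_dual (N : ℕ) (hN : 2 ≤ N) (Ω : Set (Euc N)) (hΩ : IsOpen Ω) (hfin : volume Ω ≠ ⊤)
    (sk : ℕ → ℝ) (hsk : ∀ k, sk k ∈ Ioo (0:ℝ) 1) (hlim : Tendsto sk atTop (𝓝 1))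
    (w : ℕ → Euc N → ℝ) (hw : ∀ k, memHs N (sk k) Ω (w k))
    (w0 : Euc N → ℝ) (hw0 : MemLp w0 2 (volume.restrict Ω))
    (hcv : Tendsto (fun k => ∫ x in Ω, (w k x - w0 x) ^ 2) atTop (𝓝 0))
    (Mk : ℕ → ℝ) (M : ℝ) (hMk : Tendsto Mk atTop (𝓝 M))
    (hM : ∀ k, cNs N (sk k) / 2 * (semiSq N (sk k) Ω (w k)).toReal ≤ Mk k)
    (V : Euc N → Euc N) (hV : ContDiff ℝ (⊤ : ℕ∞) V) (hc : HasCompactSupport V) (hVΩ : tsupport V ⊆ Ω) :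
    -2 * (∫ x in Ω, w0 x * divV N V x) - ∫ x in Ω, ‖V x‖ ^ 2 ≤ M := by
  haveI : IsFiniteMeasure (volume.restrict Ω) := ⟨by rw [Measure.restrict_apply_univ]; exact hfin.lt_top⟩
  have hw2 : ∀ k, MemLp (w k) 2 (volume.restrict Ω) := fun k => memL2_of (hw k).1 (hw k).2.1
  obtain ⟨C, hC, hC1, hC2, hC3⟩ := taylor2 N V hV hc
  obtain ⟨δ, hδ0, hδ⟩ := hc.isCompact.exists_cthickening_subset_open hΩ hVΩ
  have hd : Continuous (fderiv ℝ V) := hV.continuous_fderiv (by simp)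
  have hsl : Tendsto sk atTop (𝓝[<] 1) :=
    tendsto_nhdsWithin_iff.2 ⟨hlim, Eventually.of_forall fun k => (hsk k).2⟩
  have hdiv : MemLp (divV N V) 2 (volume.restrict Ω) := by
    apply MemLp.of_bound (C := ∑ i, C * ‖bas N i‖)
    · unfold divV
      exact (by fun_prop : Continuous fun x => ∑ i, (fderiv ℝ V x (bas N i)) i).aestronglyMeasurable
    · apply Eventually.of_forall
      intro x
      unfold divV
      refine (norm_sum_le _ _).trans (Finset.sum_le_sum fun i _ => ?_)
      exact (PiLp.norm_apply_le _ i).trans (((fderiv ℝ V x).le_opNorm _).trans (by gcongr; exact hC2 x))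
  have t1 : Tendsto (fun k => -2 * (∫ x in Ω, w k x * divV N V x) - ∫ x in Ω, ‖V x‖ ^ 2) atTop
      (𝓝 (-2 * (∫ x in Ω, w0 x * divV N V x) - ∫ x in Ω, ‖V x‖ ^ 2)) := by
    apply Tendsto.sub_const
    apply Tendsto.const_mul
    exact tendsto_int_mul w (fun _ => divV N V) w0 (divV N V) hw2 hw0 (fun _ => hdiv) hdiv hcv (by simp)
  -- uniform `L¹` bound
  have t2 : Tendsto (fun k => ∫ x in Ω, w k x * w k x) atTop (𝓝 (∫ x in Ω, w0 x * w0 x)) :=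
    tendsto_int_mul w w w0 w0 hw2 hw0 hw2 hw0 hcv hcv
  obtain ⟨B0, hB0⟩ := t2.bddAbove_range
  set B := volume.real Ω + B0 with hB
  have hBk : ∀ k, ∫ x, |Ω.indicator (w k) x| ≤ B := by
    intro k
    have e : (fun x => |Ω.indicator (w k) x|) = Ω.indicator (fun x => |w k x|) := by
      ext x
      by_cases hx : x ∈ Ω
      · simp only [indicator_of_mem hx]
      · simp only [indicator_of_notMem hx, abs_zero]
    rw [e, integral_indicator hΩ.measurableSet]
    have i1 : Integrable (fun x => w k x * w k x) (volume.restrict Ω) := (hw2 k).integrable_mul (hw2 k)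
    calc ∫ x in Ω, |w k x| ≤ ∫ x in Ω, (1 + w k x * w k x) := by
          apply integral_mono ((hw2 k).integrable (by norm_num)).abs ((integrable_const _).add i1)
          intro x
          beta_reduce
          show |w k x| ≤ 1 + w k x * w k x
          nlinarith [sq_nonneg (|w k x| - 1), sq_abs (w k x), abs_nonneg (w k x)]
      _ = volume.real Ω + ∫ x in Ω, w k x * w k x := by
          rw [integral_add (integrable_const _) i1]; simp
      _ ≤ B := by
          rw [hB]; gcongr; exact hB0 ⟨k, rfl⟩
  have hbN := bN_pos N hN
  have t3 := (tendsto_main N hN δ hδ0).comp hsl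
  have t4 : Tendsto (fun s : ℝ => cNs N s / 2 * (2 * C * B * (N * bN N * δ ^ (3 - 2 * s) / (3 - 2 * s)))) (𝓝[<] 1) (𝓝 0) := by
    have a1 : Tendsto (fun s : ℝ => 2 * C * B * (N * bN N * δ ^ (3 - 2 * s) / (3 - 2 * s))) (𝓝[<] 1)
        (𝓝 (2 * C * B * (N * bN N * δ ^ (3 - 2 * (1:ℝ)) / (3 - 2 * 1)))) := by
      apply tendsto_nhdsWithin_of_tendsto_nhds
      apply ContinuousAt.tendsto
      apply ContinuousAt.mul continuousAt_const
      apply ContinuousAt.div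
      · apply ContinuousAt.mul continuousAt_const
        apply ContinuousAt.rpow continuousAt_const (by fun_prop) (Or.inl hδ0.ne')
      · fun_prop
      · norm_num
    have := ((tendsto_cNs N hN).div_const 2).mul a1
    simpa using this
  have t5 := t4.comp hsl
  have t6 := (t1.mul t3).sub t5
  rw [mul_one, sub_zero] at t6
  refine le_of_tendsto_of_tendsto' t6 hMk fun k => ?_
  refine le_trans ?_ (hM k)
  have hcp := cNs_pos N _ (hsk k)
  have hI := indicator_integrable hΩ hfin (hw2 k)
  have hsl := semi_lower N hN Ω hΩ (w k) (hw k).1 hI V hV hc C hC hC1 hC3 δ hδ0 hδ (sk k) (hsk k)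
  rw [ENNReal.ofReal_le_iff_le_toReal (hw k).2.2.ne, trQ_eq N Ω hΩ (w k) hI V hV hc hVΩ] at hsl
  have h3 : 0 < 3 - 2 * sk k := by linarith [(hsk k).2]
  have hmono : 2 * C * (∫ x, |Ω.indicator (w k) x|) * (N * bN N * δ ^ (3 - 2 * sk k) / (3 - 2 * sk k)) ≤
      2 * C * B * (N * bN N * δ ^ (3 - 2 * sk k) / (3 - 2 * sk k)) := by
    gcongr
    exact hBk k
  simp only [Function.comp]
  calc _ = cNs N (sk k) / 2 * ((-2 * (∫ x in Ω, w k x * divV N V x) - ∫ x in Ω, ‖V x‖ ^ 2) *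
        (bN N * δ ^ (2 - 2 * sk k) / (2 - 2 * sk k)) - 2 * C * B * (N * bN N * δ ^ (3 - 2 * sk k) / (3 - 2 * sk k))) := by ring
    _ ≤ _ := by
      apply mul_le_mul_of_nonneg_left _ (by positivity)
      linarith


lemma riesz_dual {E H : Type*} [AddCommGroup E] [Module ℝ E] [NormedAddCommGroup H] [InnerProductSpace ℝ H]
    [CompleteSpace H] (ι : E →ₗ[ℝ] H) (ℓ : E →ₗ[ℝ] ℝ) (M : ℝ)
    (h : ∀ v, 2 * ℓ v - ‖ι v‖ ^ 2 ≤ M) : ∃ g : H, (∀ v, ℓ v = inner ℝ g (ι v)) ∧ ‖g‖ ^ 2 ≤ M := by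
  have hM : 0 ≤ M := by simpa using h 0
  have ht : ∀ v (t : ℝ), 2 * t * ℓ v - t ^ 2 * ‖ι v‖ ^ 2 ≤ M := by
    intro v t
    have := h (t • v)
    rw [map_smul, map_smul, norm_smul, mul_pow, Real.norm_eq_abs, sq_abs, smul_eq_mul] at this
    linarith
  have hb : ∀ v, |ℓ v| ≤ √M * ‖ι v‖ := by
    intro v
    by_cases h0 : ‖ι v‖ = 0
    · have h1 : ℓ v = 0 := by
        by_contra hne
        have := ht v ((M + 1) / (2 * ℓ v))
        rw [h0] at this
        have e : 2 * ((M + 1) / (2 * ℓ v)) * ℓ v = M + 1 := by field_simp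
        rw [e] at this
        linarith
      rw [h1, h0]; simp
    · have hp : 0 < ‖ι v‖ := lt_of_le_of_ne (norm_nonneg _) (Ne.symm h0)
      have := ht v (ℓ v / ‖ι v‖ ^ 2)
      have e : 2 * (ℓ v / ‖ι v‖ ^ 2) * ℓ v - (ℓ v / ‖ι v‖ ^ 2) ^ 2 * ‖ι v‖ ^ 2 = (ℓ v) ^ 2 / ‖ι v‖ ^ 2 := by
        field_simp; ring
      rw [e, div_le_iff₀ (by positivity)] at this
      apply abs_le_of_sq_le_sq _ (by positivity)
      rw [mul_pow, Real.sq_sqrt hM]; exact this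
  obtain ⟨σ, hσ⟩ := LinearMap.exists_rightInverse_of_surjective ι.rangeRestrict ι.range_rangeRestrict
  have hσ' : ∀ y : LinearMap.range ι, ι (σ y) = y := fun y => by
    have := congrArg Subtype.val (LinearMap.congr_fun hσ y)
    simpa using this
  let f : LinearMap.range ι →L[ℝ] ℝ := (ℓ ∘ₗ σ).mkContinuous (√M) (fun y => by
    have := hb (σ y)
    rw [hσ'] at this
    simpa using this)
  obtain ⟨F, hF1, hF2⟩ := exists_extension_norm_eq (𝕜 := ℝ) _ f
  refine ⟨(InnerProductSpace.toDual ℝ H).symm F, fun v => ?_, ?_⟩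
  · rw [InnerProductSpace.toDual_symm_apply]
    have h1 := hF1 ⟨ι v, LinearMap.mem_range_self ι v⟩
    simp only at h1
    rw [h1]
    show ℓ v = ℓ (σ ⟨ι v, LinearMap.mem_range_self ι v⟩)
    have := hb (v - σ ⟨ι v, LinearMap.mem_range_self ι v⟩)
    rw [map_sub, map_sub, hσ'] at this
    simp at this
    linarith
  · rw [LinearIsometryEquiv.norm_map, hF2]
    have : ‖f‖ ≤ √M := LinearMap.mkContinuous_norm_le _ (Real.sqrt_nonneg _) _
    calc ‖f‖ ^ 2 ≤ √M ^ 2 := by gcongr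
      _ = M := Real.sq_sqrt hM

def testV (N : ℕ) (Ω : Set (Euc N)) : Submodule ℝ (Euc N → Euc N) where
  carrier := {V | ContDiff ℝ (⊤ : ℕ∞) V ∧ HasCompactSupport V ∧ tsupport V ⊆ Ω}
  zero_mem' := ⟨contDiff_const, HasCompactSupport.zero, by
    rw [show (0 : Euc N → Euc N) = fun _ => 0 from rfl, tsupport]; simp [Function.support]⟩
  add_mem' := fun {a b} ha hb => ⟨ha.1.add hb.1, ha.2.1.add hb.2.1,
    (tsupport_add a b).trans (union_subset ha.2.2 hb.2.2)⟩
  smul_mem' := fun c a ha => ⟨ha.1.const_smul c, ha.2.1.smul_left (f := fun _ => c),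
    (tsupport_smul_subset_right (fun _ => c) a).trans ha.2.2⟩

lemma divV_memLp (N : ℕ) (Ω : Set (Euc N)) (hfin : volume Ω ≠ ⊤) (V : Euc N → Euc N)
    (hV : ContDiff ℝ (⊤ : ℕ∞) V) (hc : HasCompactSupport V) : MemLp (divV N V) 2 (volume.restrict Ω) := by
  haveI : IsFiniteMeasure (volume.restrict Ω) := ⟨by rw [Measure.restrict_apply_univ]; exact hfin.lt_top⟩
  obtain ⟨C, hC, hC1, hC2, hC3⟩ := taylor2 N V hV hc
  have hd : Continuous (fderiv ℝ V) := hV.continuous_fderiv (by simp)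
  apply MemLp.of_bound (C := ∑ i, C * ‖bas N i‖)
  · unfold divV
    exact (by fun_prop : Continuous fun x => ∑ i, (fderiv ℝ V x (bas N i)) i).aestronglyMeasurable
  · apply Eventually.of_forall
    intro x
    unfold divV
    refine (norm_sum_le _ _).trans (Finset.sum_le_sum fun i _ => ?_)
    exact (PiLp.norm_apply_le _ i).trans (((fderiv ℝ V x).le_opNorm _).trans (by gcongr; exact hC2 x))

lemma testV_memLp (N : ℕ) (Ω : Set (Euc N)) (V : testV N Ω) : MemLp V.1 2 (volume.restrict Ω) :=
  (V.2.1.continuous.memLp_of_hasCompactSupport V.2.2.1).restrict _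

lemma weak_grad_of_dual (N : ℕ) (Ω : Set (Euc N)) (hfin : volume Ω ≠ ⊤)
    (w0 : Euc N → ℝ) (hw0 : MemLp w0 2 (volume.restrict Ω)) (M : ℝ)
    (h : ∀ V : Euc N → Euc N, ContDiff ℝ (⊤ : ℕ∞) V → HasCompactSupport V → tsupport V ⊆ Ω →
      -2 * (∫ x in Ω, w0 x * divV N V x) - ∫ x in Ω, ‖V x‖ ^ 2 ≤ M) :
    ∃ g, IsWeakGradient N Ω w0 g ∧ MemLp g 2 (volume.restrict Ω) ∧ ∫ x in Ω, ‖g x‖ ^ 2 ≤ M := by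
  have hIntg : ∀ V : testV N Ω, Integrable (fun x => w0 x * divV N V.1 x) (volume.restrict Ω) := fun V =>
    hw0.integrable_mul (divV_memLp N Ω hfin V.1 V.2.1 V.2.2.1)
  have hdf : ∀ (V : testV N Ω) x, DifferentiableAt ℝ V.1 x := fun V x =>
    (V.2.1.differentiable (by simp)).differentiableAt
  let ι : testV N Ω →ₗ[ℝ] Lp (Euc N) 2 (volume.restrict Ω) :=
    { toFun := fun V => (testV_memLp N Ω V).toLp V.1
      map_add' := fun a b => MemLp.toLp_add _ _
      map_smul' := fun c a => MemLp.toLp_const_smul _ _ }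
  let ℓ : testV N Ω →ₗ[ℝ] ℝ :=
    { toFun := fun V => - ∫ x in Ω, w0 x * divV N V.1 x
      map_add' := fun a b => by
        have e : ∀ x, w0 x * divV N (a + b).1 x = w0 x * divV N a.1 x + w0 x * divV N b.1 x := fun x => by
          have : fderiv ℝ ((a + b).1) x = fderiv ℝ a.1 x + fderiv ℝ b.1 x := fderiv_add (hdf a x) (hdf b x)
          unfold divV
          rw [this]
          simp [Finset.sum_add_distrib, mul_add]
        simp_rw [e]
        rw [integral_add (hIntg a) (hIntg b)]; ring
      map_smul' := fun c a => by
        have e : ∀ x, w0 x * divV N (c • a).1 x = c * (w0 x * divV N a.1 x) := fun x => by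
          have : fderiv ℝ ((c • a).1) x = c • fderiv ℝ a.1 x := fderiv_const_smul (hdf a x) c
          unfold divV
          rw [this]
          simp only [ContinuousLinearMap.smul_apply, PiLp.smul_apply, smul_eq_mul, ← Finset.mul_sum]
          ring
        simp_rw [e]
        rw [integral_const_mul]; simp }
  have hnorm : ∀ G : Lp (Euc N) 2 (volume.restrict Ω), ‖G‖ ^ 2 = ∫ x in Ω, ‖G x‖ ^ 2 := fun G => by
    rw [← real_inner_self_eq_norm_sq, L2.inner_def]
    congr 1; ext x; rw [real_inner_self_eq_norm_sq]
  obtain ⟨G, hG, hGM⟩ := riesz_dual ι ℓ M (fun V => by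
    have := h V.1 V.2.1 V.2.2.1 V.2.2.2
    have e : ‖ι V‖ ^ 2 = ∫ x in Ω, ‖V.1 x‖ ^ 2 := by
      rw [hnorm]
      apply integral_congr_ae
      filter_upwards [(testV_memLp N Ω V).coeFn_toLp] with x hx
      rw [← hx]; rfl
    rw [e]
    show 2 * (- ∫ x in Ω, w0 x * divV N V.1 x) - _ ≤ M
    linarith)
  have hGm : MemLp (G : Euc N → Euc N) 2 (volume.restrict Ω) := Lp.memLp G
  refine ⟨G, ⟨(Lp.stronglyMeasurable G).measurable, ?_, ?_⟩, hGm, ?_⟩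
  · have := hGm.integrable_norm_pow (by norm_num)
    have h2 := this.2
    rw [hasFiniteIntegral_iff_ofReal (Eventually.of_forall fun x => by positivity)] at h2
    simpa using h2
  · intro φ hφ hφc hφΩ i
    let V : testV N Ω := ⟨fun x => φ x • bas N i, hφ.smul contDiff_const, hφc.smul_right, 
      (tsupport_smul_subset_left φ _).trans hφΩ⟩
    have h1 := hG V
    have e1 : ∀ x, divV N V.1 x = fderiv ℝ φ x (EuclideanSpace.single i 1) := fun x => by
      have : fderiv ℝ V.1 x = (fderiv ℝ φ x).smulRight (bas N i) := by
        have hd : DifferentiableAt ℝ φ x := (hφ.differentiable (by simp)).differentiableAt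
        exact (hd.hasFDerivAt.smul_const (bas N i)).fderiv
      unfold divV
      rw [this]
      simp [bas]
    have e2 : (inner ℝ G (ι V) : ℝ) = ∫ x in Ω, G x i * φ x := by
      rw [L2.inner_def]
      apply integral_congr_ae
      filter_upwards [(testV_memLp N Ω V).coeFn_toLp] with x hx
      have : (ι V : Euc N → Euc N) x = φ x • bas N i := hx
      rw [this, inner_coord]
      simp [bas]
    rw [← e2, ← h1]
    show _ = - - _
    rw [neg_neg]
    simp_rw [e1]
  · rw [← hnorm]; exact hGM

lemma weak_liminf (N : ℕ) (hN : 2 ≤ N) (Ω : Set (Euc N)) (hΩ : IsOpen Ω) (hfin : volume Ω ≠ ⊤)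
    (sk : ℕ → ℝ) (hsk : ∀ k, sk k ∈ Ioo (0:ℝ) 1) (hlim : Tendsto sk atTop (𝓝 1))
    (w : ℕ → Euc N → ℝ) (hw : ∀ k, memHs N (sk k) Ω (w k))
    (w0 : Euc N → ℝ) (hw0 : MemLp w0 2 (volume.restrict Ω))
    (hcv : Tendsto (fun k => ∫ x in Ω, (w k x - w0 x) ^ 2) atTop (𝓝 0))
    (Mk : ℕ → ℝ) (M : ℝ) (hMk : Tendsto Mk atTop (𝓝 M))
    (hM : ∀ k, cNs N (sk k) / 2 * (semiSq N (sk k) Ω (w k)).toReal ≤ Mk k) :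
    ∃ g, IsWeakGradient N Ω w0 g ∧ MemLp g 2 (volume.restrict Ω) ∧ ∫ x in Ω, ‖g x‖ ^ 2 ≤ M :=
  weak_grad_of_dual N Ω hfin w0 hw0 M fun V hV hc hVΩ =>
    liminf_dual N hN Ω hΩ hfin sk hsk hlim w hw w0 hw0 hcv Mk M hMk hM V hV hc hVΩ

lemma weakGrad_memLp {N : ℕ} {Ω : Set (Euc N)} {u : Euc N → ℝ} {g : Euc N → Euc N}
    (h : IsWeakGradient N Ω u g) : MemLp g 2 (volume.restrict Ω) := by
  rw [← memLp_norm_iff h.1.aestronglyMeasurable, memLp_two_iff_integrable_sq h.1.norm.aestronglyMeasurable]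
  refine ⟨(h.1.norm.pow_const 2).aestronglyMeasurable, ?_⟩
  rw [hasFiniteIntegral_iff_ofReal (Eventually.of_forall fun x => sq_nonneg _)]
  exact h.2.1

lemma memLp_coord {N : ℕ} {μ : Measure (Euc N)} {g : Euc N → Euc N} (h : MemLp g 2 μ) (i : Fin N) :
    MemLp (fun x => g x i) 2 μ := by
  have := (EuclideanSpace.proj i : EuclideanSpace ℝ (Fin N) →L[ℝ] ℝ).comp_memLp' h
  exact this

lemma weakGrad_unique {N : ℕ} {Ω : Set (Euc N)} (hΩ : IsOpen Ω) (hfin : volume Ω ≠ ⊤) {u : Euc N → ℝ} {g g' : Euc N → Euc N}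
    (h : IsWeakGradient N Ω u g) (h' : IsWeakGradient N Ω u g') : g =ᵐ[volume.restrict Ω] g' := by
  haveI : IsFiniteMeasure (volume.restrict Ω) := ⟨by rw [Measure.restrict_apply_univ]; exact hfin.lt_top⟩
  have hi : ∀ i : Fin N, ∀ᵐ x ∂(volume.restrict Ω), g x i = g' x i := by
    intro i
    have h1 := memLp_coord (weakGrad_memLp h) i
    have h2 := memLp_coord (weakGrad_memLp h') i
    have := hΩ.ae_eq_zero_of_integral_contDiff_smul_eq_zero (μ := volume) (f := fun x => g x i - g' x i)
      (IntegrableOn.locallyIntegrableOn ((h1.integrable (by norm_num)).sub (h2.integrable (by norm_num)))) ?_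
    · rw [ae_restrict_iff' hΩ.measurableSet]
      filter_upwards [this] with x hx hxΩ
      exact sub_eq_zero.1 (hx hxΩ)
    · intro φ hφ hφc hφΩ
      have a1 := h.2.2 φ hφ hφc hφΩ i
      have a2 := h'.2.2 φ hφ hφc hφΩ i
      have hφm : MemLp φ 2 (volume.restrict Ω) := (hφ.continuous.memLp_of_hasCompactSupport hφc).restrict _
      have e : ∀ x, φ x • (g x i - g' x i) = g x i * φ x - g' x i * φ x := fun x => by
        rw [smul_eq_mul]; ring
      have : ∫ x, φ x • (g x i - g' x i) = ∫ x in Ω, φ x • (g x i - g' x i) := by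
        rw [setIntegral_eq_integral_of_forall_compl_eq_zero]
        intro x hx
        have : φ x = 0 := by
          by_contra h0
          exact hx (hφΩ (subset_tsupport _ h0))
        rw [this, zero_smul]
      rw [this]
      simp_rw [e]
      have i1 : Integrable (fun x => g x i * φ x) (volume.restrict Ω) := h1.integrable_mul hφm
      have i2 : Integrable (fun x => g' x i * φ x) (volume.restrict Ω) := h2.integrable_mul hφm
      rw [integral_sub i1 i2]
      linarith
  have := ae_all_iff.2 hi
  filter_upwards [this] with x hx
  ext i; exact hx i

lemma weakGrad_comb {N : ℕ} {Ω : Set (Euc N)} (hfin : volume Ω ≠ ⊤) {n : ℕ} (ψ : Fin n → Euc N → ℝ)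
    (g : Fin n → Euc N → Euc N) (hψ : ∀ i, MemLp (ψ i) 2 (volume.restrict Ω))
    (h : ∀ i, IsWeakGradient N Ω (ψ i) (g i)) (a : Fin n → ℝ) :
    IsWeakGradient N Ω (∑ i, a i • ψ i) (∑ i, a i • g i) := by
  have hm : Measurable (∑ i, a i • g i) := by
    have := fun i => (h i).1
    have h2 := Finset.measurable_sum Finset.univ fun i _ => (this i).const_smul (a i)
    convert h2 using 1
    ext x; simp
  have hL : MemLp (∑ i, a i • g i) 2 (volume.restrict Ω) := 
    memLp_finsetSum' _ fun i _ => (weakGrad_memLp (h i)).const_smul (a i)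
  refine ⟨hm, ?_, ?_⟩
  · have := hL.integrable_norm_pow (by norm_num)
    have h2 := this.2
    rw [hasFiniteIntegral_iff_ofReal (Eventually.of_forall fun x => by positivity)] at h2
    simpa using h2
  · intro φ hφ hφc hφΩ i
    have hφm : MemLp φ 2 (volume.restrict Ω) := (hφ.continuous.memLp_of_hasCompactSupport hφc).restrict _
    have hd : MemLp (fun x => fderiv ℝ φ x (EuclideanSpace.single i 1)) 2 (volume.restrict Ω) := by
      apply MemLp.restrict
      apply Continuous.memLp_of_hasCompactSupport
      · have := hφ.continuous_fderiv (by simp)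
        fun_prop
      · exact hφc.fderiv_apply (𝕜 := ℝ) _
    have e1 : ∀ x, (∑ j, a j • ψ j) x * fderiv ℝ φ x (EuclideanSpace.single i 1) =
        ∑ j, a j * (ψ j x * fderiv ℝ φ x (EuclideanSpace.single i 1)) := fun x => by
      simp only [Finset.sum_apply, Pi.smul_apply, smul_eq_mul, Finset.sum_mul, mul_assoc]
    have e2 : ∀ x, (∑ j, a j • g j) x i * φ x = ∑ j, a j * (g j x i * φ x) := fun x => by
      simp only [Finset.sum_apply, Pi.smul_apply, smul_eq_mul, WithLp.ofLp_sum, WithLp.ofLp_smul, Finset.sum_mul, mul_assoc]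
    simp_rw [e1, e2]
    have i1 : ∀ j, Integrable (fun x => ψ j x * fderiv ℝ φ x (EuclideanSpace.single i 1)) (volume.restrict Ω) := 
      fun j => (hψ j).integrable_mul hd
    have i2 : ∀ j, Integrable (fun x => g j x i * φ x) (volume.restrict Ω) := 
      fun j => (memLp_coord (weakGrad_memLp (h j)) i).integrable_mul hφm
    rw [integral_finsetSum _ fun j _ => (i1 j).const_mul _, integral_finsetSum _ fun j _ => (i2 j).const_mul _,
      ← Finset.sum_neg_distrib]
    apply Finset.sum_congr rfl
    intro j _
    rw [integral_const_mul, integral_const_mul, (h j).2.2 φ hφ hφc hφΩ i]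
    ring



def gradF (N : ℕ) (φ : Euc N → ℝ) (x : Euc N) : Euc N := (InnerProductSpace.toDual ℝ (Euc N)).symm (fderiv ℝ φ x)

lemma gradF_inner (N : ℕ) (φ : Euc N → ℝ) (x h : Euc N) : inner ℝ (gradF N φ x) h = fderiv ℝ φ x h := by
  unfold gradF; rw [InnerProductSpace.toDual_symm_apply]

lemma gradF_norm (N : ℕ) (φ : Euc N → ℝ) (x : Euc N) : ‖gradF N φ x‖ = ‖fderiv ℝ φ x‖ := by
  unfold gradF; rw [LinearIsometryEquiv.norm_map]

lemma gradF_coord (N : ℕ) (φ : Euc N → ℝ) (x : Euc N) (i : Fin N) : gradF N φ x i = fderiv ℝ φ x (bas N i) := by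
  rw [← gradF_inner, inner_coord]; simp [bas]

lemma gradF_continuous (N : ℕ) (φ : Euc N → ℝ) (hφ : ContDiff ℝ (⊤ : ℕ∞) φ) : Continuous (gradF N φ) := by
  have := hφ.continuous_fderiv (by simp)
  unfold gradF
  exact (LinearIsometryEquiv.continuous _).comp this

lemma inner_ball (N : ℕ) (hN : 2 ≤ N) (s : ℝ) (hs : s ∈ Ioo (0:ℝ) 1) (δ : ℝ) (hδ : 0 < δ) (a : Euc N) :
    ∫⁻ h in Metric.ball (0 : Euc N) δ, ENNReal.ofReal ((inner ℝ a h : ℝ) ^ 2 * ‖h‖ ^ (-((N : ℝ) + 2 * s)))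
      = ENNReal.ofReal (bN N * δ ^ (2 - 2 * s) / (2 - 2 * s)) * ENNReal.ofReal (‖a‖ ^ 2) := by
  have h1 := lint_inner_sq N hN a (fun t => if t < δ then |t| ^ (-((N : ℝ) + 2 * s)) else 0)
    (fun t => by split_ifs <;> positivity) (by
      apply Measurable.ite measurableSet_Iio (by fun_prop) measurable_const)
  have e1 : ∀ F : Euc N → ℝ, ∫⁻ h, ENNReal.ofReal (F h * (if ‖h‖ < δ then |‖h‖| ^ (-((N : ℝ) + 2 * s)) else 0))
      = ∫⁻ h in Metric.ball (0 : Euc N) δ, ENNReal.ofReal (F h * ‖h‖ ^ (-((N : ℝ) + 2 * s))) := by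
    intro F
    rw [← lintegral_indicator measurableSet_ball]
    congr 1; ext h
    by_cases hh : ‖h‖ < δ
    · rw [indicator_of_mem (by simpa using hh), if_pos hh, abs_of_nonneg (norm_nonneg _)]
    · rw [indicator_of_notMem (by simpa using hh), if_neg hh]; simp
  rw [e1, e1] at h1
  rw [h1]
  have h2 := lint_ball_rpow N hN δ (2 - 2 * s) hδ (by linarith [hs.2])
  have e2 : ∫⁻ h in Metric.ball (0 : Euc N) δ, ENNReal.ofReal (‖h‖ ^ 2 * ‖h‖ ^ (-((N : ℝ) + 2 * s))) = 
      ∫⁻ h in Metric.ball (0 : Euc N) δ, ENNReal.ofReal (‖h‖ ^ (2 - 2 * s - N)) := by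
    haveI : Nonempty (Fin N) := ⟨⟨0, by omega⟩⟩
    apply lintegral_congr_ae
    have : ∀ᵐ h : Euc N ∂(volume.restrict (Metric.ball (0 : Euc N) δ)), h ≠ 0 := by
      apply ae_restrict_of_ae
      exact Measure.ae_ne volume 0
    filter_upwards [this] with h hh
    congr 1
    rw [← Real.rpow_natCast, ← Real.rpow_add (norm_pos_iff.2 hh)]
    congr 1; push_cast; ring
  rw [e2, h2, ← ENNReal.ofReal_mul (by positivity), ← ENNReal.ofReal_mul]
  · congr 1
    have : (N : ℝ) ≠ 0 := by positivity
    field_simp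
  · have := bN_pos N hN
    have := hs.2
    apply div_nonneg (by positivity) (by linarith)

lemma semi_upper (N : ℕ) (hN : 2 ≤ N) (s : ℝ) (hs : s ∈ Ioo (0:ℝ) 1) (Ω : Set (Euc N))
    (φ : Euc N → ℝ) (hφ : ContDiff ℝ (⊤ : ℕ∞) φ)
    (C : ℝ) (hC : 0 ≤ C) (hC1 : ∀ x, ‖φ x‖ ≤ C) (hC2 : ∀ x, ‖fderiv ℝ φ x‖ ≤ C)
    (hC3 : ∀ x h, ‖φ (x + h) - φ x - fderiv ℝ φ x h‖ ≤ C * ‖h‖ ^ 2) (δ : ℝ) (hδ : 0 < δ) (hδ1 : δ ≤ 1) :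
    semiSq N s Ω φ ≤ ENNReal.ofReal (bN N * δ ^ (2 - 2 * s) / (2 - 2 * s)) *
        (∫⁻ x in Metric.cthickening δ (closure Ω), ENNReal.ofReal (‖gradF N φ x‖ ^ 2))
      + ENNReal.ofReal (3 * C ^ 2) * volume (Metric.cthickening δ (closure Ω)) *
        ENNReal.ofReal (N * bN N * δ ^ (3 - 2 * s) / (3 - 2 * s))
      + ENNReal.ofReal (4 * C ^ 2) * (2 * volume (closure Ω)) *
        ENNReal.ofReal (N * bN N * (δ / 2) ^ (-(2 * s)) / (2 * s)) := by
  set K := Metric.cthickening δ (closure Ω) with hK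
  have hKm : MeasurableSet K := Metric.isClosed_cthickening.measurableSet
  have hφc := hφ.continuous
  have hgc := gradF_continuous N φ hφ
  rw [semiSq_eq N s Ω φ hφc.measurable]
  set k : Euc N → ℝ := fun h => ‖h‖ ^ (-((N : ℝ) + 2 * s)) with hk
  have hkm : Measurable k := by fun_prop
  have hk0 : ∀ h, 0 ≤ k h := fun h => by positivity
  set F1 : Euc N → ℝ≥0∞ := fun h => ∫⁻ x in K, ENNReal.ofReal ((inner ℝ (gradF N φ x) h : ℝ) ^ 2 * k h) with hF1
  set F2 : Euc N → ℝ≥0∞ := fun h => ENNReal.ofReal (3 * C ^ 2) * volume K * ENNReal.ofReal (‖h‖ ^ (3 - 2 * s - N)) with hF2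
  set F3 : Euc N → ℝ≥0∞ := fun h => ENNReal.ofReal (4 * C ^ 2) * (2 * volume (closure Ω)) * ENNReal.ofReal (‖h‖ ^ (-(2 * s) - N)) with hF3
  have hjm : Measurable (fun p : Euc N × Euc N => ENNReal.ofReal ((inner ℝ (gradF N φ p.2) p.1 : ℝ) ^ 2 * k p.1)) := by
    apply Measurable.ennreal_ofReal
    apply Measurable.mul _ (hkm.comp measurable_fst)
    have : Continuous fun p : Euc N × Euc N => (inner ℝ (gradF N φ p.2) p.1 : ℝ) ^ 2 := by fun_prop
    exact this.measurable
  have hF1m : Measurable F1 := hjm.lintegral_prod_right'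
  have key : ∀ h : Euc N, ∫⁻ x, (reg N Ω).indicator
      (fun q => ENNReal.ofReal ((φ q.1 - φ q.2) ^ 2 / kern N s q.1 q.2)) (x, x + h) ≤
      (Metric.ball (0 : Euc N) δ).indicator F1 h + (Metric.ball (0 : Euc N) δ).indicator F2 h +
      ((Metric.closedBall (0 : Euc N) (δ/2))ᶜ).indicator F3 h := by
    intro h
    have ek : ∀ x, (φ x - φ (x + h)) ^ 2 / kern N s x (x + h) = (φ (x + h) - φ x) ^ 2 * k h := fun x => by
      unfold kern
      rw [hk]
      simp only
      rw [Real.rpow_neg (norm_nonneg _), show x - (x + h) = -h by abel, norm_neg]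
      ring
    by_cases hh : ‖h‖ < δ
    · rw [indicator_of_mem (by simpa using hh), indicator_of_mem (by simpa using hh)]
      refine le_trans ?_ le_self_add
      calc ∫⁻ x, (reg N Ω).indicator
            (fun q => ENNReal.ofReal ((φ q.1 - φ q.2) ^ 2 / kern N s q.1 q.2)) (x, x + h)
          ≤ ∫⁻ x, K.indicator (fun x => ENNReal.ofReal ((inner ℝ (gradF N φ x) h : ℝ) ^ 2 * k h) +
              ENNReal.ofReal (3 * C ^ 2) * ENNReal.ofReal (‖h‖ ^ (3 - 2 * s - N))) x := by
            apply lintegral_mono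
            intro x
            beta_reduce
            by_cases hx : (x, x + h) ∈ reg N Ω
            · have hxK : x ∈ K := by
                rcases hx with hx | hx
                · exact Metric.self_subset_cthickening _ hx
                · refine Metric.mem_cthickening_of_dist_le _ (x + h) δ _ hx ?_
                  rw [dist_eq_norm, show x - (x + h) = -h by abel, norm_neg]; exact hh.le
              rw [indicator_of_mem hx, indicator_of_mem hxK]
              simp only
              rw [ek, ← ENNReal.ofReal_mul (by positivity), ← ENNReal.ofReal_add (by have := hk0 h; positivity) (by positivity)]
              apply ENNReal.ofReal_le_ofReal
              have h3 := hC3 x h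
              have h2 : ‖fderiv ℝ φ x h‖ ≤ C * ‖h‖ := ((fderiv ℝ φ x).le_opNorm h).trans (by gcongr; exact hC2 x)
              rw [gradF_inner]
              have hsq : (φ (x + h) - φ x) ^ 2 ≤ (fderiv ℝ φ x h) ^ 2 + 3 * C ^ 2 * ‖h‖ ^ 3 := by
                rw [Real.norm_eq_abs] at h2 h3
                set A := φ (x + h) - φ x
                set B := fderiv ℝ φ x h
                have n0 := norm_nonneg h
                have n1 : ‖h‖ ≤ 1 := by linarith
                have : A ^ 2 = B ^ 2 + 2 * B * (A - B) + (A - B) ^ 2 := by ring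
                rw [this]
                have a1 : 2 * B * (A - B) ≤ 2 * ((C * ‖h‖) * (C * ‖h‖ ^ 2)) := by
                  have : B * (A - B) ≤ |B| * |A - B| := by rw [← abs_mul]; exact le_abs_self _
                  have : |B| * |A - B| ≤ (C * ‖h‖) * (C * ‖h‖ ^ 2) := by gcongr
                  linarith
                have a2 : (A - B) ^ 2 ≤ (C * ‖h‖ ^ 2) ^ 2 := by rw [← sq_abs]; gcongr
                have a3 : (C * ‖h‖ ^ 2) ^ 2 ≤ C ^ 2 * ‖h‖ ^ 3 := by
                  have : ‖h‖ ^ 4 ≤ ‖h‖ ^ 3 := pow_le_pow_of_le_one n0 n1 (by norm_num)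
                  nlinarith [sq_nonneg C]
                nlinarith
              have hkk : ‖h‖ ^ 3 * k h ≤ ‖h‖ ^ (3 - 2 * s - N) := by
                by_cases h0 : h = 0
                · rw [h0]; simp; positivity
                · rw [hk]; simp only
                  rw [← Real.rpow_natCast, ← Real.rpow_add (norm_pos_iff.2 h0)]
                  apply le_of_eq; congr 1; norm_num; ring
              calc (φ (x + h) - φ x) ^ 2 * k h ≤ ((fderiv ℝ φ x h) ^ 2 + 3 * C ^ 2 * ‖h‖ ^ 3) * k h := by
                    have := hk0 h; gcongr
                _ = (fderiv ℝ φ x h) ^ 2 * k h + 3 * C ^ 2 * (‖h‖ ^ 3 * k h) := by ring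
                _ ≤ _ := by gcongr
            · rw [indicator_of_notMem hx]; exact zero_le
        _ = F1 h + F2 h := by
            rw [lintegral_indicator hKm, lintegral_add_right _ measurable_const, setLIntegral_const]
            rw [hF1, hF2]; simp only
            congr 1; ring
    · rw [indicator_of_notMem (by simpa using hh), indicator_of_notMem (by simpa using hh), zero_add, zero_add,
        indicator_of_mem (by simp only [mem_compl_iff, Metric.mem_closedBall, dist_zero_right]; push Not at hh ⊢; linarith)]
      have hpos : h ≠ 0 := by rintro rfl; simp at hh; linarith
      calc ∫⁻ x, (reg N Ω).indicator
            (fun q => ENNReal.ofReal ((φ q.1 - φ q.2) ^ 2 / kern N s q.1 q.2)) (x, x + h)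
          ≤ ∫⁻ x, (((closure Ω).indicator (fun _ => ENNReal.ofReal (4 * C ^ 2) * ENNReal.ofReal (k h)) x) +
             ((closure Ω).indicator (fun _ => ENNReal.ofReal (4 * C ^ 2) * ENNReal.ofReal (k h)) (x + h))) := by
            apply lintegral_mono
            intro x
            beta_reduce
            by_cases hx : (x, x + h) ∈ reg N Ω
            · have hb : ENNReal.ofReal ((φ x - φ (x + h)) ^ 2 / kern N s x (x + h)) ≤ 
                ENNReal.ofReal (4 * C ^ 2) * ENNReal.ofReal (k h) := by
                rw [ek, ← ENNReal.ofReal_mul (by positivity)]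
                apply ENNReal.ofReal_le_ofReal
                have := hk0 h
                gcongr
                have a1 := abs_le.1 (hC1 x)
                have a2 := abs_le.1 (hC1 (x + h))
                nlinarith
              rw [indicator_of_mem hx]
              rcases hx with hx | hx
              · simp only at hx
                rw [indicator_of_mem hx]
                exact hb.trans le_self_add
              · simp only at hx
                rw [indicator_of_mem hx]
                exact hb.trans le_add_self
            · rw [indicator_of_notMem hx]; exact zero_le
        _ = F3 h := by
            rw [lintegral_add_left (measurable_const.indicator isClosed_closure.measurableSet)]
            have := lintegral_add_right_eq_self (μ := volume) (fun x => (closure Ω).indicator (fun _ => ENNReal.ofReal (4 * C ^ 2) * ENNReal.ofReal (k h)) x) h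
            rw [this, lintegral_indicator isClosed_closure.measurableSet, setLIntegral_const, hF3]
            simp only
            have : k h = ‖h‖ ^ (-(2 * s) - N) := by rw [hk]; simp only; congr 1; ring
            rw [this]; ring
  refine (lintegral_mono key).trans ?_
  have m1 : Measurable ((Metric.ball (0 : Euc N) δ).indicator F1) := hF1m.indicator measurableSet_ball
  have m2 : Measurable ((Metric.ball (0 : Euc N) δ).indicator F2) := by
    apply Measurable.indicator _ measurableSet_ball
    fun_prop
  have m12 : Measurable fun a => (Metric.ball (0 : Euc N) δ).indicator F1 a + (Metric.ball (0 : Euc N) δ).indicator F2 a := m1.add m2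
  rw [lintegral_add_left m12, lintegral_add_left m1, lintegral_indicator measurableSet_ball,
    lintegral_indicator measurableSet_ball, lintegral_indicator measurableSet_closedBall.compl]
  gcongr
  · rw [hF1]
    simp only
    rw [lintegral_lintegral_swap (f := fun h x => ENNReal.ofReal ((inner ℝ (gradF N φ x) h : ℝ) ^ 2 * k h)) hjm.aemeasurable]
    simp only [hk]
    simp_rw [inner_ball N hN s hs δ hδ]
    rw [lintegral_const_mul' _ _ ENNReal.ofReal_ne_top]
  · rw [hF2]
    rw [lintegral_const_mul _ (by fun_prop), lint_ball_rpow N hN δ (3 - 2 * s) hδ (by linarith [hs.2])]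
  · rw [hF3]
    rw [lintegral_const_mul _ (by fun_prop), lint_tail_rpow N hN (δ/2) (2 * s) (by positivity) (by linarith [hs.1])]



lemma gradF_memLp (N : ℕ) (φ : Euc N → ℝ) (hφ : ContDiff ℝ (⊤ : ℕ∞) φ) (hc : HasCompactSupport φ) :
    MemLp (gradF N φ) 2 volume := by
  apply (gradF_continuous N φ hφ).memLp_of_hasCompactSupport
  have := hc.fderiv (𝕜 := ℝ)
  exact this.comp_left (g := (InnerProductSpace.toDual ℝ (Euc N)).symm) (map_zero _)

lemma smooth_weakGrad (N : ℕ) (Ω : Set (Euc N)) (φ : Euc N → ℝ) (hφ : ContDiff ℝ (⊤ : ℕ∞) φ) 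
    (hc : HasCompactSupport φ) : IsWeakGradient N Ω φ (gradF N φ) := by
  have hL := gradF_memLp N φ hφ hc
  refine ⟨(gradF_continuous N φ hφ).measurable, ?_, ?_⟩
  · have := (hL.restrict Ω).integrable_norm_pow (by norm_num)
    have h2 := this.2
    rw [hasFiniteIntegral_iff_ofReal (Eventually.of_forall fun x => by positivity)] at h2
    simpa using h2
  · intro η hη hηc hηΩ i
    have hφm : MemLp φ 2 volume := (hφ.continuous.memLp_of_hasCompactSupport hc)
    have hηm : MemLp η 2 volume := (hη.continuous.memLp_of_hasCompactSupport hηc)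
    have hd : MemLp (fun x => fderiv ℝ η x (bas N i)) 2 volume := by
      have := memLp_coord (gradF_memLp N η hη hηc) i
      simp_rw [gradF_coord] at this
      exact this
    have hd' : MemLp (fun x => fderiv ℝ φ x (bas N i)) 2 volume := by
      have := memLp_coord hL i
      simp_rw [gradF_coord] at this
      exact this
    have h1 := integral_mul_fderiv_eq_neg_fderiv_mul_of_integrable (μ := volume) (f := φ) (g := η) (v := bas N i)
      (hd'.integrable_mul hηm) (hφm.integrable_mul hd) (hφm.integrable_mul hηm)
      (fun x _ => (hφ.differentiable (by simp)).differentiableAt) (fun x _ => (hη.differentiable (by simp)).differentiableAt)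
    have e1 : ∫ x in Ω, φ x * fderiv ℝ η x (EuclideanSpace.single i 1) = ∫ x, φ x * fderiv ℝ η x (bas N i) := by
      rw [setIntegral_eq_integral_of_forall_compl_eq_zero]
      · rfl
      · intro x hx
        have : fderiv ℝ η x = 0 := by
          by_contra h0
          exact hx (hηΩ (support_fderiv_subset ℝ h0))
        rw [this]; simp
    have e2 : ∫ x in Ω, gradF N φ x i * η x = ∫ x, fderiv ℝ φ x (bas N i) * η x := by
      simp_rw [gradF_coord]
      rw [setIntegral_eq_integral_of_forall_compl_eq_zero]
      · intro x hx
        have : η x = 0 := by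
          by_contra h0
          exact hx (hηΩ (subset_tsupport _ h0))
        rw [this]; simp
    rw [e1, e2, h1]

lemma closure_compact {N : ℕ} {Ω : Set (Euc N)} (hΩ : IsLipschitzDomain N Ω) : IsCompact (closure Ω) :=
  hΩ.2.1.isCompact_closure

lemma lint_gradF_le {N : ℕ} (φ : Euc N → ℝ) (C : ℝ) (hC2 : ∀ x, ‖fderiv ℝ φ x‖ ≤ C) (K : Set (Euc N)) :
    ∫⁻ x in K, ENNReal.ofReal (‖gradF N φ x‖ ^ 2) ≤ ENNReal.ofReal (C ^ 2) * volume K := by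
  rw [← setLIntegral_const]
  apply lintegral_mono
  intro x
  apply ENNReal.ofReal_le_ofReal
  rw [gradF_norm]
  gcongr; exact hC2 x

lemma smooth_memHs (N : ℕ) (hN : 2 ≤ N) (Ω : Set (Euc N)) (hΩ : IsLipschitzDomain N Ω) 
    (φ : Euc N → ℝ) (hφ : ContDiff ℝ (⊤ : ℕ∞) φ) (hc : HasCompactSupport φ) (s : ℝ) (hs : s ∈ Ioo (0:ℝ) 1) :
    memHs N s Ω φ := by
  refine ⟨hφ.continuous.measurable, l2sq_lt_top ((hφ.continuous.memLp_of_hasCompactSupport hc).restrict _), ?_⟩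
  obtain ⟨C, hC, hC1, hC2, hC3⟩ := taylor2 N φ hφ hc
  refine (semi_upper N hN s hs Ω φ hφ C hC hC1 hC2 hC3 1 one_pos le_rfl).trans_lt ?_
  have hK : volume (Metric.cthickening 1 (closure Ω)) < ⊤ := (closure_compact hΩ).cthickening.measure_lt_top
  have hK2 : volume (closure Ω) < ⊤ := (closure_compact hΩ).measure_lt_top
  have h1 : ∫⁻ x in Metric.cthickening 1 (closure Ω), ENNReal.ofReal (‖gradF N φ x‖ ^ 2) < ⊤ :=
    (lint_gradF_le φ C hC2 _).trans_lt (ENNReal.mul_lt_top ENNReal.ofReal_lt_top hK)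
  refine ENNReal.add_lt_top.2 ⟨ENNReal.add_lt_top.2 ⟨?_, ?_⟩, ?_⟩
  · exact ENNReal.mul_lt_top ENNReal.ofReal_lt_top h1
  · exact ENNReal.mul_lt_top (ENNReal.mul_lt_top ENNReal.ofReal_lt_top hK) ENNReal.ofReal_lt_top
  · exact ENNReal.mul_lt_top (ENNReal.mul_lt_top ENNReal.ofReal_lt_top (ENNReal.mul_lt_top (by norm_num) hK2)) ENNReal.ofReal_lt_top

lemma int_gradF_eq {N : ℕ} {φ : Euc N → ℝ} (hφ : ContDiff ℝ (⊤ : ℕ∞) φ) (hc : HasCompactSupport φ) (K : Set (Euc N)) :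
    ∫⁻ x in K, ENNReal.ofReal (‖gradF N φ x‖ ^ 2) = ENNReal.ofReal (∫ x in K, ‖gradF N φ x‖ ^ 2) := by
  rw [ofReal_integral_eq_lintegral_ofReal _ (Eventually.of_forall fun x => by positivity)]
  have := ((gradF_memLp N φ hφ hc).restrict K).integrable_norm_pow (by norm_num)
  simpa using this

lemma smooth_limsup (N : ℕ) (hN : 2 ≤ N) (Ω : Set (Euc N)) (hΩ : IsLipschitzDomain N Ω) 
    (φ : Euc N → ℝ) (hφ : ContDiff ℝ (⊤ : ℕ∞) φ) (hc : HasCompactSupport φ) (ε : ℝ) (hε : 0 < ε) :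
    ∀ᶠ s in 𝓝[<] (1:ℝ), cNs N s / 2 * (semiSq N s Ω φ).toReal < (∫ x in Ω, ‖gradF N φ x‖ ^ 2) + ε := by
  obtain ⟨C, hC, hC1, hC2, hC3⟩ := taylor2 N φ hφ hc
  have hcl : volume (closure Ω) = volume Ω := by
    apply le_antisymm _ (measure_mono subset_closure)
    rw [closure_eq_self_union_frontier]
    refine (measure_union_le _ _).trans ?_
    rw [frontier_null N Ω hΩ, add_zero]
  have hfin := vol_ne_top hΩ
  -- choice of δ
  obtain ⟨δ, hδ0, hδ1, hδ⟩ : ∃ δ : ℝ, 0 < δ ∧ δ ≤ 1 ∧ 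
      volume (Metric.cthickening δ (closure Ω)) < volume Ω + ENNReal.ofReal (ε / (2 * (C ^ 2 + 1))) := by
    have ht := tendsto_measure_cthickening_of_isCompact (μ := (volume : Measure (Euc N))) (closure_compact hΩ)
    rw [hcl] at ht
    have h1 : ∀ᶠ r in 𝓝 (0:ℝ), volume (Metric.cthickening r (closure Ω)) < volume Ω + ENNReal.ofReal (ε / (2 * (C ^ 2 + 1))) :=
      ht.eventually_lt_const (ENNReal.lt_add_right hfin (by simp; positivity))
    have h2 : ∀ᶠ r in 𝓝[>] (0:ℝ), r ≤ 1 := by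
      have : ∀ᶠ r in 𝓝 (0:ℝ), r ≤ 1 := eventually_le_nhds (by norm_num)
      exact this.filter_mono nhdsWithin_le_nhds
    obtain ⟨r, hr⟩ := ((h1.filter_mono nhdsWithin_le_nhds).and (h2.and self_mem_nhdsWithin)).exists
    exact ⟨r, hr.2.2, hr.2.1, hr.1⟩
  set K := Metric.cthickening δ (closure Ω) with hK
  have hKf : volume K < ⊤ := (closure_compact hΩ).cthickening.measure_lt_top
  have hΩK : Ω ⊆ K := subset_closure.trans (Metric.self_subset_cthickening _)
  set X := ∫ x in K, ‖gradF N φ x‖ ^ 2 with hX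
  have hXΩ : X ≤ (∫ x in Ω, ‖gradF N φ x‖ ^ 2) + ε / 2 := by
    have hi : Integrable (fun x => ‖gradF N φ x‖ ^ 2) := by
      simpa using (gradF_memLp N φ hφ hc).integrable_norm_pow (by norm_num)
    have h1 : X = (∫ x in Ω, ‖gradF N φ x‖ ^ 2) + ∫ x in K \ Ω, ‖gradF N φ x‖ ^ 2 := by
      rw [hX, ← setIntegral_union disjoint_sdiff_right (Metric.isClosed_cthickening.measurableSet.diff hΩ.1.measurableSet) hi.integrableOn hi.integrableOn,
        union_diff_cancel hΩK]
    have h2 : ∫ x in K \ Ω, ‖gradF N φ x‖ ^ 2 ≤ ε / 2 := by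
      have h3 := lint_gradF_le φ C hC2 (K \ Ω)
      rw [int_gradF_eq hφ hc] at h3
      have h4 : volume (K \ Ω) ≤ ENNReal.ofReal (ε / (2 * (C ^ 2 + 1))) := by
        rw [measure_diff hΩK hΩ.1.measurableSet.nullMeasurableSet hfin]
        exact tsub_le_iff_left.2 hδ.le
      have h5 : ENNReal.ofReal (∫ x in K \ Ω, ‖gradF N φ x‖ ^ 2) ≤ ENNReal.ofReal (C ^ 2 * (ε / (2 * (C ^ 2 + 1)))) := by
        rw [ENNReal.ofReal_mul (by positivity)]
        exact h3.trans (by gcongr)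
      have h6 := (ENNReal.ofReal_le_ofReal_iff (by positivity)).1 h5
      refine h6.trans ?_
      rw [mul_div_assoc', div_le_div_iff₀ (by positivity) (by positivity)]
      nlinarith [sq_nonneg C]
    linarith
  have hb := bN_pos N hN
  -- the real bound
  set R : ℝ → ℝ := fun s => cNs N s / 2 * (bN N * δ ^ (2 - 2 * s) / (2 - 2 * s)) * X
      + cNs N s * (1 / 2 * (3 * C ^ 2 * volume.real K * (N * bN N * δ ^ (3 - 2 * s) / (3 - 2 * s))
        + 4 * C ^ 2 * (2 * volume.real (closure Ω)) * (N * bN N * (δ / 2) ^ (-(2 * s)) / (2 * s)))) with hR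
  have hRl : Tendsto R (𝓝[<] 1) (𝓝 (1 * X + 0 * (1 / 2 * (3 * C ^ 2 * volume.real K * (N * bN N * δ ^ (3 - 2 * (1:ℝ)) / (3 - 2 * 1))
        + 4 * C ^ 2 * (2 * volume.real (closure Ω)) * (N * bN N * (δ / 2) ^ (-(2 * (1:ℝ))) / (2 * 1)))))) := by
    apply ((tendsto_main N hN δ hδ0).mul_const X).add
    apply (tendsto_cNs N hN).mul
    apply Tendsto.mono_left _ nhdsWithin_le_nhds
    apply Tendsto.const_mul
    apply Tendsto.add
    · apply Tendsto.const_mul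
      apply Tendsto.div
      · apply Tendsto.const_mul
        apply Tendsto.rpow tendsto_const_nhds
        · exact (by fun_prop : Continuous fun s : ℝ => 3 - 2 * s).tendsto 1
        · left; positivity
      · exact (by fun_prop : Continuous fun s : ℝ => 3 - 2 * s).tendsto 1
      · norm_num
    · apply Tendsto.const_mul
      apply Tendsto.div
      · apply Tendsto.const_mul
        apply Tendsto.rpow tendsto_const_nhds
        · exact (by fun_prop : Continuous fun s : ℝ => -(2 * s)).tendsto 1
        · left; positivity
      · exact (by fun_prop : Continuous fun s : ℝ => 2 * s).tendsto 1
      · norm_num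
  have hIoo : ∀ᶠ s in 𝓝[<] (1:ℝ), s ∈ Ioo (0:ℝ) 1 := Ioo_mem_nhdsLT (by norm_num)
  have hev := hRl.eventually_lt_const (u := (∫ x in Ω, ‖gradF N φ x‖ ^ 2) + ε) (by
    rw [one_mul, zero_mul, add_zero]; linarith)
  filter_upwards [hIoo, hev] with s hs hRs
  refine lt_of_le_of_lt ?_ hRs
  have hu := semi_upper N hN s hs Ω φ hφ C hC hC1 hC2 hC3 δ hδ0 hδ1
  rw [← hK, int_gradF_eq hφ hc, ← hX] at hu
  have hXn : 0 ≤ X := integral_nonneg fun x => by positivity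
  have p1 : 0 ≤ bN N * δ ^ (2 - 2 * s) / (2 - 2 * s) := div_nonneg (by positivity) (by linarith [hs.2])
  have p2 : 0 ≤ N * bN N * δ ^ (3 - 2 * s) / (3 - 2 * s) := div_nonneg (by positivity) (by linarith [hs.2])
  have p3 : 0 ≤ N * bN N * (δ / 2) ^ (-(2 * s)) / (2 * s) := div_nonneg (by positivity) (by linarith [hs.1])
  have hK2 : volume (closure Ω) < ⊤ := (closure_compact hΩ).measure_lt_top
  have eK : volume K = ENNReal.ofReal (volume.real K) := (ofReal_measureReal hKf.ne).symm
  have eO : volume (closure Ω) = ENNReal.ofReal (volume.real (closure Ω)) := (ofReal_measureReal hK2.ne).symm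
  have e2 : (2 : ℝ≥0∞) * ENNReal.ofReal (volume.real (closure Ω)) = ENNReal.ofReal (2 * volume.real (closure Ω)) := by
    rw [ENNReal.ofReal_mul (by norm_num)]; norm_num
  rw [eK, eO, e2, ← ENNReal.ofReal_mul p1, ← ENNReal.ofReal_mul (by positivity), ← ENNReal.ofReal_mul (by positivity),
    ← ENNReal.ofReal_mul (by positivity), ← ENNReal.ofReal_mul (by positivity),
    ← ENNReal.ofReal_add (by positivity) (by positivity), ← ENNReal.ofReal_add (by positivity) (by positivity)] at hu
  have hu2 := ENNReal.toReal_le_of_le_ofReal (by positivity) hu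
  have hcp := cNs_pos N s hs
  calc cNs N s / 2 * (semiSq N s Ω φ).toReal ≤ cNs N s / 2 * _ := mul_le_mul_of_nonneg_left hu2 (by positivity)
    _ = R s := by rw [hR]; ring

lemma smooth_tendsto (N : ℕ) (hN : 2 ≤ N) (Ω : Set (Euc N)) (hΩ : IsLipschitzDomain N Ω) 
    (φ : Euc N → ℝ) (hφ : ContDiff ℝ (⊤ : ℕ∞) φ) (hc : HasCompactSupport φ) 
    (sk : ℕ → ℝ) (hsk : ∀ k, sk k ∈ Ioo (0:ℝ) 1) (hlim : Tendsto sk atTop (𝓝 1)) :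
    Tendsto (fun k => cNs N (sk k) / 2 * (semiSq N (sk k) Ω φ).toReal) atTop (𝓝 (∫ x in Ω, ‖gradF N φ x‖ ^ 2)) := by
  have hsl : Tendsto sk atTop (𝓝[<] 1) :=
    tendsto_nhdsWithin_iff.2 ⟨hlim, Eventually.of_forall fun k => (hsk k).2⟩
  rw [tendsto_order]
  constructor
  · intro a ha
    by_contra hcon
    rw [not_eventually] at hcon
    obtain ⟨ψ, hψ, hψ2⟩ := extraction_of_frequently_atTop hcon
    have hφm : MemLp φ 2 (volume.restrict Ω) := (hφ.continuous.memLp_of_hasCompactSupport hc).restrict _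
    obtain ⟨g, hg, hgL, hgM⟩ := weak_liminf N hN Ω hΩ.1 (vol_ne_top hΩ) (sk ∘ ψ) (fun k => hsk _) 
      (hlim.comp hψ.tendsto_atTop) (fun _ => φ) (fun k => smooth_memHs N hN Ω hΩ φ hφ hc _ (hsk _)) φ hφm
      (by simp) (fun _ => a) a tendsto_const_nhds (fun k => not_lt.1 (hψ2 k))
    have := weakGrad_unique hΩ.1 (vol_ne_top hΩ) hg (smooth_weakGrad N Ω φ hφ hc)
    have e : ∫ x in Ω, ‖g x‖ ^ 2 = ∫ x in Ω, ‖gradF N φ x‖ ^ 2 := by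
      apply integral_congr_ae
      filter_upwards [this] with x hx
      rw [hx]
    linarith
  · intro a ha
    have := hsl.eventually (smooth_limsup N hN Ω hΩ φ hφ hc (a - ∫ x in Ω, ‖gradF N φ x‖ ^ 2) (by linarith))
    filter_upwards [this] with k hk
    linarith



lemma translate_cont (N : ℕ) (F : Euc N → ℝ) (hF : MemLp F 2 volume) (ε : ℝ) (hε : 0 < ε) :
    ∃ l : ℝ, 0 < l ∧ ∀ h : Euc N, ‖h‖ < l → ∫⁻ x, ENNReal.ofReal ((F (x + h) - F x) ^ 2) ≤ ENNReal.ofReal ε := by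
  let g : C(Euc N, C(Euc N, Euc N)) := (ContinuousMap.mk (fun a : Euc N × Euc N => a.2 + a.1) (by fun_prop)).curry
  have hgm : ∀ h, MeasurePreserving (g h) volume volume := fun h => measurePreserving_add_right volume h
  have ht : Tendsto (fun h => Lp.compMeasurePreserving (g h) (hgm h) (hF.toLp F)) (𝓝 0)
      (𝓝 (Lp.compMeasurePreserving (g 0) (hgm 0) (hF.toLp F))) := 
    Filter.Tendsto.compMeasurePreservingLp (α := Euc N) (l := 𝓝 0) (f := fun _ => hF.toLp F) (f₀ := hF.toLp F) (g := g) (g₀ := g 0)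
      tendsto_const_nhds (g.continuous.tendsto 0) hgm (hgm 0) (by norm_num)
  have e0 : Lp.compMeasurePreserving (g 0) (hgm 0) (hF.toLp F) = hF.toLp F := by
    rw [Lp.toLp_compMeasurePreserving hF]
    congr 1
    ext x; simp [g]
  rw [e0, Metric.tendsto_nhds_nhds] at ht
  obtain ⟨l, hl, h⟩ := ht (√ε) (Real.sqrt_pos.2 hε)
  refine ⟨l, hl, fun h' hh => ?_⟩
  have h1 := h (x := h') (by simpa using hh)
  rw [Lp.toLp_compMeasurePreserving hF, dist_eq_norm, ← MemLp.toLp_sub] at h1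
  have hm : MemLp (fun x => F (x + h') - F x) 2 volume := (hF.comp_measurePreserving (hgm h')).sub hF
  have h2 : ‖hm.toLp _‖ < √ε := h1
  have h3 : ‖hm.toLp _‖ ^ 2 ≤ ε := by
    rw [← Real.sq_sqrt hε.le]; gcongr
  rw [norm_sq_toLp] at h3
  rw [← ofReal_integral_eq_lintegral_ofReal hm.integrable_sq (Eventually.of_forall fun x => sq_nonneg _)]
  exact ENNReal.ofReal_le_ofReal h3

lemma memLp_shift (N : ℕ) (F : Euc N → ℝ) (hF : MemLp F 2 volume) (x : Euc N) : MemLp (fun t => F (x - t)) 2 volume :=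
  hF.comp_measurePreserving (Measure.measurePreserving_sub_left volume x)

def molB (N : ℕ) (b : ContDiffBump (0 : Euc N)) (F : Euc N → ℝ) (x : Euc N) : ℝ := ∫ t, b.normed volume t * F (x - t)

lemma normed_memLp (N : ℕ) (b : ContDiffBump (0 : Euc N)) : MemLp (b.normed volume) 2 (volume : Measure (Euc N)) :=
  b.continuous_normed.memLp_of_hasCompactSupport b.hasCompactSupport_normed

lemma molB_conv (N : ℕ) (F : Euc N → ℝ) (hFm : Measurable F) (hF : MemLp F 2 volume) (ε : ℝ) (hε : 0 < ε) :
    ∃ l : ℝ, 0 < l ∧ ∀ (b : ContDiffBump (0 : Euc N)) (c : Euc N), b.rOut + ‖c‖ ≤ l → 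
      ∫⁻ x, ENNReal.ofReal ((molB N b F (x + c) - F x) ^ 2) ≤ ENNReal.ofReal ε := by
  obtain ⟨l, hl, h⟩ := translate_cont N F hF ε hε
  refine ⟨l, hl, fun b c hbc => ?_⟩
  set ρ := b.normed (volume : Measure (Euc N)) with hρ
  have hρc : Continuous ρ := b.continuous_normed
  have hρ0 : ∀ t, 0 ≤ ρ t := b.nonneg_normed
  have hρL := normed_memLp N b
  set ν := (volume : Measure (Euc N)).withDensity (fun t => ENNReal.ofReal (ρ t)) with hν
  haveI : IsProbabilityMeasure ν := ⟨by
    rw [hν, withDensity_apply _ MeasurableSet.univ, Measure.restrict_univ, 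
      ← ofReal_integral_eq_lintegral_ofReal b.integrable_normed (Eventually.of_forall hρ0), b.integral_normed, ENNReal.ofReal_one]⟩
  have hIntg : ∀ x, Integrable (fun t => ρ t * F (x - t)) := fun x => hρL.integrable_mul (memLp_shift N F hF x)
  have hsup : ∀ t, ρ t ≠ 0 → ‖t‖ < b.rOut := by
    intro t ht
    have : t ∈ Function.support ρ := ht
    rw [hρ, b.support_normed_eq] at this
    simpa using this
  have hfm : Measurable (fun p : Euc N × Euc N => ENNReal.ofReal ((F (p.1 + c - p.2) - F p.1) ^ 2) * ENNReal.ofReal (ρ p.2)) := by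
    have h1 : Measurable (fun p : Euc N × Euc N => F (p.1 + c - p.2)) := hFm.comp (by fun_prop)
    have h2 : Measurable (fun p : Euc N × Euc N => F p.1) := hFm.comp measurable_fst
    have h3 : Measurable (fun p : Euc N × Euc N => ρ p.2) := hρc.measurable.comp measurable_snd
    exact ((h1.sub h2).pow_const 2).ennreal_ofReal.mul h3.ennreal_ofReal
  have key : ∀ x, ENNReal.ofReal ((molB N b F (x + c) - F x) ^ 2) ≤ 
      ∫⁻ t, ENNReal.ofReal ((F (x + c - t) - F x) ^ 2) * ENNReal.ofReal (ρ t) := by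
    intro x
    have hm : Measurable (fun t => F (x + c - t) - F x) := (hFm.comp (by fun_prop)).sub_const _
    have h1 := sq_integral_le ν (fun t => F (x + c - t) - F x) hm.aestronglyMeasurable
    have e1 : ∫ t, (F (x + c - t) - F x) ∂ν = molB N b F (x + c) - F x := by
      rw [hν, integral_withDensity_eq_integral_toReal_smul (by fun_prop) (Eventually.of_forall fun t => ENNReal.ofReal_lt_top)]
      have : ∀ t, (ENNReal.ofReal (ρ t)).toReal • (F (x + c - t) - F x) = ρ t * F (x + c - t) - ρ t * F x := fun t => by
        rw [ENNReal.toReal_ofReal (hρ0 t), smul_eq_mul]; ring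
      simp_rw [this]
      rw [integral_sub (hIntg (x + c)) (b.integrable_normed.mul_const _), integral_mul_const, b.integral_normed, one_mul]
      rfl
    rw [e1] at h1
    refine h1.trans (le_of_eq ?_)
    rw [hν, lintegral_withDensity_eq_lintegral_mul _ (by fun_prop) (hm.pow_const 2).ennreal_ofReal]
    congr 1; ext t
    simp only [Pi.mul_apply]; ring
  calc _ ≤ ∫⁻ x, ∫⁻ t, ENNReal.ofReal ((F (x + c - t) - F x) ^ 2) * ENNReal.ofReal (ρ t) := lintegral_mono key
    _ = ∫⁻ t, ∫⁻ x, ENNReal.ofReal ((F (x + c - t) - F x) ^ 2) * ENNReal.ofReal (ρ t) := 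
        lintegral_lintegral_swap hfm.aemeasurable
    _ ≤ ∫⁻ t, ENNReal.ofReal ε * ENNReal.ofReal (ρ t) := by
        apply lintegral_mono
        intro t
        beta_reduce
        rw [lintegral_mul_const' _ _ ENNReal.ofReal_ne_top]
        by_cases h0 : ρ t = 0
        · rw [h0]; simp
        · gcongr
          have := h (c - t) (by
            have := hsup t h0
            have h2 := norm_sub_le c t
            linarith)
          simpa only [add_sub_assoc] using this
    _ = ENNReal.ofReal ε := by
        rw [lintegral_const_mul' _ _ ENNReal.ofReal_ne_top, 
          ← ofReal_integral_eq_lintegral_ofReal b.integrable_normed (Eventually.of_forall hρ0), b.integral_normed, ENNReal.ofReal_one, mul_one]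

lemma molB_eq (N : ℕ) (b : ContDiffBump (0 : Euc N)) (F : Euc N → ℝ) : 
    molB N b F = MeasureTheory.convolution (b.normed volume) F (ContinuousLinearMap.lsmul ℝ ℝ) volume := by
  ext x
  rw [convolution_def]
  rfl

lemma molB_contDiff (N : ℕ) (b : ContDiffBump (0 : Euc N)) (F : Euc N → ℝ) (hF : MemLp F 2 volume) :
    ContDiff ℝ (⊤ : ℕ∞) (molB N b F) := by
  rw [molB_eq]
  exact b.hasCompactSupport_normed.contDiff_convolution_left _ b.contDiff_normed (hF.locallyIntegrable (by norm_num))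

lemma molB_fderiv (N : ℕ) (b : ContDiffBump (0 : Euc N)) (F : Euc N → ℝ) (hF : MemLp F 2 volume) (x v : Euc N) :
    fderiv ℝ (molB N b F) x v = ∫ y, F y * fderiv ℝ (b.normed volume) (x - y) v := by
  rw [molB_eq]
  have hL : LocallyIntegrable F volume := hF.locallyIntegrable (by norm_num)
  rw [(b.hasCompactSupport_normed.hasFDerivAt_convolution_left (ContinuousLinearMap.lsmul ℝ ℝ) (b.contDiff_normed (n := 1)) hL x).fderiv]
  rw [convolution_def]
  have hi : ConvolutionExistsAt (fderiv ℝ (b.normed volume)) F x (ContinuousLinearMap.precompL (Euc N) (ContinuousLinearMap.lsmul ℝ ℝ)) volume := 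
    HasCompactSupport.convolutionExists_left _ (b.hasCompactSupport_normed.fderiv ℝ) ((b.contDiff_normed (n := 1)).continuous_fderiv (by simp)) hL x
  rw [ContinuousLinearMap.integral_apply hi]
  have := integral_sub_left_eq_self (μ := volume) (fun y => F y * fderiv ℝ (b.normed volume) (x - y) v) x
  rw [← this]
  congr 1; ext t
  rw [sub_sub_cancel]
  simp [ContinuousLinearMap.precompL_apply]
  ring



lemma local_approx (N : ℕ) (Ω : Set (Euc N)) (hΩ : IsOpen Ω) (v : Euc N → ℝ) (hvm : Measurable v)
    (hv : MemLp v 2 (volume.restrict Ω)) (g : Euc N → Euc N) (hg : IsWeakGradient N Ω v g)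
    (x0 e : Euc N) (r κ : ℝ) (he : ‖e‖ = 1) (hκ : 0 < κ) (hκ4 : κ ≤ 1 / 4) (hr : 0 < r)
    (hcone : ∀ y ∈ Ω ∩ Metric.ball x0 r, ∀ l ∈ Ioc 0 r, ∀ h ∈ Metric.closedBall ((3 / 4 * l) • e) (κ * l), (y, h) ∈ Sg N Ω)
    (ε : ℝ) (hε : 0 < ε) :
    ∃ B : Euc N → ℝ, ContDiff ℝ (⊤ : ℕ∞) B ∧ ∫⁻ x in Ω, ENNReal.ofReal ((B x - v x) ^ 2) ≤ ENNReal.ofReal ε ∧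
      ∀ i, ∫⁻ x in Ω ∩ Metric.ball x0 r, ENNReal.ofReal ((fderiv ℝ B x (bas N i) - g x i) ^ 2) ≤ ENNReal.ofReal ε := by
  have hF : MemLp (Ω.indicator v) 2 volume := (memLp_indicator_iff_restrict hΩ.measurableSet).2 hv
  have hFm : Measurable (Ω.indicator v) := hvm.indicator hΩ.measurableSet
  have hgi : ∀ i, Measurable fun x => g x i := fun i => by
    have := hg.1
    fun_prop
  have hG : ∀ i, MemLp (Ω.indicator fun x => g x i) 2 volume := fun i => 
    (memLp_indicator_iff_restrict hΩ.measurableSet).2 (memLp_coord (weakGrad_memLp hg) i)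
  have hGm : ∀ i, Measurable (Ω.indicator fun x => g x i) := fun i => (hgi i).indicator hΩ.measurableSet
  obtain ⟨lv, hlv, hv2⟩ := molB_conv N _ hFm hF ε hε
  choose lg hlg hg2 using fun i => molB_conv N _ (hGm i) (hG i) ε hε
  have hev : ∀ᶠ l in 𝓝[>] (0:ℝ), (l ∈ Ioc 0 r ∧ l ≤ lv) ∧ ∀ i, l ≤ lg i := by
    have h0 : ∀ᶠ l in 𝓝[>] (0:ℝ), l ∈ Ioc 0 r := Ioc_mem_nhdsGT hr
    have h1 : ∀ᶠ l in 𝓝[>] (0:ℝ), l ≤ lv := (eventually_le_nhds hlv).filter_mono nhdsWithin_le_nhds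
    have h2 : ∀ i, ∀ᶠ l in 𝓝[>] (0:ℝ), l ≤ lg i := fun i => (eventually_le_nhds (hlg i)).filter_mono nhdsWithin_le_nhds
    exact (h0.and h1).and (eventually_all.2 h2)
  obtain ⟨l, ⟨hl, hllv⟩, hllg⟩ := hev.exists
  have hl0 := hl.1
  let b : ContDiffBump (0 : Euc N) := ⟨κ * l / 2, κ * l, by positivity, by linarith [mul_pos hκ hl0]⟩
  have hbr : b.rOut = κ * l := rfl
  set c : Euc N := (3 / 4 * l) • e with hc
  have hbc : b.rOut + ‖c‖ ≤ l := by
    rw [hbr, hc, norm_smul, he, Real.norm_eq_abs, abs_of_pos (by positivity)]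
    nlinarith
  have hS := molB_contDiff N b _ hF
  refine ⟨fun x => molB N b (Ω.indicator v) (x + c), hS.comp (contDiff_id.add contDiff_const), ?_, ?_⟩
  · refine le_trans ?_ (hv2 b c (hbc.trans hllv))
    refine le_trans (le_of_eq ?_) (setLIntegral_le_lintegral Ω _)
    apply setLIntegral_congr_fun hΩ.measurableSet
    intro x hx
    simp only [indicator_of_mem hx]
  · intro i
    refine le_trans ?_ (hg2 i b c (hbc.trans (hllg i)))
    refine le_trans (le_of_eq ?_) (setLIntegral_le_lintegral (Ω ∩ Metric.ball x0 r) _)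
    apply setLIntegral_congr_fun (hΩ.measurableSet.inter measurableSet_ball)
    intro x hx
    simp only
    rw [indicator_of_mem hx.1]
    congr 3
    rw [fderiv_comp_add_right, molB_fderiv N b _ hF]
    set ρ := b.normed (volume : Measure (Euc N)) with hρ
    have hρd : ContDiff ℝ (⊤ : ℕ∞) ρ := b.contDiff_normed
    have hηd : ContDiff ℝ (⊤ : ℕ∞) (fun y => ρ (x + c - y)) := hρd.comp (contDiff_const.sub contDiff_id)
    have hηs : tsupport (fun y => ρ (x + c - y)) ⊆ Metric.closedBall (x + c) (κ * l) := by
      apply closure_minimal _ Metric.isClosed_closedBall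
      intro y hy
      have : x + c - y ∈ Function.support ρ := hy
      rw [hρ, b.support_normed_eq, hbr] at this
      rw [Metric.mem_closedBall, dist_comm, dist_eq_norm]
      have := Metric.mem_ball.1 this
      rw [dist_zero_right] at this
      exact this.le
    have hηc : HasCompactSupport (fun y => ρ (x + c - y)) := 
      (isCompact_closedBall _ _).of_isClosed_subset (isClosed_tsupport _) hηs
    have hηΩ : tsupport (fun y => ρ (x + c - y)) ⊆ Ω := by
      refine hηs.trans fun y hy => ?_
      have h1 := hcone x hx l hl (y - x) (by
        rw [Metric.mem_closedBall, dist_eq_norm] at hy ⊢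
        rw [show y - x - (3 / 4 * l) • e = y - (x + c) by rw [hc]; abel]
        exact hy)
      have h2 := h1 1 (by simp)
      simpa using h2
    have hw := hg.2.2 _ hηd hηc hηΩ i
    have hfd : ∀ y, fderiv ℝ (fun y => ρ (x + c - y)) y = - fderiv ℝ ρ (x + c - y) := fun y => by
      have h1 : HasFDerivAt ρ (fderiv ℝ ρ (x + c - y)) (x + c - y) := (hρd.differentiable (by simp)).differentiableAt.hasFDerivAt
      have h2 : HasFDerivAt (fun y : Euc N => x + c - y) (-(ContinuousLinearMap.id ℝ (Euc N))) y := (hasFDerivAt_id y).const_sub _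
      have h3 := (h1.comp y h2).fderiv
      rw [show (fun y => ρ (x + c - y)) = ρ ∘ (fun y : Euc N => x + c - y) from rfl, h3]
      ext z; simp
    simp_rw [hfd] at hw
    have e1 : ∫ y, Ω.indicator v y * fderiv ℝ ρ (x + c - y) (bas N i) = ∫ y in Ω, v y * fderiv ℝ ρ (x + c - y) (bas N i) := by
      rw [← integral_indicator hΩ.measurableSet]
      congr 1; ext y
      by_cases hy : y ∈ Ω
      · simp only [indicator_of_mem hy]
      · simp only [indicator_of_notMem hy, zero_mul]
    have e2 : molB N b (Ω.indicator fun x => g x i) (x + c) = ∫ y in Ω, g y i * ρ (x + c - y) := by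
      unfold molB
      rw [← integral_indicator hΩ.measurableSet]
      have := integral_sub_left_eq_self (μ := volume) (fun y => Ω.indicator (fun y => g y i * ρ (x + c - y)) y) (x + c)
      rw [← this]
      congr 1; ext t
      by_cases hy : x + c - t ∈ Ω
      · simp only [indicator_of_mem hy, sub_sub_cancel]; rw [mul_comm]
      · simp only [indicator_of_notMem hy, mul_zero]
    rw [e1, e2]
    have e3 : ∫ y in Ω, v y * (-fderiv ℝ ρ (x + c - y)) (EuclideanSpace.single i 1) = - ∫ y in Ω, v y * fderiv ℝ ρ (x + c - y) (bas N i) := by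
      rw [← integral_neg]
      congr 1; ext y
      simp [bas]
    rw [e3] at hw
    exact neg_injective hw

lemma sq_sum_le {ι : Type*} (t : Finset ι) (f : ι → ℝ) : (∑ i ∈ t, f i) ^ 2 ≤ t.card * ∑ i ∈ t, (f i) ^ 2 := 
  sq_sum_le_card_mul_sum_sq



lemma lint_sum_sq {α ι : Type*} [MeasurableSpace α] (μ : Measure α) (S : Set α) (hS : MeasurableSet S) (t : Finset ι)
    (f : ι → α → ℝ) (hf : ∀ i, Measurable (f i)) (F : α → ℝ) (hF : ∀ x ∈ S, F x = ∑ i ∈ t, f i x) (D : ℝ) (hD : 0 ≤ D)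
    (h : ∀ i ∈ t, ∫⁻ x in S, ENNReal.ofReal ((f i x) ^ 2) ∂μ ≤ ENNReal.ofReal D) :
    ∫⁻ x in S, ENNReal.ofReal ((F x) ^ 2) ∂μ ≤ ENNReal.ofReal ((t.card : ℝ) ^ 2 * D) := by
  calc ∫⁻ x in S, ENNReal.ofReal ((F x) ^ 2) ∂μ ≤ ∫⁻ x in S, ENNReal.ofReal t.card * ∑ i ∈ t, ENNReal.ofReal ((f i x) ^ 2) ∂μ := by
        apply setLIntegral_mono' hS
        intro x hx
        rw [hF x hx, ← ENNReal.ofReal_sum_of_nonneg (fun i _ => sq_nonneg _), ← ENNReal.ofReal_mul (by positivity)]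
        exact ENNReal.ofReal_le_ofReal (sq_sum_le t _)
    _ = ENNReal.ofReal t.card * ∑ i ∈ t, ∫⁻ x in S, ENNReal.ofReal ((f i x) ^ 2) ∂μ := by
        rw [lintegral_const_mul' _ _ ENNReal.ofReal_ne_top, lintegral_finsetSum]
        intro i _
        exact ((hf i).pow_const 2).ennreal_ofReal
    _ ≤ ENNReal.ofReal t.card * ∑ i ∈ t, ENNReal.ofReal D := by
        gcongr with i hi
        exact h i hi
    _ = _ := by
        rw [Finset.sum_const, nsmul_eq_mul, ← ENNReal.ofReal_natCast, ← ENNReal.ofReal_mul (by positivity), ← ENNReal.ofReal_mul (by positivity)]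
        congr 1; ring

lemma pou (N : ℕ) (K : Set (Euc N)) (hK : IsClosed K) (t : Finset (Euc N)) (r : Euc N → ℝ)
    (hcov : K ⊆ ⋃ x ∈ t, Metric.ball x (r x)) :
    ∃ χ : Euc N → Euc N → ℝ, (∀ x, ContDiff ℝ (⊤ : ℕ∞) (χ x)) ∧ (∀ x, HasCompactSupport (χ x)) ∧
      (∀ x, tsupport (χ x) ⊆ Metric.ball x (r x)) ∧ (∀ x y, 0 ≤ χ x y ∧ χ x y ≤ 1) ∧ ∀ y ∈ K, ∑ x ∈ t, χ x y = 1 := by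
  classical
  obtain ⟨f, hf⟩ := SmoothPartitionOfUnity.exists_isSubordinate (modelWithCornersSelf ℝ (Euc N)) hK
    (fun x : {x // x ∈ t} => Metric.ball x.1 (r x.1)) (fun _ => Metric.isOpen_ball) (by
      intro y hy
      obtain ⟨x, hx, hxy⟩ := mem_iUnion₂.1 (hcov hy)
      exact mem_iUnion.2 ⟨⟨x, hx⟩, hxy⟩)
  refine ⟨fun x => if h : x ∈ t then f ⟨x, h⟩ else 0, ?_, ?_, ?_, ?_, ?_⟩
  · intro x
    by_cases h : x ∈ t
    · simp only [h, dif_pos]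
      exact (f ⟨x, h⟩).contMDiff.contDiff
    · simp only [h, dif_neg, not_false_iff]
      exact contDiff_const
  · intro x
    by_cases h : x ∈ t
    · simp only [h, dif_pos]
      exact (isCompact_closedBall x (r x)).of_isClosed_subset (isClosed_tsupport _) ((hf ⟨x, h⟩).trans Metric.ball_subset_closedBall)
    · simp only [h, dif_neg, not_false_iff]
      exact HasCompactSupport.zero
  · intro x
    by_cases h : x ∈ t
    · simp only [h, dif_pos]
      exact hf ⟨x, h⟩
    · simp only [h, dif_neg, not_false_iff]
      simp [tsupport]
  · intro x y
    by_cases h : x ∈ t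
    · simp only [h, dif_pos]
      exact ⟨f.nonneg _ _, f.le_one _ _⟩
    · simp [h]
  · intro y hy
    have h1 := f.sum_eq_one hy
    rw [finsum_eq_sum_of_fintype] at h1
    rw [← h1, ← Finset.sum_coe_sort t]
    apply Finset.sum_congr rfl
    intro i _
    simp

lemma approx_lint (N : ℕ) (hN : 2 ≤ N) (Ω : Set (Euc N)) (hΩ : IsLipschitzDomain N Ω) (v : Euc N → ℝ) (hvm : Measurable v)
    (hv : MemLp v 2 (volume.restrict Ω)) (g : Euc N → Euc N) (hg : IsWeakGradient N Ω v g) (ε : ℝ) (hε : 0 < ε) :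
    ∃ φ : Euc N → ℝ, ContDiff ℝ (⊤ : ℕ∞) φ ∧ HasCompactSupport φ ∧ 
      ∫⁻ x in Ω, ENNReal.ofReal ((φ x - v x) ^ 2) ≤ ENNReal.ofReal ε ∧
      ∀ i, ∫⁻ x in Ω, ENNReal.ofReal ((gradF N φ x i - g x i) ^ 2) ≤ ENNReal.ofReal ε := by
  obtain ⟨t, r, e, κ, ht, hcov⟩ := cone_cover N hN Ω hΩ
  obtain ⟨χ, hχd, hχc, hχs, hχ1, hχsum⟩ := pou N _ isClosed_closure t r hcov
  choose C hC0 hC1 hC2 hC3 using fun x => taylor2 N (χ x) (hχd x) (hχc x)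
  have hCC : ∃ D : ℝ, 0 ≤ D ∧ ∀ x ∈ t, C x ≤ D := 
    ⟨∑ x ∈ t, C x, Finset.sum_nonneg fun x _ => hC0 x, fun x hx => Finset.single_le_sum (f := C) (fun x _ => hC0 x) hx⟩
  obtain ⟨D, hD0, hD⟩ := hCC
  set m : ℝ := (t.card : ℝ) with hm
  have hm0 : 0 ≤ m := by positivity
  set ε' : ℝ := ε / ((m ^ 2 + 1) * (2 * D ^ 2 + 2)) with hε'
  have hε'0 : 0 < ε' := by positivity
  have hkey : m ^ 2 * ((2 * D ^ 2 + 2) * ε') ≤ ε := by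
    rw [hε']
    have : m ^ 2 * ((2 * D ^ 2 + 2) * (ε / ((m ^ 2 + 1) * (2 * D ^ 2 + 2)))) = ε * (m ^ 2 / (m ^ 2 + 1)) := by field_simp
    rw [this]
    have : m ^ 2 / (m ^ 2 + 1) ≤ 1 := by rw [div_le_one (by positivity)]; linarith
    nlinarith
  have hB : ∀ x, ∃ B : Euc N → ℝ, x ∈ t → ContDiff ℝ (⊤ : ℕ∞) B ∧ ∫⁻ y in Ω, ENNReal.ofReal ((B y - v y) ^ 2) ≤ ENNReal.ofReal ε' ∧
      ∀ i, ∫⁻ y in Ω ∩ Metric.ball x (r x), ENNReal.ofReal ((fderiv ℝ B y (bas N i) - g y i) ^ 2) ≤ ENNReal.ofReal ε' := by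
    intro x
    by_cases hx : x ∈ t
    · obtain ⟨h1, h2, h3, h4, h5⟩ := ht x hx
      obtain ⟨B, hB⟩ := local_approx N Ω hΩ.1 v hvm hv g hg x (e x) (r x) (κ x) h1 h2 h3 h4 h5 ε' hε'0
      exact ⟨B, fun _ => hB⟩
    · exact ⟨0, fun h => absurd h hx⟩
  choose B0 hB0 using hB
  classical
  obtain ⟨B, hBd, hB1, hB2⟩ : ∃ B : Euc N → Euc N → ℝ, (∀ x, ContDiff ℝ (⊤ : ℕ∞) (B x)) ∧ (∀ x ∈ t, ∫⁻ y in Ω, ENNReal.ofReal ((B x y - v y) ^ 2) ≤ ENNReal.ofReal ε') ∧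
      ∀ x ∈ t, ∀ i, ∫⁻ y in Ω ∩ Metric.ball x (r x), ENNReal.ofReal ((fderiv ℝ (B x) y (bas N i) - g y i) ^ 2) ≤ ENNReal.ofReal ε' := by
    refine ⟨fun x => if x ∈ t then B0 x else 0, fun x => ?_, fun x hx => ?_, fun x hx => ?_⟩
    · by_cases hx : x ∈ t
      · simp only [hx, if_true]; exact (hB0 x hx).1
      · simp only [hx, if_false]; exact contDiff_const
    · simp only [hx, if_true]; exact (hB0 x hx).2.1
    · simp only [hx, if_true]; exact (hB0 x hx).2.2
  have hΩm := hΩ.1.measurableSet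
  have hgi : ∀ i, Measurable fun x => g x i := fun i => by
    have := hg.1
    fun_prop
  have hmD : ∀ (f : Euc N → ℝ), ContDiff ℝ (⊤ : ℕ∞) f → ∀ w, Measurable fun y => fderiv ℝ f y w := fun f hf w => by
    have := hf.continuous_fderiv (by simp)
    have h2 : Continuous fun y => fderiv ℝ f y w := this.clm_apply continuous_const
    exact h2.measurable
  have hφd : ContDiff ℝ (⊤ : ℕ∞) (fun y => ∑ x ∈ t, χ x y * B x y) := 
    ContDiff.sum fun x _ => (hχd x).mul (hBd x)
  refine ⟨fun y => ∑ x ∈ t, χ x y * B x y, hφd, ?_, ?_, ?_⟩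
  · apply HasCompactSupport.intro (K := ⋃ x ∈ t, Metric.closedBall x (r x))
    · exact t.finite_toSet.isCompact_biUnion fun x _ => isCompact_closedBall _ _
    · intro y hy
      apply Finset.sum_eq_zero
      intro x hx
      have : y ∉ tsupport (χ x) := fun h => hy (mem_iUnion₂.2 ⟨x, hx, Metric.ball_subset_closedBall (hχs x h)⟩)
      rw [image_eq_zero_of_notMem_tsupport this, zero_mul]
  · refine (lint_sum_sq volume Ω hΩm t (fun x y => χ x y * (B x y - v y)) ?_ _ ?_ ε' hε'0.le ?_).trans (ENNReal.ofReal_le_ofReal ?_)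
    · intro x
      exact (hχd x).continuous.measurable.mul ((hBd x).continuous.measurable.sub hvm)
    · intro y hy
      simp only [mul_sub, Finset.sum_sub_distrib, ← Finset.sum_mul, hχsum y (subset_closure hy), one_mul]
    · intro x hx
      refine le_trans (lintegral_mono fun y => ENNReal.ofReal_le_ofReal ?_) (hB1 x hx)
      rw [mul_pow]
      have := hχ1 x y
      have h2 : χ x y ^ 2 ≤ 1 := pow_le_one₀ this.1 this.2
      nlinarith [sq_nonneg (B x y - v y)]
    · refine le_trans ?_ hkey
      gcongr
      nlinarith [sq_nonneg D]
  · intro i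
    refine (lint_sum_sq volume Ω hΩm t (fun x y => fderiv ℝ (χ x) y (bas N i) * (B x y - v y) + χ x y * (fderiv ℝ (B x) y (bas N i) - g y i)) ?_ _ ?_ 
      ((2 * D ^ 2 + 2) * ε') (by positivity) ?_).trans (ENNReal.ofReal_le_ofReal hkey)
    · intro x
      exact ((hmD _ (hχd x) _).mul ((hBd x).continuous.measurable.sub hvm)).add ((hχd x).continuous.measurable.mul ((hmD _ (hBd x) _).sub (hgi i)))
    · intro y hy
      have d1 : ∀ x, DifferentiableAt ℝ (χ x) y := fun x => ((hχd x).differentiable (by simp)) y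
      have d2 : ∀ x, DifferentiableAt ℝ (B x) y := fun x => ((hBd x).differentiable (by simp)) y
      have hz : ∑ x ∈ t, fderiv ℝ (χ x) y (bas N i) = 0 := by
        have h1 : fderiv ℝ (fun z => ∑ x ∈ t, χ x z) y = 0 := by
          have : (fun z => ∑ x ∈ t, χ x z) =ᶠ[𝓝 y] fun _ => 1 := by
            filter_upwards [hΩ.1.mem_nhds hy] with z hz
            exact hχsum z (subset_closure hz)
          rw [this.fderiv_eq]; simp
        rw [fderiv_fun_sum (fun x _ => d1 x)] at h1
        have := congrArg (fun T : Euc N →L[ℝ] ℝ => T (bas N i)) h1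
        simpa using this
      have h2 : fderiv ℝ (fun z => ∑ x ∈ t, χ x z * B x z) y (bas N i) = ∑ x ∈ t, (χ x y * fderiv ℝ (B x) y (bas N i) + B x y * fderiv ℝ (χ x) y (bas N i)) := by
        have d3 : ∀ x ∈ t, DifferentiableAt ℝ (fun z => χ x z * B x z) y := fun x _ => (d1 x).mul (d2 x)
        rw [fderiv_fun_sum d3]
        rw [ContinuousLinearMap.sum_apply]
        apply Finset.sum_congr rfl
        intro x _
        rw [fderiv_fun_mul (d1 x) (d2 x)]
        simp
      rw [gradF_coord, h2]
      have h3 : ∀ x, fderiv ℝ (χ x) y (bas N i) * (B x y - v y) + χ x y * (fderiv ℝ (B x) y (bas N i) - g y i) 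
          = (χ x y * fderiv ℝ (B x) y (bas N i) + B x y * fderiv ℝ (χ x) y (bas N i)) - fderiv ℝ (χ x) y (bas N i) * v y - χ x y * g y i := fun x => by ring
      simp only [h3]
      rw [Finset.sum_sub_distrib, Finset.sum_sub_distrib, ← Finset.sum_mul, ← Finset.sum_mul, hz, hχsum y (subset_closure hy)]
      ring
    · intro x hx
      have hbi : ‖bas N i‖ = 1 := by simp [bas]
      calc ∫⁻ y in Ω, ENNReal.ofReal ((fderiv ℝ (χ x) y (bas N i) * (B x y - v y) + χ x y * (fderiv ℝ (B x) y (bas N i) - g y i)) ^ 2)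
          ≤ ∫⁻ y in Ω, (ENNReal.ofReal (2 * D ^ 2) * ENNReal.ofReal ((B x y - v y) ^ 2) + 
              ENNReal.ofReal 2 * (Metric.ball x (r x)).indicator (fun y => ENNReal.ofReal ((fderiv ℝ (B x) y (bas N i) - g y i) ^ 2)) y) := by
            apply lintegral_mono
            intro y
            have hd : (fderiv ℝ (χ x) y (bas N i)) ^ 2 ≤ D ^ 2 := by
              apply sq_le_sq'
              · have := (fderiv ℝ (χ x) y).le_opNorm (bas N i)
                rw [hbi, mul_one, Real.norm_eq_abs] at this
                have := (abs_le.1 this).1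
                linarith [hC2 x y, hD x hx]
              · have := (fderiv ℝ (χ x) y).le_opNorm (bas N i)
                rw [hbi, mul_one, Real.norm_eq_abs] at this
                have := (abs_le.1 this).2
                linarith [hC2 x y, hD x hx]
            by_cases hy : y ∈ Metric.ball x (r x)
            · simp only [indicator_of_mem hy]
              rw [← ENNReal.ofReal_mul (by positivity), ← ENNReal.ofReal_mul (by positivity), ← ENNReal.ofReal_add (by positivity) (by positivity)]
              apply ENNReal.ofReal_le_ofReal
              set a := fderiv ℝ (χ x) y (bas N i)
              set b := B x y - v y
              set c := χ x y
              set d := fderiv ℝ (B x) y (bas N i) - g y i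
              have hc : c ^ 2 ≤ 1 := pow_le_one₀ (hχ1 x y).1 (hχ1 x y).2
              have h1 : a ^ 2 * b ^ 2 ≤ D ^ 2 * b ^ 2 := by gcongr
              have h2 : c ^ 2 * d ^ 2 ≤ 1 * d ^ 2 := by gcongr
              nlinarith [sq_nonneg (a * b - c * d)]
            · simp only [indicator_of_notMem hy, mul_zero, add_zero]
              have : y ∉ tsupport (χ x) := fun h => hy (hχs x h)
              rw [image_eq_zero_of_notMem_tsupport this, zero_mul, add_zero, ← ENNReal.ofReal_mul (by positivity)]
              apply ENNReal.ofReal_le_ofReal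
              rw [mul_pow]
              have : (fderiv ℝ (χ x) y (bas N i)) ^ 2 * (B x y - v y) ^ 2 ≤ D ^ 2 * (B x y - v y) ^ 2 := by gcongr
              nlinarith [mul_nonneg (sq_nonneg D) (sq_nonneg (B x y - v y))]
        _ = ENNReal.ofReal (2 * D ^ 2) * (∫⁻ y in Ω, ENNReal.ofReal ((B x y - v y) ^ 2)) + 
              ENNReal.ofReal 2 * ∫⁻ y in Ω ∩ Metric.ball x (r x), ENNReal.ofReal ((fderiv ℝ (B x) y (bas N i) - g y i) ^ 2) := by
            rw [lintegral_add_left, lintegral_const_mul' _ _ ENNReal.ofReal_ne_top, lintegral_const_mul' _ _ ENNReal.ofReal_ne_top,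
              lintegral_indicator measurableSet_ball, Measure.restrict_restrict measurableSet_ball, inter_comm]
            exact ((((hBd x).continuous.measurable.sub hvm).pow_const 2).ennreal_ofReal).const_mul _
        _ ≤ ENNReal.ofReal (2 * D ^ 2) * ENNReal.ofReal ε' + ENNReal.ofReal 2 * ENNReal.ofReal ε' := by
            gcongr
            · exact hB1 x hx
            · exact hB2 x hx i
        _ = _ := by
            rw [← ENNReal.ofReal_mul (by positivity), ← ENNReal.ofReal_mul (by positivity), ← ENNReal.ofReal_add (by positivity) (by positivity)]
            congr 1; ring

/-- Density of smooth compactly supported functions in `H¹(Ω)`. -/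
lemma approx_seq (N : ℕ) (hN : 2 ≤ N) (Ω : Set (Euc N)) (hΩ : IsLipschitzDomain N Ω) (v : Euc N → ℝ) (hvm : Measurable v)
    (hv : MemLp v 2 (volume.restrict Ω)) (g : Euc N → Euc N) (hg : IsWeakGradient N Ω v g) :
    ∃ φ : ℕ → Euc N → ℝ, (∀ k, ContDiff ℝ (⊤ : ℕ∞) (φ k)) ∧ (∀ k, HasCompactSupport (φ k)) ∧ 
      Tendsto (fun k => ∫ x in Ω, (φ k x - v x) ^ 2) atTop (𝓝 0) ∧
      ∀ i, Tendsto (fun k => ∫ x in Ω, (gradF N (φ k) x i - g x i) ^ 2) atTop (𝓝 0) := by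
  choose φ h1 h2 h3 h4 using fun k : ℕ => approx_lint N hN Ω hΩ v hvm hv g hg (1 / ((k:ℝ) + 1)) (by positivity)
  have hgi : ∀ i, Measurable fun x => g x i := fun i => by
    have := hg.1
    fun_prop
  refine ⟨φ, h1, h2, ?_, fun i => ?_⟩
  · refine squeeze_zero (fun k => integral_nonneg fun x => sq_nonneg _) (fun k => ?_) tendsto_one_div_add_atTop_nhds_zero_nat
    have hms : Measurable fun x => (φ k x - v x) ^ 2 := ((h1 k).continuous.measurable.sub hvm).pow_const 2
    rw [integral_eq_lintegral_of_nonneg_ae (ae_of_all _ fun x => sq_nonneg _) hms.aestronglyMeasurable]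
    exact ENNReal.toReal_le_of_le_ofReal (by positivity) (h3 k)
  · refine squeeze_zero (fun k => integral_nonneg fun x => sq_nonneg _) (fun k => ?_) tendsto_one_div_add_atTop_nhds_zero_nat
    have hm : Measurable fun x => gradF N (φ k) x i := by
      have := (gradF_continuous N (φ k) (h1 k)).measurable
      fun_prop
    have hms : Measurable fun x => (gradF N (φ k) x i - g x i) ^ 2 := (hm.sub (hgi i)).pow_const 2
    rw [integral_eq_lintegral_of_nonneg_ae (ae_of_all _ fun x => sq_nonneg _) hms.aestronglyMeasurable]
    exact ENNReal.toReal_le_of_le_ofReal (by positivity) (h4 k i)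


lemma integrable_inner_of {α F : Type*} [MeasurableSpace α] {μ : Measure α} [NormedAddCommGroup F] [InnerProductSpace ℝ F]
    {f g : α → F} (hf : MemLp f 2 μ) (hg : MemLp g 2 μ) : Integrable (fun x => (inner ℝ (f x) (g x) : ℝ)) μ := by
  have h := L2.integrable_inner (𝕜 := ℝ) (hf.toLp f) (hg.toLp g)
  refine h.congr ?_
  filter_upwards [hf.coeFn_toLp, hg.coeFn_toLp] with x h1 h2
  rw [h1, h2]

lemma quad_expand {α F : Type*} [MeasurableSpace α] {μ : Measure α} [NormedAddCommGroup F] [InnerProductSpace ℝ F]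
    {n : ℕ} (f : Fin n → α → F) (hf : ∀ i, MemLp (f i) 2 μ) (a : Fin n → ℝ) :
    ∫ x, ‖∑ i, a i • f i x‖ ^ 2 ∂μ = ∑ i, ∑ j, a i * a j * ∫ x, (inner ℝ (f i x) (f j x) : ℝ) ∂μ := by
  have h1 : ∀ x, ‖∑ i, a i • f i x‖ ^ 2 = ∑ i, ∑ j, a i * a j * (inner ℝ (f i x) (f j x) : ℝ) := by
    intro x
    rw [← real_inner_self_eq_norm_sq, sum_inner]
    apply Finset.sum_congr rfl
    intro i _
    rw [inner_sum]
    apply Finset.sum_congr rfl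
    intro j _
    rw [real_inner_smul_left, real_inner_smul_right]; ring
  have hi : ∀ i j, Integrable (fun x => a i * a j * (inner ℝ (f i x) (f j x) : ℝ)) μ := fun i j => 
    (integrable_inner_of (hf i) (hf j)).const_mul _
  simp_rw [h1]
  rw [integral_finsetSum _ (fun i _ => integrable_finsetSum _ fun j _ => hi i j)]
  apply Finset.sum_congr rfl
  intro i _
  rw [integral_finsetSum _ (fun j _ => hi i j)]
  apply Finset.sum_congr rfl
  intro j _
  rw [integral_const_mul]

lemma quad_expand_real {α : Type*} [MeasurableSpace α] {μ : Measure α} 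
    {n : ℕ} (f : Fin n → α → ℝ) (hf : ∀ i, MemLp (f i) 2 μ) (a : Fin n → ℝ) :
    ∫ x, (∑ i, a i * f i x) ^ 2 ∂μ = ∑ i, ∑ j, a i * a j * ∫ x, f i x * f j x ∂μ := by
  have := quad_expand f hf a
  simp only [Real.norm_eq_abs, sq_abs, smul_eq_mul] at this
  rw [this]
  apply Finset.sum_congr rfl
  intro i _
  apply Finset.sum_congr rfl
  intro j _
  congr 2; ext x
  simp [mul_comm]

def Tq (N : ℕ) (s : ℝ) (u : Euc N → ℝ) (q : Euc N × Euc N) : ℝ := (u q.1 - u q.2) * Real.sqrt ((kern N s q.1 q.2)⁻¹)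

lemma kern_nonneg (N : ℕ) (s : ℝ) (x y : Euc N) : 0 ≤ kern N s x y := Real.rpow_nonneg (norm_nonneg _) _

lemma Tq_mul (N : ℕ) (s : ℝ) (u v : Euc N → ℝ) (q : Euc N × Euc N) : 
    Tq N s u q * Tq N s v q = (u q.1 - u q.2) * (v q.1 - v q.2) / kern N s q.1 q.2 := by
  unfold Tq
  have := Real.mul_self_sqrt (inv_nonneg.2 (kern_nonneg N s q.1 q.2))
  calc _ = (u q.1 - u q.2) * (v q.1 - v q.2) * (Real.sqrt ((kern N s q.1 q.2)⁻¹) * Real.sqrt ((kern N s q.1 q.2)⁻¹)) := by ring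
    _ = _ := by rw [this, div_eq_mul_inv]

lemma Tq_sq (N : ℕ) (s : ℝ) (u : Euc N → ℝ) (q : Euc N × Euc N) : 
    (Tq N s u q) ^ 2 = (u q.1 - u q.2) ^ 2 / kern N s q.1 q.2 := by
  rw [sq, Tq_mul, sq]

lemma Tq_measurable (N : ℕ) (s : ℝ) (u : Euc N → ℝ) (hu : Measurable u) : Measurable (Tq N s u) := by
  unfold Tq
  have h := measurable_kern N s
  have : Measurable fun q : Euc N × Euc N => kern N s q.1 q.2 := h
  exact ((hu.comp measurable_fst).sub (hu.comp measurable_snd)).mul this.inv.sqrt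

lemma semiSq_Tq (N : ℕ) (s : ℝ) (Ω : Set (Euc N)) (u : Euc N → ℝ) : 
    semiSq N s Ω u = ∫⁻ q in reg N Ω, ENNReal.ofReal ((Tq N s u q) ^ 2) := by
  unfold semiSq; simp_rw [Tq_sq]

lemma bform_Tq (N : ℕ) (s : ℝ) (Ω : Set (Euc N)) (u v : Euc N → ℝ) : 
    bform N s Ω u v = ∫ q in reg N Ω, Tq N s u q * Tq N s v q := by
  unfold bform; simp_rw [Tq_mul]

lemma memLp_of_lint {α : Type*} [MeasurableSpace α] {μ : Measure α} {f : α → ℝ} (hf : Measurable f) 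
    (h : ∫⁻ x, ENNReal.ofReal ((f x) ^ 2) ∂μ < ⊤) : MemLp f 2 μ := by
  rw [memLp_two_iff_integrable_sq hf.aestronglyMeasurable]
  refine ⟨(hf.pow_const 2).aestronglyMeasurable, ?_⟩
  rw [hasFiniteIntegral_iff_ofReal (ae_of_all _ fun x => sq_nonneg _)]
  exact h

lemma lint_eq_of {α : Type*} [MeasurableSpace α] {μ : Measure α} {f : α → ℝ} (h : MemLp f 2 μ) :
    ∫⁻ x, ENNReal.ofReal ((f x) ^ 2) ∂μ = ENNReal.ofReal (∫ x, (f x) ^ 2 ∂μ) := by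
  rw [ofReal_integral_eq_lintegral_ofReal ((memLp_two_iff_integrable_sq h.1).1 h) (ae_of_all _ fun x => sq_nonneg _)]

lemma Tq_memLp {N : ℕ} {s : ℝ} {Ω : Set (Euc N)} {u : Euc N → ℝ} (h : memHs N s Ω u) : 
    MemLp (Tq N s u) 2 (volume.restrict (reg N Ω)) := 
  memLp_of_lint (Tq_measurable N s u h.1) (by rw [← semiSq_Tq]; exact h.2.2)

lemma semiSq_toReal {N : ℕ} {s : ℝ} {Ω : Set (Euc N)} {u : Euc N → ℝ} (h : memHs N s Ω u) : 
    (semiSq N s Ω u).toReal = ∫ q in reg N Ω, (Tq N s u q) ^ 2 := by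
  rw [semiSq_Tq, lint_eq_of (Tq_memLp h), ENNReal.toReal_ofReal (integral_nonneg fun x => sq_nonneg _)]

lemma bform_self {N : ℕ} {s : ℝ} {Ω : Set (Euc N)} {u : Euc N → ℝ} (h : memHs N s Ω u) : 
    bform N s Ω u u = (semiSq N s Ω u).toReal := by
  rw [semiSq_toReal h, bform_Tq]
  simp_rw [sq]

lemma Tq_comb (N : ℕ) (s : ℝ) {n : ℕ} (ψ : Fin n → Euc N → ℝ) (a : Fin n → ℝ) (q) : 
    Tq N s (∑ i, a i • ψ i) q = ∑ i, a i * Tq N s (ψ i) q := by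
  unfold Tq
  simp only [Finset.sum_apply, Pi.smul_apply, smul_eq_mul]
  rw [← Finset.sum_sub_distrib, Finset.sum_mul]
  apply Finset.sum_congr rfl
  intro i _; ring

lemma memHs_of {N : ℕ} {s : ℝ} {Ω : Set (Euc N)} {u : Euc N → ℝ} (hu : Measurable u) 
    (h1 : MemLp u 2 (volume.restrict Ω)) (h2 : MemLp (Tq N s u) 2 (volume.restrict (reg N Ω))) : memHs N s Ω u := by
  refine ⟨hu, ?_, ?_⟩
  · exact l2sq_lt_top h1
  · rw [semiSq_Tq, lint_eq_of h2]
    exact ENNReal.ofReal_lt_top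

lemma memHs_memLp {N : ℕ} {s : ℝ} {Ω : Set (Euc N)} {u : Euc N → ℝ} (h : memHs N s Ω u) : MemLp u 2 (volume.restrict Ω) := 
  memL2_of h.1 h.2.1

lemma comb_measurable {N : ℕ} {n : ℕ} {ψ : Fin n → Euc N → ℝ} (hψ : ∀ i, Measurable (ψ i)) (a : Fin n → ℝ) :
    Measurable (∑ i, a i • ψ i) := by
  have : (∑ i, a i • ψ i) = fun x => ∑ i, (a i • ψ i) x := by ext x; simp
  rw [this]
  exact Finset.measurable_sum _ fun i _ => (hψ i).const_smul (a i)

lemma comb_memLp {α F : Type*} [MeasurableSpace α] {μ : Measure α} [NormedAddCommGroup F] [NormedSpace ℝ F] {n : ℕ} {ψ : Fin n → α → F} 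
    (hψ : ∀ i, MemLp (ψ i) 2 μ) (a : Fin n → ℝ) : MemLp (∑ i, a i • ψ i) 2 μ := 
  memLp_finsetSum' _ fun i _ => (hψ i).const_smul (a i)

lemma memHs_comb {N : ℕ} {s : ℝ} {Ω : Set (Euc N)} {n : ℕ} {ψ : Fin n → Euc N → ℝ} (hψ : ∀ i, memHs N s Ω (ψ i)) (a : Fin n → ℝ) :
    memHs N s Ω (∑ i, a i • ψ i) := by
  refine memHs_of (comb_measurable (fun i => (hψ i).1) a) (comb_memLp (fun i => memHs_memLp (hψ i)) a) ?_
  have : Tq N s (∑ i, a i • ψ i) = ∑ i, a i • Tq N s (ψ i) := by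
    ext q; rw [Tq_comb]; simp
  rw [this]
  exact comb_memLp (fun i => Tq_memLp (hψ i)) a

lemma semi_comb {N : ℕ} {s : ℝ} {Ω : Set (Euc N)} {n : ℕ} {ψ : Fin n → Euc N → ℝ} (hψ : ∀ i, memHs N s Ω (ψ i)) (a : Fin n → ℝ) :
    (semiSq N s Ω (∑ i, a i • ψ i)).toReal = ∑ i, ∑ j, a i * a j * bform N s Ω (ψ i) (ψ j) := by
  rw [semiSq_toReal (memHs_comb hψ a)]
  simp_rw [Tq_comb, bform_Tq]
  exact quad_expand_real _ (fun i => Tq_memLp (hψ i)) a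

lemma l2_comb {N : ℕ} {Ω : Set (Euc N)} {n : ℕ} {ψ : Fin n → Euc N → ℝ} (hψ : ∀ i, MemLp (ψ i) 2 (volume.restrict Ω)) (a : Fin n → ℝ) :
    ∫ x in Ω, ((∑ i, a i • ψ i) x) ^ 2 = ∑ i, ∑ j, a i * a j * ∫ x in Ω, ψ i x * ψ j x := by
  simp only [Finset.sum_apply, Pi.smul_apply, smul_eq_mul]
  exact quad_expand_real _ hψ a

lemma grad_comb {N : ℕ} {Ω : Set (Euc N)} {n : ℕ} {g : Fin n → Euc N → Euc N} (hg : ∀ i, MemLp (g i) 2 (volume.restrict Ω)) (a : Fin n → ℝ) :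
    ∫ x in Ω, ‖(∑ i, a i • g i) x‖ ^ 2 = ∑ i, ∑ j, a i * a j * ∫ x in Ω, (inner ℝ (g i x) (g j x) : ℝ) := by
  simp only [Finset.sum_apply, Pi.smul_apply]
  exact quad_expand _ hg a

lemma mean_comb {N : ℕ} {Ω : Set (Euc N)} {n : ℕ} {ψ : Fin n → Euc N → ℝ} (hψ : ∀ i, Integrable (ψ i) (volume.restrict Ω))
    (h0 : ∀ i, ∫ x in Ω, ψ i x = 0) (a : Fin n → ℝ) : ∫ x in Ω, (∑ i, a i • ψ i) x = 0 := by
  simp only [Finset.sum_apply, Pi.smul_apply, smul_eq_mul]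
  rw [integral_finsetSum _ fun i _ => (hψ i).const_mul _]
  apply Finset.sum_eq_zero
  intro i _
  rw [integral_const_mul, h0, mul_zero]

lemma mat_bound {n : ℕ} (X : Fin n → Fin n → ℝ) (a : Fin n → ℝ) : 
    |∑ i, ∑ j, a i * a j * X i j| ≤ (∑ i, ∑ j, |X i j|) * ∑ i, (a i) ^ 2 := by
  refine (Finset.abs_sum_le_sum_abs _ _).trans ?_
  rw [Finset.sum_mul]
  apply Finset.sum_le_sum
  intro i _
  refine (Finset.abs_sum_le_sum_abs _ _).trans ?_
  rw [Finset.sum_mul]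
  apply Finset.sum_le_sum
  intro j _
  rw [abs_mul, mul_comm]
  gcongr
  have h1 : (a i) ^ 2 ≤ ∑ i, (a i) ^ 2 := Finset.single_le_sum (f := fun i => (a i) ^ 2) (fun i _ => sq_nonneg _) (Finset.mem_univ i)
  have h2 : (a j) ^ 2 ≤ ∑ i, (a i) ^ 2 := Finset.single_le_sum (f := fun i => (a i) ^ 2) (fun i _ => sq_nonneg _) (Finset.mem_univ j)
  rw [abs_le]
  constructor <;> nlinarith [sq_nonneg (a i - a j), sq_nonneg (a i + a j)]

lemma mat_pos {n : ℕ} (X : ℕ → Fin n → Fin n → ℝ) (Y : Fin n → Fin n → ℝ) (hX : ∀ i j, Tendsto (fun k => X k i j) atTop (𝓝 (Y i j)))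
    (c c' : ℝ) (hc : c' < c) (hY : ∀ a : Fin n → ℝ, c * ∑ i, (a i) ^ 2 ≤ ∑ i, ∑ j, a i * a j * Y i j) :
    ∀ᶠ k in atTop, ∀ a : Fin n → ℝ, c' * ∑ i, (a i) ^ 2 ≤ ∑ i, ∑ j, a i * a j * X k i j := by
  have h1 : Tendsto (fun k => ∑ i, ∑ j, |X k i j - Y i j|) atTop (𝓝 0) := by
    have : Tendsto (fun k => ∑ i, ∑ j, |X k i j - Y i j|) atTop (𝓝 (∑ i : Fin n, ∑ j : Fin n, |Y i j - Y i j|)) := 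
      tendsto_finsetSum _ fun i _ => tendsto_finsetSum _ fun j _ => ((hX i j).sub tendsto_const_nhds).abs
    simpa using this
  filter_upwards [h1.eventually_lt_const (sub_pos.2 hc)] with k hk a
  have h2 := (abs_le.1 (mat_bound (fun i j => X k i j - Y i j) a)).1
  have h3 : ∑ i, ∑ j, a i * a j * (X k i j - Y i j) = ∑ i, ∑ j, a i * a j * X k i j - ∑ i, ∑ j, a i * a j * Y i j := by
    simp only [mul_sub, Finset.sum_sub_distrib]
  rw [h3] at h2
  have h4 : 0 ≤ ∑ i, (a i) ^ 2 := Finset.sum_nonneg fun i _ => sq_nonneg _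
  have := hY a
  nlinarith [mul_le_mul_of_nonneg_right hk.le h4]


lemma span_facts {N n : ℕ} {Ω : Set (Euc N)} (ψ : Fin n → Euc N → ℝ)
    (hpos : ∀ a : Fin n → ℝ, a ≠ 0 → 0 < ∫ x in Ω, ((∑ i, a i • ψ i) x) ^ 2) :
    Module.finrank ℝ (Submodule.span ℝ (range ψ)) = n ∧ 
    (∀ u ∈ Submodule.span ℝ (range ψ), ∃ a : Fin n → ℝ, ∑ i, a i • ψ i = u) ∧ 
    (∀ u ∈ Submodule.span ℝ (range ψ), u =ᵐ[volume.restrict Ω] 0 → u = 0) := by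
  have hex : ∀ u ∈ Submodule.span ℝ (range ψ), ∃ a : Fin n → ℝ, ∑ i, a i • ψ i = u := fun u hu => 
    (Submodule.mem_span_range_iff_exists_fun ℝ).1 hu
  refine ⟨?_, hex, ?_⟩
  · have hli : LinearIndependent ℝ ψ := by
      rw [Fintype.linearIndependent_iff]
      intro a ha
      by_contra hne
      push Not at hne
      obtain ⟨i, hi⟩ := hne
      have := hpos a (fun h => hi (by rw [h]; rfl))
      rw [ha] at this
      simp at this
    rw [finrank_span_eq_card hli, Fintype.card_fin]
  · intro u hu h0
    obtain ⟨a, rfl⟩ := hex u hu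
    by_cases ha : a = 0
    · simp [ha]
    · exfalso
      have h1 := hpos a ha
      have : ∫ x in Ω, ((∑ i, a i • ψ i) x) ^ 2 = 0 := by
        rw [integral_eq_zero_of_ae]
        filter_upwards [h0] with x hx
        rw [hx]; simp
      linarith

lemma ae_restrict_of_volume {N : ℕ} {Ω : Set (Euc N)} {u : Euc N → ℝ} (h : u =ᵐ[(volume : Measure (Euc N))] 0) : u =ᵐ[volume.restrict Ω] 0 := 
  ae_restrict_of_ae h

lemma muNs_le {N n : ℕ} {Ω : Set (Euc N)} (hfin : volume Ω ≠ ⊤) {s : ℝ} (hs : s ∈ Ioo (0:ℝ) 1) (ψ : Fin n → Euc N → ℝ) (hψ : ∀ i, memHs N s Ω (ψ i)) 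
    (h0 : ∀ i, ∫ x in Ω, ψ i x = 0) (K : ℝ)
    (hpos : ∀ a : Fin n → ℝ, a ≠ 0 → 0 < ∫ x in Ω, ((∑ i, a i • ψ i) x) ^ 2)
    (hK : ∀ a : Fin n → ℝ, cNs N s / 2 * (semiSq N s Ω (∑ i, a i • ψ i)).toReal ≤ K * ∫ x in Ω, ((∑ i, a i • ψ i) x) ^ 2) :
    muNs N s Ω n ≤ ENNReal.ofReal K := by
  haveI : IsFiniteMeasure (volume.restrict Ω) := ⟨by rw [Measure.restrict_apply_univ]; exact hfin.lt_top⟩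
  obtain ⟨hf, hex, hz⟩ := span_facts ψ hpos
  unfold muNs
  refine iInf₂_le_of_le (Submodule.span ℝ (range ψ)) ⟨hf, ?_, ?_⟩ ?_
  · intro u hu
    obtain ⟨a, rfl⟩ := hex u hu
    exact ⟨memHs_comb hψ a, mean_comb (fun i => (memHs_memLp (hψ i)).integrable (by norm_num)) h0 a⟩
  · intro u hu h
    exact hz u hu (ae_restrict_of_volume h)
  · refine iSup₂_le ?_
    rintro u ⟨hu, hne⟩
    obtain ⟨a, rfl⟩ := hex u hu
    have ha : a ≠ 0 := fun h => hne (by simp [h])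
    have hp := hpos a ha
    have hm := memHs_comb hψ a
    unfold rayleighS
    rw [l2sq_eq (memHs_memLp hm), ← ENNReal.ofReal_toReal hm.2.2.ne, ← ENNReal.ofReal_mul (by have := cNs_pos N s hs; positivity),
      ← ENNReal.ofReal_div_of_pos hp]
    apply ENNReal.ofReal_le_ofReal
    rw [div_le_iff₀ hp]
    exact hK a

lemma lint_norm_eq {α F : Type*} [MeasurableSpace α] {μ : Measure α} [NormedAddCommGroup F] {f : α → F} (h : MemLp f 2 μ) :
    ∫⁻ x, ENNReal.ofReal (‖f x‖ ^ 2) ∂μ = ENNReal.ofReal (∫ x, ‖f x‖ ^ 2 ∂μ) := lint_eq_of h.norm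

lemma gradSq_eq {N : ℕ} {Ω : Set (Euc N)} (hΩ : IsOpen Ω) (hfin : volume Ω ≠ ⊤) {u : Euc N → ℝ} {g : Euc N → Euc N} (h : IsWeakGradient N Ω u g) :
    gradSq N Ω u = ENNReal.ofReal (∫ x in Ω, ‖g x‖ ^ 2) := by
  unfold gradSq
  rw [← lint_norm_eq (weakGrad_memLp h)]
  apply le_antisymm
  · exact iInf₂_le g h
  · refine le_iInf₂ fun g' h' => le_of_eq ?_
    apply lintegral_congr_ae
    filter_upwards [weakGrad_unique hΩ hfin h h'] with x hx
    rw [hx]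

lemma muN1_le {N n : ℕ} {Ω : Set (Euc N)} (hΩ : IsOpen Ω) (hfin : volume Ω ≠ ⊤) (ψ : Fin n → Euc N → ℝ) (g : Fin n → Euc N → Euc N) 
    (hm : ∀ i, Measurable (ψ i)) (hψ : ∀ i, MemLp (ψ i) 2 (volume.restrict Ω)) (hg : ∀ i, IsWeakGradient N Ω (ψ i) (g i))
    (h0 : ∀ i, ∫ x in Ω, ψ i x = 0) (K : ℝ)
    (hpos : ∀ a : Fin n → ℝ, a ≠ 0 → 0 < ∫ x in Ω, ((∑ i, a i • ψ i) x) ^ 2)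
    (hK : ∀ a : Fin n → ℝ, ∫ x in Ω, ‖(∑ i, a i • g i) x‖ ^ 2 ≤ K * ∫ x in Ω, ((∑ i, a i • ψ i) x) ^ 2) :
    muN1 N Ω n ≤ ENNReal.ofReal K := by
  haveI : IsFiniteMeasure (volume.restrict Ω) := ⟨by rw [Measure.restrict_apply_univ]; exact hfin.lt_top⟩
  obtain ⟨hf, hex, hz⟩ := span_facts ψ hpos
  unfold muN1
  refine iInf₂_le_of_le (Submodule.span ℝ (range ψ)) ⟨hf, ?_, hz⟩ ?_
  · intro u hu
    obtain ⟨a, rfl⟩ := hex u hu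
    exact ⟨⟨comb_measurable hm a, l2sq_lt_top (comb_memLp hψ a), _, weakGrad_comb hfin ψ g hψ hg a⟩, 
      mean_comb (fun i => (hψ i).integrable (by norm_num)) h0 a⟩
  · refine iSup₂_le ?_
    rintro u ⟨hu, hne⟩
    obtain ⟨a, rfl⟩ := hex u hu
    have ha : a ≠ 0 := fun h => hne (by simp [h])
    have hp := hpos a ha
    unfold rayleigh1
    rw [l2sq_eq (comb_memLp hψ a), gradSq_eq hΩ hfin (weakGrad_comb hfin ψ g hψ hg a), ← ENNReal.ofReal_div_of_pos hp]
    apply ENNReal.ofReal_le_ofReal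
    rw [div_le_iff₀ hp]
    exact hK a

lemma extract_ortho {N n : ℕ} (hn : 1 ≤ n) {Ω : Set (Euc N)} (A : Submodule ℝ (Euc N → ℝ)) (hA : Module.finrank ℝ A = n)
    (hL : ∀ u ∈ A, MemLp u 2 (volume.restrict Ω)) (hz : ∀ u ∈ A, u =ᵐ[volume.restrict Ω] 0 → u = 0) :
    ∃ ψ : Fin n → Euc N → ℝ, (∀ i, ψ i ∈ A) ∧ ∀ a : Fin n → ℝ, ∫ x in Ω, ((∑ i, a i • ψ i) x) ^ 2 = ∑ i, (a i) ^ 2 := by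
  haveI : Module.Finite ℝ A := Module.finite_of_finrank_pos (by omega)
  let L : A →ₗ[ℝ] Lp ℝ 2 (volume.restrict Ω) := 
    { toFun := fun u => (hL u.1 u.2).toLp u.1
      map_add' := fun u v => MemLp.toLp_add (hL u.1 u.2) (hL v.1 v.2)
      map_smul' := fun c u => MemLp.toLp_const_smul c (hL u.1 u.2) }
  have hLdef : ∀ u : A, L u = (hL u.1 u.2).toLp u.1 := fun u => rfl
  have hinj : Function.Injective L := by
    rw [← LinearMap.ker_eq_bot, LinearMap.ker_eq_bot']
    intro u hu
    have h1 := (hL u.1 u.2).coeFn_toLp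
    rw [← hLdef, hu] at h1
    have h2 := hz u.1 u.2 (h1.symm.trans (Lp.coeFn_zero _ _ _))
    exact Subtype.ext h2
  let e := LinearEquiv.ofInjective L hinj
  have hfr : Module.finrank ℝ (LinearMap.range L) = n := by rw [← hA]; exact (LinearEquiv.finrank_eq e).symm
  haveI : FiniteDimensional ℝ (LinearMap.range L) := inferInstance
  let b := (stdOrthonormalBasis ℝ (LinearMap.range L)).reindex (finCongr hfr)
  refine ⟨fun i => (e.symm (b i)).1, fun i => (e.symm (b i)).2, fun a => ?_⟩
  have hsum : (∑ i, a i • (e.symm (b i)).1) = (e.symm (∑ i, a i • b i)).1 := by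
    rw [map_sum]
    simp
  rw [hsum]
  set w := e.symm (∑ i, a i • b i) with hw
  have h1 : L w = ((∑ i, a i • b i : LinearMap.range L) : Lp ℝ 2 (volume.restrict Ω)) := by
    have : e w = ∑ i, a i • b i := by rw [hw, LinearEquiv.apply_symm_apply]
    rw [← this]; rfl
  have h2 : ‖L w‖ ^ 2 = ∑ i, (a i) ^ 2 := by
    rw [h1, ← Submodule.coe_norm, ← real_inner_self_eq_norm_sq, b.orthonormal.inner_sum]
    apply Finset.sum_congr rfl
    intro i _
    simp [sq]
  rw [← h2, hLdef, norm_sq_toLp]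

lemma extract_N1 {N n : ℕ} (hn : 1 ≤ n) {Ω : Set (Euc N)} (hΩ : IsOpen Ω) (hfin : volume Ω ≠ ⊤) (K : ℝ) (hK : muN1 N Ω n < ENNReal.ofReal K) :
    ∃ (ψ : Fin n → Euc N → ℝ) (g : Fin n → Euc N → Euc N), (∀ i, Measurable (ψ i)) ∧ (∀ i, MemLp (ψ i) 2 (volume.restrict Ω)) ∧
      (∀ i, IsWeakGradient N Ω (ψ i) (g i)) ∧ (∀ i, ∫ x in Ω, ψ i x = 0) ∧ 
      (∀ a : Fin n → ℝ, ∫ x in Ω, ((∑ i, a i • ψ i) x) ^ 2 = ∑ i, (a i) ^ 2) ∧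
      ∀ a : Fin n → ℝ, ∫ x in Ω, ‖(∑ i, a i • g i) x‖ ^ 2 ≤ K * ∑ i, (a i) ^ 2 := by
  unfold muN1 at hK
  obtain ⟨A, hA⟩ := iInf_lt_iff.1 hK
  obtain ⟨⟨hA1, hA2, hA3⟩, hA4⟩ := iInf_lt_iff.1 hA
  have hL : ∀ u ∈ A, MemLp u 2 (volume.restrict Ω) := fun u hu => memL2_of (hA2 u hu).1.1 (hA2 u hu).1.2.1
  obtain ⟨ψ, hψA, hψ⟩ := extract_ortho hn A hA1 hL hA3
  choose g hg using fun i => (hA2 _ (hψA i)).1.2.2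
  refine ⟨ψ, g, fun i => (hA2 _ (hψA i)).1.1, fun i => hL _ (hψA i), hg, fun i => (hA2 _ (hψA i)).2, hψ, fun a => ?_⟩
  by_cases ha : ∑ i, (a i) ^ 2 = 0
  · have ha0 : a = 0 := by
      ext i
      have := (Finset.sum_eq_zero_iff_of_nonneg (fun i _ => sq_nonneg (a i))).1 ha i (Finset.mem_univ i)
      simpa using this
    simp [ha0]
  have hp : 0 < ∑ i, (a i) ^ 2 := lt_of_le_of_ne (Finset.sum_nonneg fun i _ => sq_nonneg _) (Ne.symm ha)
  have hmem : (∑ i, a i • ψ i) ∈ A := A.sum_mem fun i _ => A.smul_mem _ (hψA i)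
  have hne : (∑ i, a i • ψ i) ≠ 0 := by
    intro h
    have := hψ a
    rw [h] at this
    simp at this
    exact ha this.symm
  have h1 : rayleigh1 N Ω (∑ i, a i • ψ i) < ENNReal.ofReal K := 
    lt_of_le_of_lt (le_iSup₂ (f := fun (u : Euc N → ℝ) (_ : u ∈ A ∧ u ≠ 0) => rayleigh1 N Ω u) _ ⟨hmem, hne⟩) hA4
  unfold rayleigh1 at h1
  rw [l2sq_eq (hL _ hmem), hψ a, gradSq_eq hΩ hfin (weakGrad_comb hfin ψ g (fun i => hL _ (hψA i)) hg a), ← ENNReal.ofReal_div_of_pos hp] at h1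
  have h2 := (ENNReal.ofReal_lt_ofReal_iff'.1 h1).1
  rw [div_lt_iff₀ hp] at h2
  exact h2.le

set_option maxHeartbeats 1000000 in
lemma ae_zero_of {N : ℕ} (hN : 2 ≤ N) {s : ℝ} {Ω : Set (Euc N)} (hΩ : IsOpen Ω) (hne : Ω.Nonempty) {u : Euc N → ℝ} (hu : Measurable u)
    (h0 : u =ᵐ[volume.restrict Ω] 0) (hs : semiSq N s Ω u = 0) : u =ᵐ[(volume : Measure (Euc N))] 0 := by
  haveI : Nontrivial (Euc N) := by
    haveI : Nonempty (Fin N) := ⟨⟨0, by omega⟩⟩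
    infer_instance
  have hm : Measurable fun q : Euc N × Euc N => ENNReal.ofReal ((u q.1 - u q.2) ^ 2 / kern N s q.1 q.2) := by
    have := (Tq_measurable N s u hu).pow_const 2
    simp_rw [Tq_sq] at this
    exact this.ennreal_ofReal
  unfold semiSq at hs
  have h1 : ∫⁻ q in Ω ×ˢ (univ : Set (Euc N)), ENNReal.ofReal ((u q.1 - u q.2) ^ 2 / kern N s q.1 q.2) = 0 := by
    apply le_antisymm _ zero_le
    rw [← hs]
    apply lintegral_mono_set
    rintro q ⟨hq, _⟩
    exact Or.inl (subset_closure hq)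
  rw [Measure.volume_eq_prod, ← Measure.prod_restrict, Measure.restrict_univ, lintegral_prod _ hm.aemeasurable, 
    lintegral_eq_zero_iff hm.lintegral_prod_right'] at h1
  have hne0 : (volume.restrict Ω) ≠ 0 := by
    rw [Ne, Measure.restrict_eq_zero]
    exact (hΩ.measure_pos _ hne).ne'
  haveI : NeBot (ae (volume.restrict Ω)) := ae_neBot.2 hne0
  obtain ⟨x, hx1, hx2⟩ := (h1.and h0).exists
  have hx1 : ∫⁻ y, ENNReal.ofReal ((u x - u y) ^ 2 / kern N s x y) = 0 := hx1
  have hx2 : u x = 0 := hx2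
  have hmx : Measurable fun y => ENNReal.ofReal ((u x - u y) ^ 2 / kern N s x y) := hm.comp (measurable_const.prodMk measurable_id)
  rw [lintegral_eq_zero_iff hmx] at hx1
  have hxx : ∀ᵐ y ∂(volume : Measure (Euc N)), y ≠ x := by
    rw [ae_iff]; simp
  filter_upwards [hx1, hxx] with y hy hyx
  have hy : ENNReal.ofReal ((u x - u y) ^ 2 / kern N s x y) = 0 := hy
  rw [ENNReal.ofReal_eq_zero] at hy
  have hk : 0 < kern N s x y := Real.rpow_pos_of_pos (norm_pos_iff.2 (sub_ne_zero.2 hyx.symm)) _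
  rw [div_le_iff₀ hk, zero_mul, hx2] at hy
  have : u y = 0 := by nlinarith [sq_nonneg (u y)]
  simpa using this

lemma extract_Ns {N n : ℕ} (hN : 2 ≤ N) (hn : 1 ≤ n) {s : ℝ} (hs : s ∈ Ioo (0:ℝ) 1) {Ω : Set (Euc N)} (hΩ : IsOpen Ω) (hΩne : Ω.Nonempty) (K : ℝ) 
    (hK : muNs N s Ω n < ENNReal.ofReal K) :
    ∃ (ψ : Fin n → Euc N → ℝ), (∀ i, memHs N s Ω (ψ i)) ∧ (∀ i, ∫ x in Ω, ψ i x = 0) ∧ 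
      (∀ a : Fin n → ℝ, ∫ x in Ω, ((∑ i, a i • ψ i) x) ^ 2 = ∑ i, (a i) ^ 2) ∧
      ∀ a : Fin n → ℝ, cNs N s / 2 * (semiSq N s Ω (∑ i, a i • ψ i)).toReal ≤ K * ∑ i, (a i) ^ 2 := by
  unfold muNs at hK
  obtain ⟨A, hA⟩ := iInf_lt_iff.1 hK
  obtain ⟨⟨hA1, hA2, hA3⟩, hA4⟩ := iInf_lt_iff.1 hA
  have hray : ∀ u ∈ A, u ≠ 0 → rayleighS N s Ω u < ENNReal.ofReal K := fun u hu hne => 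
    lt_of_le_of_lt (le_iSup₂ (f := fun (u : Euc N → ℝ) (_ : u ∈ A ∧ u ≠ 0) => rayleighS N s Ω u) _ ⟨hu, hne⟩) hA4
  have hL : ∀ u ∈ A, MemLp u 2 (volume.restrict Ω) := fun u hu => memHs_memLp (hA2 u hu).1
  have hc := cNs_pos N s hs
  have hz : ∀ u ∈ A, u =ᵐ[volume.restrict Ω] 0 → u = 0 := by
    intro u hu h0
    by_contra hne
    have h1 := hray u hu hne
    have hl : l2sq N Ω u = 0 := by
      unfold l2sq
      rw [lintegral_eq_zero_iff (((hA2 u hu).1.1.pow_const 2).ennreal_ofReal)]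
      filter_upwards [h0] with x hx
      rw [hx]; simp
    unfold rayleighS at h1
    rw [hl] at h1
    have h2 : semiSq N s Ω u = 0 := by
      by_contra h3
      rw [ENNReal.div_zero] at h1
      · exact absurd h1 (by simp)
      · refine mul_ne_zero ?_ h3
        have : 0 < cNs N s / 2 := by positivity
        simpa using this
    exact hne (hA3 u hu (ae_zero_of hN hΩ hΩne (hA2 u hu).1.1 h0 h2))
  obtain ⟨ψ, hψA, hψ⟩ := extract_ortho hn A hA1 hL hz
  refine ⟨ψ, fun i => (hA2 _ (hψA i)).1, fun i => (hA2 _ (hψA i)).2, hψ, fun a => ?_⟩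
  by_cases ha : ∑ i, (a i) ^ 2 = 0
  · have ha0 : a = 0 := by
      ext i
      have := (Finset.sum_eq_zero_iff_of_nonneg (fun i _ => sq_nonneg (a i))).1 ha i (Finset.mem_univ i)
      simpa using this
    simp [ha0, semiSq]
  have hp : 0 < ∑ i, (a i) ^ 2 := lt_of_le_of_ne (Finset.sum_nonneg fun i _ => sq_nonneg _) (Ne.symm ha)
  have hmem : (∑ i, a i • ψ i) ∈ A := A.sum_mem fun i _ => A.smul_mem _ (hψA i)
  have hne : (∑ i, a i • ψ i) ≠ 0 := by
    intro h
    have := hψ a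
    rw [h] at this
    simp at this
    exact ha this.symm
  have h1 := hray _ hmem hne
  unfold rayleighS at h1
  rw [l2sq_eq (hL _ hmem), hψ a, ← ENNReal.ofReal_toReal (hA2 _ hmem).1.2.2.ne, ← ENNReal.ofReal_mul (by positivity), ← ENNReal.ofReal_div_of_pos hp] at h1
  have h2 := (ENNReal.ofReal_lt_ofReal_iff'.1 h1).1
  rw [div_lt_iff₀ hp] at h2
  exact h2.le


lemma memHs_add_smul {N : ℕ} {s : ℝ} {Ω : Set (Euc N)} {u v : Euc N → ℝ} (hu : memHs N s Ω u) (hv : memHs N s Ω v) (t : ℝ) : 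
    memHs N s Ω (u + t • v) := by
  have h : ∀ i, memHs N s Ω ((![u, v] : Fin 2 → Euc N → ℝ) i) := by
    intro i; fin_cases i
    · exact hu
    · exact hv
  have := memHs_comb h ![1, t]
  simpa [Fin.sum_univ_two] using this

lemma bform_comm (N : ℕ) (s : ℝ) (Ω : Set (Euc N)) (u v : Euc N → ℝ) : bform N s Ω u v = bform N s Ω v u := by
  rw [bform_Tq, bform_Tq]
  simp_rw [mul_comm]

lemma semi_add_smul {N : ℕ} {s : ℝ} {Ω : Set (Euc N)} {u v : Euc N → ℝ} (hu : memHs N s Ω u) (hv : memHs N s Ω v) (t : ℝ) : 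
    (semiSq N s Ω (u + t • v)).toReal = (semiSq N s Ω u).toReal + 2 * t * bform N s Ω u v + t ^ 2 * (semiSq N s Ω v).toReal := by
  have h : ∀ i, memHs N s Ω ((![u, v] : Fin 2 → Euc N → ℝ) i) := by
    intro i; fin_cases i
    · exact hu
    · exact hv
  have := semi_comb h ![1, t]
  simp only [Fin.sum_univ_two, Matrix.cons_val_zero, Matrix.cons_val_one, one_smul] at this
  rw [this, bform_comm N s Ω v u, bform_self hu, bform_self hv]
  ring

lemma norm_add_smul {α F : Type*} [MeasurableSpace α] {μ : Measure α} [NormedAddCommGroup F] [InnerProductSpace ℝ F]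
    {f g : α → F} (hf : MemLp f 2 μ) (hg : MemLp g 2 μ) (t : ℝ) :
    ∫ x, ‖f x + t • g x‖ ^ 2 ∂μ = (∫ x, ‖f x‖ ^ 2 ∂μ) + 2 * t * (∫ x, (inner ℝ (f x) (g x) : ℝ) ∂μ) + t ^ 2 * ∫ x, ‖g x‖ ^ 2 ∂μ := by
  have h : ∀ i, MemLp ((![f, g] : Fin 2 → α → F) i) 2 μ := by
    intro i; fin_cases i
    · exact hf
    · exact hg
  have := quad_expand _ h ![1, t]
  simp only [Fin.sum_univ_two, Matrix.cons_val_zero, Matrix.cons_val_one, one_smul, real_inner_self_eq_norm_sq] at this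
  rw [this]
  have e : (∫ x, (inner ℝ (g x) (f x) : ℝ) ∂μ) = ∫ x, (inner ℝ (f x) (g x) : ℝ) ∂μ := by
    congr 1; ext x; exact real_inner_comm _ _
  rw [e]; ring

lemma gradF_add_smul (N : ℕ) {φ η : Euc N → ℝ} (hφ : ContDiff ℝ (⊤ : ℕ∞) φ) (hη : ContDiff ℝ (⊤ : ℕ∞) η) (t : ℝ) (x : Euc N) :
    gradF N (φ + t • η) x = gradF N φ x + t • gradF N η x := by
  unfold gradF
  have d1 : DifferentiableAt ℝ φ x := (hφ.differentiable (by simp)) x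
  have d2 : DifferentiableAt ℝ η x := (hη.differentiable (by simp)) x
  rw [fderiv_add d1 (d2.const_smul t), fderiv_const_smul d2]
  simp

lemma smooth_polar (N : ℕ) (hN : 2 ≤ N) (Ω : Set (Euc N)) (hΩ : IsLipschitzDomain N Ω) 
    (φ : Euc N → ℝ) (hφ : ContDiff ℝ (⊤ : ℕ∞) φ) (hc : HasCompactSupport φ) 
    (η : Euc N → ℝ) (hη : ContDiff ℝ (⊤ : ℕ∞) η) (hcη : HasCompactSupport η) 
    (sk : ℕ → ℝ) (hsk : ∀ k, sk k ∈ Ioo (0:ℝ) 1) (hlim : Tendsto sk atTop (𝓝 1)) :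
    Tendsto (fun k => cNs N (sk k) / 2 * bform N (sk k) Ω φ η) atTop (𝓝 (∫ x in Ω, (inner ℝ (gradF N φ x) (gradF N η x) : ℝ))) := by
  have hs : ContDiff ℝ (⊤ : ℕ∞) (φ + (1:ℝ) • η) := hφ.add (hη.const_smul (1:ℝ))
  have hsc : HasCompactSupport (φ + (1:ℝ) • η) := hc.add (by simpa using hcη)
  have h1 := smooth_tendsto N hN Ω hΩ φ hφ hc sk hsk hlim
  have h2 := smooth_tendsto N hN Ω hΩ η hη hcη sk hsk hlim
  have h3 := smooth_tendsto N hN Ω hΩ _ hs hsc sk hsk hlim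
  have h4 := ((h3.sub h1).sub h2).div_const 2
  have e1 : ((∫ x in Ω, ‖gradF N (φ + (1:ℝ) • η) x‖ ^ 2) - (∫ x in Ω, ‖gradF N φ x‖ ^ 2) - (∫ x in Ω, ‖gradF N η x‖ ^ 2)) / 2 
      = ∫ x in Ω, (inner ℝ (gradF N φ x) (gradF N η x) : ℝ) := by
    simp_rw [gradF_add_smul N hφ hη]
    rw [norm_add_smul ((gradF_memLp N φ hφ hc).restrict _) ((gradF_memLp N η hη hcη).restrict _)]
    ring
  rw [e1] at h4
  refine h4.congr fun k => ?_
  rw [semi_add_smul (smooth_memHs N hN Ω hΩ φ hφ hc _ (hsk k)) (smooth_memHs N hN Ω hΩ η hη hcη _ (hsk k))]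
  ring

lemma Tq_sub_const (N : ℕ) (s : ℝ) (u : Euc N → ℝ) (c : ℝ) : Tq N s (fun x => u x - c) = Tq N s u := by
  ext q; simp [Tq]

lemma center_le {α : Type*} [MeasurableSpace α] {μ : Measure α} [IsFiniteMeasure μ] {f : α → ℝ} (hf : MemLp f 2 μ) :
    ∫ x, (f x - (∫ y, f y ∂μ) / μ.real univ) ^ 2 ∂μ ≤ ∫ x, (f x) ^ 2 ∂μ := by
  have hi : Integrable f μ := hf.integrable (by norm_num)
  have hi2 : Integrable (fun x => (f x) ^ 2) μ := (memLp_two_iff_integrable_sq hf.1).1 hf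
  set c := (∫ y, f y ∂μ) / μ.real univ with hc
  have h1 : ∀ x, (f x - c) ^ 2 = (f x) ^ 2 + ((-2 * c) * f x + c ^ 2) := fun x => by ring
  simp_rw [h1]
  have hi3 : Integrable (fun x => (-2 * c) * f x + c ^ 2) μ := (hi.const_mul _).add (integrable_const _)
  rw [integral_add hi2 hi3, integral_add (hi.const_mul _) (integrable_const _), integral_const_mul, integral_const]
  by_cases h0 : μ.real univ = 0
  · have : c = 0 := by rw [hc, h0, div_zero]
    simp [this]
  · have : ∫ y, f y ∂μ = c * μ.real univ := by rw [hc]; field_simp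
    rw [this, smul_eq_mul]
    have : 0 ≤ μ.real univ := measureReal_nonneg
    nlinarith [mul_nonneg this (sq_nonneg c)]

lemma int_inner_coord {N : ℕ} {μ : Measure (Euc N)} {f h : Euc N → Euc N} (hf : MemLp f 2 μ) (hh : MemLp h 2 μ) :
    ∫ x, (inner ℝ (f x) (h x) : ℝ) ∂μ = ∑ l, ∫ x, f x l * h x l ∂μ := by
  have hi : ∀ l ∈ (Finset.univ : Finset (Fin N)), Integrable (fun x => f x l * h x l) μ := fun l _ => 
    (memLp_coord hf l).integrable_mul (memLp_coord hh l)
  rw [← integral_finsetSum _ hi]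
  congr 1; ext x
  exact inner_coord N _ _

lemma limsup_mu (N : ℕ) (hN : 2 ≤ N) (n : ℕ) (hn : 1 ≤ n) (Ω : Set (Euc N)) (hΩ : IsLipschitzDomain N Ω) 
    (sk : ℕ → ℝ) (hsk : ∀ k, sk k ∈ Ioo (0:ℝ) 1) (hlim : Tendsto sk atTop (𝓝 1)) (K : ℝ) (hK : muN1 N Ω n < ENNReal.ofReal K) :
    ∀ᶠ k in atTop, muNs N (sk k) Ω n ≤ ENNReal.ofReal K := by
  have hfin := vol_ne_top hΩ
  haveI : IsFiniteMeasure (volume.restrict Ω) := ⟨by rw [Measure.restrict_apply_univ]; exact hfin.lt_top⟩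
  obtain ⟨K1, hK1, hK1K⟩ : ∃ K1, muN1 N Ω n < ENNReal.ofReal K1 ∧ K1 < K := by
    obtain ⟨c, hc1, hc2⟩ := exists_between hK
    have hct : c ≠ ⊤ := (hc2.trans ENNReal.ofReal_lt_top).ne
    refine ⟨c.toReal, by rwa [ENNReal.ofReal_toReal hct], ?_⟩
    exact (ENNReal.lt_ofReal_iff_toReal_lt hct).1 hc2
  obtain ⟨ψ, g, hm, hL, hg, h0, ho, hE⟩ := extract_N1 hn hΩ.1 hfin K1 hK1
  choose φ hφ hφc hφ1 hφ2 using fun i => approx_seq N hN Ω hΩ (ψ i) (hm i) (hL i) (g i) (hg i)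
  have hφL : ∀ i m, MemLp (φ i m) 2 (volume.restrict Ω) := fun i m => ((hφ i m).continuous.memLp_of_hasCompactSupport (hφc i m)).restrict _
  set av : Fin n → ℕ → ℝ := fun i m => (∫ y in Ω, φ i m y) / (volume.restrict Ω).real univ with hav
  let φc : Fin n → ℕ → Euc N → ℝ := fun i m x => φ i m x - av i m
  have hφcL : ∀ i m, MemLp (φc i m) 2 (volume.restrict Ω) := fun i m => (hφL i m).sub (memLp_const _)
  have hIntg : ∀ i m, Integrable (φ i m) (volume.restrict Ω) := fun i m => (hφL i m).integrable (by norm_num)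
  have hVpos : (volume.restrict Ω).real univ ≠ 0 := by
    rw [measureReal_def, Measure.restrict_apply_univ]
    exact (ENNReal.toReal_pos (hΩ.1.measure_pos _ hΩ.2.2.1.nonempty).ne' hfin).ne'
  have hφc0 : ∀ i m, ∫ x in Ω, φc i m x = 0 := by
    intro i m
    have : ∫ x in Ω, φc i m x = (∫ x in Ω, φ i m x) - ∫ x in Ω, av i m := integral_sub (hIntg i m) (integrable_const _)
    rw [this, integral_const, hav, smul_eq_mul]
    field_simp
    simp
  have hφcc : ∀ i, Tendsto (fun m => ∫ x in Ω, (φc i m x - ψ i x) ^ 2) atTop (𝓝 0) := by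
    intro i
    refine squeeze_zero (fun k => integral_nonneg fun x => sq_nonneg _) (fun m => ?_) (hφ1 i)
    have hd : MemLp (fun x => φ i m x - ψ i x) 2 (volume.restrict Ω) := (hφL i m).sub (hL i)
    have h1 := center_le hd
    rw [integral_sub (hIntg i m) ((hL i).integrable (by norm_num)), h0 i, sub_zero] at h1
    refine le_trans (le_of_eq ?_) h1
    congr 1; ext x
    simp only [φc, hav]; ring
  have hG : ∀ i j, Tendsto (fun m => ∫ x in Ω, φc i m x * φc j m x) atTop (𝓝 (∫ x in Ω, ψ i x * ψ j x)) := fun i j => 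
    tendsto_int_mul _ _ _ _ (hφcL i) (hL i) (hφcL j) (hL j) (hφcc i) (hφcc j)
  have hgL : ∀ i m, MemLp (gradF N (φ i m)) 2 (volume.restrict Ω) := fun i m => (gradF_memLp N _ (hφ i m) (hφc i m)).restrict _
  have hcoord : ∀ (f h : Euc N → Euc N), MemLp f 2 (volume.restrict Ω) → MemLp h 2 (volume.restrict Ω) → 
      ∫ x in Ω, (inner ℝ (f x) (h x) : ℝ) = ∑ l, ∫ x in Ω, f x l * h x l := by
    exact fun f h hf hh => int_inner_coord hf hh
  have hD : ∀ i j, Tendsto (fun m => ∫ x in Ω, (inner ℝ (gradF N (φ i m) x) (gradF N (φ j m) x) : ℝ)) atTop (𝓝 (∫ x in Ω, (inner ℝ (g i x) (g j x) : ℝ))) := by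
    intro i j
    rw [hcoord _ _ (weakGrad_memLp (hg i)) (weakGrad_memLp (hg j))]
    have : (fun m => ∫ x in Ω, (inner ℝ (gradF N (φ i m) x) (gradF N (φ j m) x) : ℝ)) = fun m => ∑ l, ∫ x in Ω, gradF N (φ i m) x l * gradF N (φ j m) x l := by
      ext m; exact hcoord _ _ (hgL i m) (hgL j m)
    rw [this]
    apply tendsto_finsetSum
    intro l _
    exact tendsto_int_mul _ _ _ _ (fun m => memLp_coord (hgL i m) l) (memLp_coord (weakGrad_memLp (hg i)) l)
      (fun m => memLp_coord (hgL j m) l) (memLp_coord (weakGrad_memLp (hg j)) l) (hφ2 i l) (hφ2 j l)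
  have hXY : ∀ (G D : Fin n → Fin n → ℝ) (a : Fin n → ℝ), ∑ i, ∑ j, a i * a j * (K * G i j - D i j) 
      = K * (∑ i, ∑ j, a i * a j * G i j) - ∑ i, ∑ j, a i * a j * D i j := by
    intro G D a
    simp only [mul_sub, Finset.sum_sub_distrib, Finset.mul_sum]
    congr 1
    apply Finset.sum_congr rfl; intro i _
    apply Finset.sum_congr rfl; intro j _
    ring
  have ev1 := mat_pos (fun m i j => ∫ x in Ω, φc i m x * φc j m x) _ hG 1 (1 / 2) (by norm_num) (fun a => by
    rw [← l2_comb hL a, ho a, one_mul])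
  have ev2 := mat_pos (fun m i j => K * (∫ x in Ω, φc i m x * φc j m x) - ∫ x in Ω, (inner ℝ (gradF N (φ i m) x) (gradF N (φ j m) x) : ℝ)) _ 
    (fun i j => ((hG i j).const_mul K).sub (hD i j)) (K - K1) ((K - K1) / 2) (by linarith) (fun a => by
      rw [hXY, ← l2_comb hL a, ho a, ← grad_comb (fun i => weakGrad_memLp (hg i)) a]
      linarith [hE a])
  obtain ⟨m, hm1, hm2⟩ := (ev1.and ev2).exists
  have ev3 := mat_pos (fun k i j => K * (∫ x in Ω, φc i m x * φc j m x) - cNs N (sk k) / 2 * bform N (sk k) Ω (φ i m) (φ j m)) _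
    (fun i j => (tendsto_const_nhds).sub (smooth_polar N hN Ω hΩ _ (hφ i m) (hφc i m) _ (hφ j m) (hφc j m) sk hsk hlim)) _ 0 (by linarith) hm2
  filter_upwards [ev3] with k hk
  have hmH : ∀ i, memHs N (sk k) Ω (φc i m) := by
    intro i
    refine memHs_of ((hφ i m).continuous.measurable.sub_const _) (hφcL i m) ?_
    have : Tq N (sk k) (φc i m) = Tq N (sk k) (φ i m) := Tq_sub_const N _ _ _
    rw [this]
    exact Tq_memLp (smooth_memHs N hN Ω hΩ _ (hφ i m) (hφc i m) _ (hsk k))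
  have hbf : ∀ i j, bform N (sk k) Ω (φc i m) (φc j m) = bform N (sk k) Ω (φ i m) (φ j m) := by
    intro i j
    rw [bform_Tq, bform_Tq]
    have h1 : Tq N (sk k) (φc i m) = Tq N (sk k) (φ i m) := Tq_sub_const N _ _ _
    have h2 : Tq N (sk k) (φc j m) = Tq N (sk k) (φ j m) := Tq_sub_const N _ _ _
    rw [h1, h2]
  refine muNs_le hfin (hsk k) (fun i => φc i m) hmH (fun i => hφc0 i m) K ?_ ?_
  · intro a ha
    rw [l2_comb (fun i => hφcL i m)]
    refine lt_of_lt_of_le ?_ (hm1 a)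
    have : 0 < ∑ i, (a i) ^ 2 := by
      obtain ⟨i, hi⟩ := Function.ne_iff.1 ha
      refine Finset.sum_pos' (fun i _ => sq_nonneg _) ⟨i, Finset.mem_univ _, ?_⟩
      have : a i ≠ 0 := hi
      positivity
    positivity
  · intro a
    have h1 := hk a
    rw [hXY, zero_mul] at h1
    rw [l2_comb (fun i => hφcL i m), semi_comb hmH]
    simp_rw [hbf]
    have h2 : ∑ i, ∑ j, a i * a j * (cNs N (sk k) / 2 * bform N (sk k) Ω (φ i m) (φ j m)) = cNs N (sk k) / 2 * ∑ i, ∑ j, a i * a j * bform N (sk k) Ω (φ i m) (φ j m) := by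
      simp only [Finset.mul_sum]
      apply Finset.sum_congr rfl; intro i _
      apply Finset.sum_congr rfl; intro j _
      ring
    rw [h2] at h1
    linarith


lemma diag_sub {n : ℕ} (P : Fin n → (ℕ → ℕ) → Prop) (hst : ∀ i (φ χ : ℕ → ℕ), StrictMono χ → P i φ → P i (φ ∘ χ))
    (hex : ∀ i (φ : ℕ → ℕ), StrictMono φ → ∃ χ : ℕ → ℕ, StrictMono χ ∧ P i (φ ∘ χ)) : ∃ φ : ℕ → ℕ, StrictMono φ ∧ ∀ i, P i φ := by
  classical
  have : ∀ S : Finset (Fin n), ∃ φ : ℕ → ℕ, StrictMono φ ∧ ∀ i ∈ S, P i φ := by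
    intro S
    induction S using Finset.induction_on with
    | empty => exact ⟨id, strictMono_id, by simp⟩
    | insert i S _ ih =>
      obtain ⟨φ, hφ, h⟩ := ih
      obtain ⟨χ, hχ, h2⟩ := hex i φ hφ
      refine ⟨φ ∘ χ, hφ.comp hχ, fun j hj => ?_⟩
      rcases Finset.mem_insert.1 hj with rfl | hj
      · exact h2
      · exact hst j φ χ hχ (h j hj)
  obtain ⟨φ, hφ, h⟩ := this Finset.univ
  exact ⟨φ, hφ, fun i => h i (Finset.mem_univ i)⟩

lemma comb_tendsto {N n : ℕ} {Ω : Set (Euc N)} (w : Fin n → ℕ → Euc N → ℝ) (w0 : Fin n → Euc N → ℝ)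
    (hw : ∀ i k, MemLp (w i k) 2 (volume.restrict Ω)) (hw0 : ∀ i, MemLp (w0 i) 2 (volume.restrict Ω))
    (h : ∀ i, Tendsto (fun k => ∫ x in Ω, (w i k x - w0 i x) ^ 2) atTop (𝓝 0)) (a : Fin n → ℝ) :
    Tendsto (fun k => ∫ x in Ω, ((∑ i, a i • w i k) x - (∑ i, a i • w0 i) x) ^ 2) atTop (𝓝 0) := by
  have hd : ∀ i k, MemLp (fun x => w i k x - w0 i x) 2 (volume.restrict Ω) := fun i k => (hw i k).sub (hw0 i)
  have e : ∀ k, ∫ x in Ω, ((∑ i, a i • w i k) x - (∑ i, a i • w0 i) x) ^ 2 = ∑ i, ∑ j, a i * a j * ∫ x in Ω, (w i k x - w0 i x) * (w j k x - w0 j x) := by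
    intro k
    rw [← quad_expand_real _ (fun i => hd i k) a]
    congr 1; ext x
    simp only [Finset.sum_apply, Pi.smul_apply, smul_eq_mul]
    rw [← Finset.sum_sub_distrib]
    simp only [mul_sub]
  simp_rw [e]
  have : Tendsto (fun k => ∑ i, ∑ j, a i * a j * ∫ x in Ω, (w i k x - w0 i x) * (w j k x - w0 j x)) atTop (𝓝 (∑ i : Fin n, ∑ j : Fin n, a i * a j * 0)) := by
    refine tendsto_finsetSum _ fun i _ => tendsto_finsetSum _ fun j _ => Tendsto.const_mul _ ?_
    have := tendsto_int_mul (μ := volume.restrict Ω) (fun k x => w i k x - w0 i x) (fun k x => w j k x - w0 j x) (fun _ => 0) (fun _ => 0)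
      (hd i) MemLp.zero' (hd j) MemLp.zero' (by simpa using h i) (by simpa using h j)
    simpa using this
  simpa using this

lemma single_comb {M : Type*} [AddCommGroup M] [Module ℝ M] {n : ℕ} (f : Fin n → M) (i : Fin n) : ∑ j, (Pi.single i (1:ℝ) : Fin n → ℝ) j • f j = f i := by
  rw [Finset.sum_eq_single i]
  · simp
  · intro j _ hj
    simp [Pi.single_eq_of_ne hj]
  · simp

lemma liminf_mu (N : ℕ) (hN : 2 ≤ N) (n : ℕ) (hn : 1 ≤ n) (Ω : Set (Euc N)) (hΩ : IsLipschitzDomain N Ω) 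
    (sk : ℕ → ℝ) (hsk : ∀ k, sk k ∈ Ioo (0:ℝ) 1) (hlim : Tendsto sk atTop (𝓝 1)) (K : ℝ) 
    (hK : ∀ k, muNs N (sk k) Ω n < ENNReal.ofReal K) : muN1 N Ω n ≤ ENNReal.ofReal K := by
  have hfin := vol_ne_top hΩ
  haveI : IsFiniteMeasure (volume.restrict Ω) := ⟨by rw [Measure.restrict_apply_univ]; exact hfin.lt_top⟩
  choose ψ hH h0 ho hE using fun k => extract_Ns hN hn (hsk k) hΩ.1 hΩ.2.2.1.nonempty K (hK k)
  have hL : ∀ k i, MemLp (ψ k i) 2 (volume.restrict Ω) := fun k i => memHs_memLp (hH k i)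
  have ho1 : ∀ k i, ∫ x in Ω, (ψ k i x) ^ 2 = 1 := by
    intro k i
    have := ho k (Pi.single i 1)
    rw [single_comb] at this
    rw [this, Finset.sum_eq_single i]
    · simp
    · intro j _ hj
      simp [Pi.single_eq_of_ne hj]
    · simp
  have hs1 : ∀ i : Fin n, ∑ j, ((Pi.single i (1:ℝ) : Fin n → ℝ) j) ^ 2 = 1 := by
    intro i
    rw [Finset.sum_eq_single i]
    · simp
    · intro j _ hj
      simp [Pi.single_eq_of_ne hj]
    · simp
  have hE1 : ∀ k i, cNs N (sk k) / 2 * (semiSq N (sk k) Ω (ψ k i)).toReal ≤ K := by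
    intro k i
    have := hE k (Pi.single i 1)
    rwa [single_comb, hs1, mul_one] at this
  obtain ⟨χ, hχ, hP⟩ := diag_sub (n := n) (fun i χ => ∃ w0 : Euc N → ℝ, Measurable w0 ∧ MemLp w0 2 (volume.restrict Ω) ∧
      Tendsto (fun k => ∫ x in Ω, (ψ (χ k) i x - w0 x) ^ 2) atTop (𝓝 0)) (by
    rintro i φ χ hχ ⟨w0, h1, h2, h3⟩
    exact ⟨w0, h1, h2, h3.comp hχ.tendsto_atTop⟩) (by
    intro i φ hφ
    obtain ⟨χ, hχ, w0, h1, h2, h3⟩ := compact_seq N hN Ω hΩ (sk ∘ φ) (fun k => hsk _) (hlim.comp hφ.tendsto_atTop) (fun k => ψ (φ k) i) (fun k => hH _ i) 1 K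
      (fun k => (ho1 _ i).le) (fun k => hE1 _ i)
    exact ⟨χ, hχ, w0, h1, h2, h3⟩)
  choose w0 hm hw0 hcv using hP
  have hcomb := fun a => comb_tendsto (fun i k => ψ (χ k) i) w0 (fun i k => hL _ i) hw0 hcv a
  have hwl : ∀ a : Fin n → ℝ, ∃ g, IsWeakGradient N Ω (∑ i, a i • w0 i) g ∧ ∫ x in Ω, ‖g x‖ ^ 2 ≤ K * ∑ i, (a i) ^ 2 := by
    intro a
    obtain ⟨g, h1, h2, h3⟩ := weak_liminf N hN Ω hΩ.1 hfin (sk ∘ χ) (fun k => hsk _) (hlim.comp hχ.tendsto_atTop) (fun k => ∑ i, a i • ψ (χ k) i)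
      (fun k => memHs_comb (hH _) a) (∑ i, a i • w0 i) (comb_memLp hw0 a) (hcomb a) (fun _ => K * ∑ i, (a i) ^ 2) (K * ∑ i, (a i) ^ 2) tendsto_const_nhds
      (fun k => hE _ a)
    exact ⟨g, h1, h3⟩
  have hg : ∀ i, ∃ g, IsWeakGradient N Ω (w0 i) g := by
    intro i
    obtain ⟨g, h1, _⟩ := hwl (Pi.single i 1)
    rw [single_comb] at h1
    exact ⟨g, h1⟩
  choose g hg using hg
  have hn2 : ∀ a : Fin n → ℝ, ∫ x in Ω, ((∑ i, a i • w0 i) x) ^ 2 = ∑ i, (a i) ^ 2 := by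
    intro a
    have := tendsto_int_mul (μ := volume.restrict Ω) (fun k => ∑ i, a i • ψ (χ k) i) (fun k => ∑ i, a i • ψ (χ k) i) (∑ i, a i • w0 i) (∑ i, a i • w0 i)
      (fun k => comb_memLp (hL _) a) (comb_memLp hw0 a) (fun k => comb_memLp (hL _) a) (comb_memLp hw0 a) (hcomb a) (hcomb a)
    simp only [← sq, ho] at this
    exact (tendsto_nhds_unique this tendsto_const_nhds)
  refine muN1_le hΩ.1 hfin w0 g hm hw0 hg ?_ K ?_ ?_
  · intro i
    have := tendsto_int_mul (μ := volume.restrict Ω) (fun k => ψ (χ k) i) (fun k _ => 1) (w0 i) (fun _ => 1) (fun k => hL _ i) (hw0 i)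
      (fun k => memLp_const 1) (memLp_const 1) (hcv i) (by simp)
    simp only [mul_one, h0] at this
    exact (tendsto_nhds_unique this tendsto_const_nhds)
  · intro a ha
    rw [hn2]
    obtain ⟨i, hi⟩ := Function.ne_iff.1 ha
    refine Finset.sum_pos' (fun i _ => sq_nonneg _) ⟨i, Finset.mem_univ _, ?_⟩
    have : a i ≠ 0 := hi
    positivity
  · intro a
    obtain ⟨g', h1, h2⟩ := hwl a
    rw [hn2]
    refine le_trans (le_of_eq ?_) h2
    apply integral_congr_ae
    filter_upwards [weakGrad_unique hΩ.1 hfin (weakGrad_comb hfin w0 g hw0 hg a) h1] with x hx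
    rw [hx]

lemma muN1_finite (N : ℕ) (hN : 2 ≤ N) (n : ℕ) (hn : 1 ≤ n) (Ω : Set (Euc N)) (hΩ : IsLipschitzDomain N Ω) : muN1 N Ω n < ⊤ := by
  have hfin := vol_ne_top hΩ
  haveI : IsFiniteMeasure (volume.restrict Ω) := ⟨by rw [Measure.restrict_apply_univ]; exact hfin.lt_top⟩
  haveI : Nontrivial (Euc N) := by
    haveI : Nonempty (Fin N) := ⟨⟨0, by omega⟩⟩
    infer_instance
  have hinf : Ω.Infinite := by
    obtain ⟨x, hx⟩ := hΩ.2.2.1.nonempty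
    exact infinite_of_mem_nhds x (hΩ.1.mem_nhds hx)
  let p : ℕ → Euc N := fun k => (hinf.natEmbedding Ω k : Euc N)
  have hpΩ : ∀ k, p k ∈ Ω := fun k => (hinf.natEmbedding Ω k).2
  have hpinj : Function.Injective p := Subtype.val_injective.comp (hinf.natEmbedding Ω).injective
  have hb : ∀ k : ℕ, ∃ f : Euc N → ℝ, tsupport f ⊆ Ω ∩ (((Finset.range (n + 1)).erase k).image p : Set (Euc N))ᶜ ∧ HasCompactSupport f ∧ 
      ContDiff ℝ (⊤ : ℕ∞) f ∧ range f ⊆ Icc 0 1 ∧ f (p k) = 1 := by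
    intro k
    apply exists_contDiff_tsupport_subset
    apply IsOpen.mem_nhds (hΩ.1.inter (Finset.finite_toSet _).isClosed.isOpen_compl)
    refine ⟨hpΩ k, ?_⟩
    intro h
    obtain ⟨j, hj, hjk⟩ := Finset.mem_image.1 (Finset.mem_coe.1 h)
    exact (Finset.mem_erase.1 hj).1 (hpinj hjk)
  choose b hbs hbc hbd hb01 hb1 using hb
  have hb0 : ∀ k j, j ∈ Finset.range (n + 1) → j ≠ k → b k (p j) = 0 := by
    intro k j hj hjk
    apply image_eq_zero_of_notMem_tsupport
    intro h
    exact (hbs k h).2 (Finset.mem_coe.2 (Finset.mem_image.2 ⟨j, Finset.mem_erase.2 ⟨hjk, hj⟩, rfl⟩))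
  have hbΩ : ∀ k x, x ∉ Ω → b k x = 0 := fun k x hx => image_eq_zero_of_notMem_tsupport fun h => hx (hbs k h).1
  have hm0 : 0 < ∫ x in Ω, b 0 x := by
    rw [setIntegral_eq_integral_of_forall_compl_eq_zero (hbΩ 0)]
    refine (hbd 0).continuous.integral_pos_of_hasCompactSupport_nonneg_nonzero (hbc 0) (fun x => (hb01 0 (mem_range_self x)).1) (x := p 0) ?_
    rw [hb1]; norm_num
  let ψ : Fin n → Euc N → ℝ := fun i => b (i + 1) + (-((∫ x in Ω, b (i + 1) x) / ∫ x in Ω, b 0 x)) • b 0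
  have hψd : ∀ i, ContDiff ℝ (⊤ : ℕ∞) (ψ i) := by
    intro i
    have h : ContDiff ℝ (⊤ : ℕ∞) (fun y => b (i + 1) y + (-((∫ x in Ω, b (i + 1) x) / ∫ x in Ω, b 0 x)) • b 0 y) :=
      by
      have h2 : ∀ c : ℝ, ContDiff ℝ (⊤ : ℕ∞) (fun y => c • b 0 y) := fun c => (contDiff_const (c := c)).smul (hbd 0)
      exact (hbd _).add (h2 _)
    exact h
  have hψc : ∀ i, HasCompactSupport (ψ i) := fun i => (hbc _).add ((hbc 0).smul_left (f := fun _ => _))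
  have hψL : ∀ i, MemLp (ψ i) 2 (volume.restrict Ω) := fun i => ((hψd i).continuous.memLp_of_hasCompactSupport (hψc i)).restrict _
  have hψ0 : ∀ i, ∫ x in Ω, ψ i x = 0 := by
    intro i
    have hi : ∀ k, Integrable (b k) (volume.restrict Ω) := fun k => ((hbd k).continuous.integrable_of_hasCompactSupport (hbc k)).restrict
    simp only [ψ, Pi.add_apply, Pi.smul_apply, smul_eq_mul]
    rw [integral_add (hi _) ((hi 0).const_mul _), integral_const_mul]
    field_simp
    ring
  have hval : ∀ (a : Fin n → ℝ) (i : Fin n), (∑ j, a j • ψ j) (p (i + 1)) = a i := by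
    intro a i
    have hb00 : b 0 (p (i + 1)) = 0 := hb0 0 _ (Finset.mem_range.2 (by omega)) (by omega)
    simp only [ψ, Finset.sum_apply, Pi.smul_apply, Pi.add_apply, smul_eq_mul, hb00, mul_zero, add_zero]
    rw [Finset.sum_eq_single i]
    · rw [hb1, mul_one]
    · intro j _ hj
      rw [hb0 _ _ (Finset.mem_range.2 (by omega)) (by
        intro h; apply hj; ext; omega), mul_zero]
    · simp
  have hcont : ∀ a : Fin n → ℝ, Continuous (∑ j, a j • ψ j) := by
    intro a
    have : (∑ i, a i • ψ i) = fun x => ∑ i, a i * ψ i x := by ext x; simp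
    rw [this]
    exact continuous_finset_sum _ fun i _ => continuous_const.mul (hψd i).continuous
  have hpos : ∀ a : Fin n → ℝ, a ≠ 0 → 0 < ∫ x in Ω, ((∑ i, a i • ψ i) x) ^ 2 := by
    intro a ha
    obtain ⟨i, hi⟩ := Function.ne_iff.1 ha
    have hIntg : Integrable (fun x => ((∑ i, a i • ψ i) x) ^ 2) (volume.restrict Ω) := 
      (memLp_two_iff_integrable_sq (comb_memLp hψL a).1).1 (comb_memLp hψL a)
    rw [integral_pos_iff_support_of_nonneg (fun x => sq_nonneg _) hIntg]
    have hop : IsOpen (Function.support fun x => ((∑ i, a i • ψ i) x) ^ 2) := ((hcont a).pow 2).isOpen_support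
    rw [Measure.restrict_apply hop.measurableSet]
    refine (hop.inter hΩ.1).measure_pos volume ?_
    refine ⟨p (i + 1), ?_, hpΩ _⟩
    rw [Function.mem_support, hval]
    exact pow_ne_zero _ hi
  obtain ⟨hf, hex, hz⟩ := span_facts ψ hpos
  have hLA : ∀ u ∈ Submodule.span ℝ (range ψ), MemLp u 2 (volume.restrict Ω) := by
    intro u hu
    obtain ⟨a, rfl⟩ := hex u hu
    exact comb_memLp hψL a
  obtain ⟨η, hηA, hη⟩ := extract_ortho hn _ hf hLA hz
  choose A hA using fun i => hex _ (hηA i)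
  have hw : ∀ i, IsWeakGradient N Ω (η i) (∑ j, A i j • gradF N (ψ j)) := by
    intro i
    rw [← hA i]
    exact weakGrad_comb hfin ψ _ hψL (fun j => smooth_weakGrad N Ω _ (hψd j) (hψc j)) (A i)
  set G : Fin n → Euc N → Euc N := fun i => ∑ j, A i j • gradF N (ψ j) with hG
  have hGL : ∀ i, MemLp (G i) 2 (volume.restrict Ω) := fun i => weakGrad_memLp (hw i)
  refine lt_of_le_of_lt (muN1_le hΩ.1 hfin η G ?_ (fun i => hLA _ (hηA i)) hw ?_ (∑ i, ∑ j, |∫ x in Ω, (inner ℝ (G i x) (G j x) : ℝ)|) ?_ ?_) ENNReal.ofReal_lt_top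
  · intro i
    rw [← hA i]
    exact (hcont _).measurable
  · intro i
    rw [← hA i]
    exact mean_comb (fun i => (hψL i).integrable (by norm_num)) hψ0 _
  · intro a ha
    rw [hη]
    obtain ⟨i, hi⟩ := Function.ne_iff.1 ha
    refine Finset.sum_pos' (fun i _ => sq_nonneg _) ⟨i, Finset.mem_univ _, ?_⟩
    have : a i ≠ 0 := hi
    positivity
  · intro a
    rw [hη, grad_comb hGL a]
    exact (le_abs_self _).trans (mat_bound _ a)


lemma mu_tendsto (N : ℕ) (hN : 2 ≤ N) (n : ℕ) (hn : 1 ≤ n) (Ω : Set (Euc N)) (hΩ : IsLipschitzDomain N Ω)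
    (sk : ℕ → ℝ) (hsk : ∀ k, sk k ∈ Ioo (0:ℝ) 1) (hlim : Tendsto sk atTop (𝓝 1)) :
    Tendsto (fun k => (muNs N (sk k) Ω n).toReal) atTop (𝓝 (muN1 N Ω n).toReal) := by
  have hf := muN1_finite N hN n hn Ω hΩ
  set μ : ℝ := (muN1 N Ω n).toReal with hμ
  have hμe : muN1 N Ω n = ENNReal.ofReal μ := (ENNReal.ofReal_toReal hf.ne).symm
  have hμ0 : 0 ≤ μ := ENNReal.toReal_nonneg
  have hup : ∀ ε > 0, ∀ᶠ k in atTop, muNs N (sk k) Ω n ≤ ENNReal.ofReal (μ + ε) := by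
    intro ε hε
    apply limsup_mu N hN n hn Ω hΩ sk hsk hlim
    rw [hμe]
    exact (ENNReal.ofReal_lt_ofReal_iff (by linarith)).2 (by linarith)
  rw [Metric.tendsto_atTop']
  have key : ∀ ε > 0, ∀ᶠ k in atTop, dist (muNs N (sk k) Ω n).toReal μ < ε := by
    intro ε hε
    have hlow : ∀ᶠ k in atTop, ENNReal.ofReal (μ - ε / 2) ≤ muNs N (sk k) Ω n := by
      by_contra hcon
      rw [not_eventually] at hcon
      obtain ⟨χ, hχ, h⟩ := extraction_of_frequently_atTop hcon
      have h' : ∀ k, muNs N ((sk ∘ χ) k) Ω n < ENNReal.ofReal (μ - ε / 2) := fun k => not_le.1 (h k)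
      have := liminf_mu N hN n hn Ω hΩ (sk ∘ χ) (fun k => hsk _) (hlim.comp hχ.tendsto_atTop) _ h'
      have hpos : 0 < μ - ε / 2 := ENNReal.ofReal_pos.1 (lt_of_le_of_lt (zero_le) (h' 0))
      rw [hμe] at this
      have := (ENNReal.ofReal_le_ofReal_iff hpos.le).1 this
      linarith
    filter_upwards [hlow, hup (ε / 2) (by linarith)] with k h1 h2
    have hk : muNs N (sk k) Ω n ≠ ⊤ := (lt_of_le_of_lt h2 ENNReal.ofReal_lt_top).ne
    have a1 : μ - ε / 2 ≤ (muNs N (sk k) Ω n).toReal := (ENNReal.ofReal_le_iff_le_toReal hk).1 h1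
    have a2 : (muNs N (sk k) Ω n).toReal ≤ μ + ε / 2 := ENNReal.toReal_le_of_le_ofReal (by linarith) h2
    rw [Real.dist_eq, abs_lt]
    constructor <;> linarith
  intro ε hε
  obtain ⟨k0, h⟩ := eventually_atTop.1 (key ε hε)
  exact ⟨k0, fun k hk => h k (le_of_lt hk)⟩

lemma lin_zero {a b : ℝ} (h : ∀ t : ℝ, a + 2 * t * b ≤ 0) : b = 0 := by
  by_contra hb
  have := h ((1 - a) / (2 * b))
  have e : a + 2 * ((1 - a) / (2 * b)) * b = 1 := by field_simp; ring
  linarith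

lemma final (N : ℕ) (hN : 2 ≤ N) (n : ℕ) (hn : 1 ≤ n)
    (Ω : Set (Euc N)) (hΩ : IsLipschitzDomain N Ω)
    (u : ℝ → Euc N → ℝ)
    (hu : ∀ s ∈ Set.Ioo (0 : ℝ) 1, memHs N s Ω (u s) ∧
      (∫ x in Ω, (u s x) ^ 2) = 1 ∧ (∫ x in Ω, u s x) = 0 ∧
      ∀ v : Euc N → ℝ, memHs N s Ω v →
        cNs N s / 2 * bform N s Ω (u s) v =
          (muNs N s Ω n).toReal * ∫ x in Ω, u s x * v x) :
    ∃ sk : ℕ → ℝ, StrictMono sk ∧ (∀ k, sk k ∈ Set.Ioo (0 : ℝ) 1) ∧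
      Filter.Tendsto sk Filter.atTop (nhds 1) ∧
      ∃ (u1 : Euc N → ℝ) (g : Euc N → Euc N),
        Measurable u1 ∧ l2sq N Ω u1 < ⊤ ∧ IsWeakGradient N Ω u1 g ∧
        (∫ x in Ω, (u1 x) ^ 2) = 1 ∧
        (∀ (v : Euc N → ℝ) (gv : Euc N → Euc N), Measurable v → l2sq N Ω v < ⊤ →
          IsWeakGradient N Ω v gv →
          (∫ x in Ω, (inner ℝ (g x) (gv x) : ℝ)) =
            (muN1 N Ω n).toReal * ∫ x in Ω, u1 x * v x) ∧
        Filter.Tendsto (fun k => ∫ x in Ω, (u (sk k) x - u1 x) ^ 2)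
          Filter.atTop (nhds 0) := by
  have hfin := vol_ne_top hΩ
  haveI : IsFiniteMeasure (volume.restrict Ω) := ⟨by rw [Measure.restrict_apply_univ]; exact hfin.lt_top⟩
  set μ : ℝ := (muN1 N Ω n).toReal with hμ
  let s0 : ℕ → ℝ := fun j => 1 - 1 / ((j : ℝ) + 2)
  have hs0m : StrictMono s0 := by
    intro i j hij
    have : (i : ℝ) < j := by exact_mod_cast hij
    have h := one_div_lt_one_div_of_lt (show (0:ℝ) < (i : ℝ) + 2 by positivity) (show (i : ℝ) + 2 < (j : ℝ) + 2 by linarith)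
    show 1 - 1 / ((i : ℝ) + 2) < 1 - 1 / ((j : ℝ) + 2)
    linarith
  have hs0 : ∀ j, s0 j ∈ Ioo (0:ℝ) 1 := by
    intro j
    have h1 : 0 < 1 / ((j : ℝ) + 2) := by positivity
    have h2 : 1 / ((j : ℝ) + 2) < 1 := by
      rw [div_lt_one (by positivity)]
      have : (0:ℝ) ≤ j := Nat.cast_nonneg j
      linarith
    exact ⟨by show 0 < 1 - 1 / ((j : ℝ) + 2); linarith, by show 1 - 1 / ((j : ℝ) + 2) < 1; linarith⟩
  have hs0l : Tendsto s0 atTop (𝓝 1) := by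
    have h : Tendsto (fun j : ℕ => 1 / ((j : ℝ) + 2)) atTop (𝓝 0) := by
      have h2 : Tendsto (fun j : ℕ => (j : ℝ) + 2) atTop atTop := tendsto_atTop_add_const_right _ _ tendsto_natCast_atTop_atTop
      simp only [one_div]
      exact h2.inv_tendsto_atTop
    simpa [s0] using h.const_sub 1
  have hEn : ∀ s ∈ Ioo (0:ℝ) 1, cNs N s / 2 * (semiSq N s Ω (u s)).toReal = (muNs N s Ω n).toReal := by
    intro s hs
    obtain ⟨h1, h2, h3, h4⟩ := hu s hs
    have := h4 _ h1
    simp only [← sq, h2, mul_one] at this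
    rw [← this, bform_self h1]
  have hm0 := mu_tendsto N hN n hn Ω hΩ s0 hs0 hs0l
  obtain ⟨j0, hj0⟩ := eventually_atTop.1 (hm0.eventually_lt_const (show μ < μ + 1 by linarith))
  have hshift : StrictMono (fun k : ℕ => k + j0) := fun a b h => by simpa using h
  let s1 : ℕ → ℝ := fun k => s0 (k + j0)
  obtain ⟨χ, hχ, u1, hu1m, hu1L, hcv⟩ := compact_seq N hN Ω hΩ s1 (fun k => hs0 _) (hs0l.comp hshift.tendsto_atTop) (fun k => u (s1 k))
    (fun k => (hu _ (hs0 _)).1) 1 (μ + 1) (fun k => (hu _ (hs0 _)).2.1.le) (fun k => by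
      rw [hEn _ (hs0 _)]
      exact (hj0 _ (by omega)).le)
  let sk : ℕ → ℝ := fun k => s1 (χ k)
  have hskm : StrictMono sk := (hs0m.comp hshift).comp hχ
  have hsk : ∀ k, sk k ∈ Ioo (0:ℝ) 1 := fun k => hs0 _
  have hlim : Tendsto sk atTop (𝓝 1) := (hs0l.comp hshift.tendsto_atTop).comp hχ.tendsto_atTop
  have hcv : Tendsto (fun k => ∫ x in Ω, (u (sk k) x - u1 x) ^ 2) atTop (𝓝 0) := hcv
  have hmu := mu_tendsto N hN n hn Ω hΩ sk hsk hlim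
  have huH : ∀ k, memHs N (sk k) Ω (u (sk k)) := fun k => (hu _ (hsk k)).1
  have huL : ∀ k, MemLp (u (sk k)) 2 (volume.restrict Ω) := fun k => memHs_memLp (huH k)
  obtain ⟨g, hg, hgL, -⟩ := weak_liminf N hN Ω hΩ.1 hfin sk hsk hlim (fun k => u (sk k)) huH u1 hu1L hcv _ _ hmu (fun k => (hEn _ (hsk k)).le)
  have hsm : ∀ φ : Euc N → ℝ, ContDiff ℝ (⊤ : ℕ∞) φ → HasCompactSupport φ →
      ∫ x in Ω, (inner ℝ (g x) (gradF N φ x) : ℝ) = μ * ∫ x in Ω, u1 x * φ x := by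
    intro φ hφ hc
    have hφL : MemLp φ 2 (volume.restrict Ω) := (hφ.continuous.memLp_of_hasCompactSupport hc).restrict _
    have hgφ : MemLp (gradF N φ) 2 (volume.restrict Ω) := (gradF_memLp N φ hφ hc).restrict _
    have hφH : ∀ k, memHs N (sk k) Ω φ := fun k => smooth_memHs N hN Ω hΩ φ hφ hc _ (hsk k)
    have hEφ := smooth_tendsto N hN Ω hΩ φ hφ hc sk hsk hlim
    have hip := tendsto_int_mul (μ := volume.restrict Ω) (fun k => u (sk k)) (fun _ => φ) u1 φ huL hu1L (fun _ => hφL) hφL hcv (by simp)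
    have hwgφ := smooth_weakGrad N Ω φ hφ hc
    have hE : ∀ t : ℝ, ((∫ x in Ω, ‖g x‖ ^ 2) - μ) + 2 * t * ((∫ x in Ω, (inner ℝ (g x) (gradF N φ x) : ℝ)) - μ * ∫ x in Ω, u1 x * φ x) ≤ 0 := by
      intro t
      obtain ⟨g', h1, h2, h3⟩ := weak_liminf N hN Ω hΩ.1 hfin sk hsk hlim (fun k => u (sk k) + t • φ) (fun k => memHs_add_smul (huH k) (hφH k) t)
        (u1 + t • φ) (hu1L.add (hφL.const_smul t)) (by
          simpa using hcv)
        (fun k => (muNs N (sk k) Ω n).toReal + 2 * t * ((muNs N (sk k) Ω n).toReal * ∫ x in Ω, u (sk k) x * φ x) + t ^ 2 * (cNs N (sk k) / 2 * (semiSq N (sk k) Ω φ).toReal))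
        (μ + 2 * t * (μ * ∫ x in Ω, u1 x * φ x) + t ^ 2 * ∫ x in Ω, ‖gradF N φ x‖ ^ 2)
        ((hmu.add ((hmu.mul hip).const_mul (2 * t))).add (hEφ.const_mul (t ^ 2)))
        (fun k => by
          rw [semi_add_smul (huH k) (hφH k) t, ← (hu _ (hsk k)).2.2.2 φ (hφH k), ← hEn _ (hsk k)]
          apply le_of_eq; ring)
      have hcomb : IsWeakGradient N Ω (u1 + t • φ) (g + t • gradF N φ) := by
        have := weakGrad_comb hfin ![u1, φ] ![g, gradF N φ] (by
          intro i; fin_cases i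
          · exact hu1L
          · exact hφL) (by
          intro i; fin_cases i
          · exact hg
          · exact hwgφ) ![1, t]
        simpa [Fin.sum_univ_two] using this
      have e : ∫ x in Ω, ‖g' x‖ ^ 2 = ∫ x in Ω, ‖g x + t • gradF N φ x‖ ^ 2 := by
        apply integral_congr_ae
        filter_upwards [weakGrad_unique hΩ.1 hfin h1 hcomb] with x hx
        rw [hx]; rfl
      rw [e, norm_add_smul hgL hgφ t] at h3
      linarith
    have := lin_zero hE
    linarith
  refine ⟨sk, hskm, hsk, hlim, u1, g, hu1m, l2sq_lt_top hu1L, hg, ?_, ?_, hcv⟩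
  · have := tendsto_int_mul (μ := volume.restrict Ω) (fun k => u (sk k)) (fun k => u (sk k)) u1 u1 huL hu1L huL hu1L hcv hcv
    simp only [← sq] at this
    refine tendsto_nhds_unique this ?_
    have h1 : ∀ k, ∫ x in Ω, (u (sk k) x) ^ 2 = 1 := fun k => (hu _ (hsk k)).2.1
    simp only [h1]
    exact tendsto_const_nhds
  · intro v gv hvm hv2 hgv
    have hvL := memL2_of hvm hv2
    have hgvL := weakGrad_memLp hgv
    obtain ⟨φ, hφ, hc, hφ1, hφ2⟩ := approx_seq N hN Ω hΩ v hvm hvL gv hgv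
    have hφL : ∀ k, MemLp (φ k) 2 (volume.restrict Ω) := fun k => ((hφ k).continuous.memLp_of_hasCompactSupport (hc k)).restrict _
    have hgφ : ∀ k, MemLp (gradF N (φ k)) 2 (volume.restrict Ω) := fun k => (gradF_memLp N _ (hφ k) (hc k)).restrict _
    have t1 := tendsto_int_mul (μ := volume.restrict Ω) (fun _ => u1) φ u1 v (fun _ => hu1L) hu1L hφL hvL (by simp) hφ1
    have t2 : Tendsto (fun k => ∫ x in Ω, (inner ℝ (g x) (gradF N (φ k) x) : ℝ)) atTop (𝓝 (∫ x in Ω, (inner ℝ (g x) (gv x) : ℝ))) := by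
      rw [int_inner_coord hgL hgvL]
      simp_rw [fun k => int_inner_coord hgL (hgφ k)]
      refine tendsto_finsetSum _ fun l _ => ?_
      exact tendsto_int_mul (μ := volume.restrict Ω) (fun _ x => g x l) (fun k x => gradF N (φ k) x l) (fun x => g x l) (fun x => gv x l)
        (fun _ => memLp_coord hgL l) (memLp_coord hgL l) (fun k => memLp_coord (hgφ k) l) (memLp_coord hgvL l) (by simp) (hφ2 l)
    simp_rw [fun k => hsm (φ k) (hφ k) (hc k)] at t2
    exact tendsto_nhds_unique t2 (t1.const_mul μ)

end FracNeumann
namespace FracNeumann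

/-- Theorem 3.1, eigenfunction convergence: normalized eigenfunctions
associated to `μ_n^{(s)}(Ω)` converge in `L²(Ω)`, along a sequence `s_k → 1⁻`, to an
eigenfunction of the local Neumann Laplacian associated to `μ_n^{(1)}(Ω)`. -/
theorem statement7 (N : ℕ) (hN : 2 ≤ N) (n : ℕ) (hn : 1 ≤ n)
    (Ω : Set (Euc N)) (hΩ : IsLipschitzDomain N Ω)
    (u : ℝ → Euc N → ℝ)
    (hu : ∀ s ∈ Set.Ioo (0 : ℝ) 1, memHs N s Ω (u s) ∧
      (∫ x in Ω, (u s x) ^ 2) = 1 ∧ (∫ x in Ω, u s x) = 0 ∧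
      ∀ v : Euc N → ℝ, memHs N s Ω v →
        cNs N s / 2 * bform N s Ω (u s) v =
          (muNs N s Ω n).toReal * ∫ x in Ω, u s x * v x) :
    ∃ sk : ℕ → ℝ, StrictMono sk ∧ (∀ k, sk k ∈ Set.Ioo (0 : ℝ) 1) ∧
      Filter.Tendsto sk Filter.atTop (nhds 1) ∧
      ∃ (u1 : Euc N → ℝ) (g : Euc N → Euc N),
        Measurable u1 ∧ l2sq N Ω u1 < ⊤ ∧ IsWeakGradient N Ω u1 g ∧
        (∫ x in Ω, (u1 x) ^ 2) = 1 ∧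
        (∀ (v : Euc N → ℝ) (gv : Euc N → Euc N), Measurable v → l2sq N Ω v < ⊤ →
          IsWeakGradient N Ω v gv →
          (∫ x in Ω, (inner ℝ (g x) (gv x) : ℝ)) =
            (muN1 N Ω n).toReal * ∫ x in Ω, u1 x * v x) ∧
        Filter.Tendsto (fun k => ∫ x in Ω, (u (sk k) x - u1 x) ^ 2)
          Filter.atTop (nhds 0) := by
  exact final N hN n hn Ω hΩ u hu

end FracNeumann
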